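/- arXiv:1702.01627 — 3 statements merged into one kernel-verified Lean document; each statement's English description precedes it below -/
import Mathlib

section
/- For every positive integer n with n ≡ 1, 2, 5, or 6 (mod 8), r_3(n) = 12·H(4n). -/
/-- `r₃ n` is the number of ordered triples `(x,y,z) ∈ ℤ³` with `x² + y² + z² = n`. -/
noncomputable def r3 (n : ℕ) : ℕ :=
  Set.ncard {v : ℤ × ℤ × ℤ | v.1 ^ 2 + v.2.1 ^ 2 + v.2.2 ^ 2 = (n : ℤ)}

/-- The set of reduced positive definite binary quadratic forms `(a,b,c)` of
discriminant `−N`: `a > 0`, `b² − 4ac = −N`, `|b| ≤ a ≤ c`, and `b ≥ 0` whenever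
`|b| = a` or `a = c`. -/
def reducedForms (N : ℕ) : Set (ℤ × ℤ × ℤ) :=
  {t | 0 < t.1 ∧ t.2.1 ^ 2 - 4 * t.1 * t.2.2 = -(N : ℤ) ∧
    |t.2.1| ≤ t.1 ∧ t.1 ≤ t.2.2 ∧ ((|t.2.1| = t.1 ∨ t.1 = t.2.2) → 0 ≤ t.2.1)}

/-- The Hurwitz weight of a form `(a,b,c)`: `1/2` if `b = 0` and `a = c`, `1/3` if
`a = b = c`, and `1` otherwise. -/
def hurwitzWeight (t : ℤ × ℤ × ℤ) : ℚ :=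
  if t.2.1 = 0 ∧ t.1 = t.2.2 then 1/2
  else if t.1 = t.2.1 ∧ t.2.1 = t.2.2 then 1/3
  else 1

/-- The Hurwitz class number `H(N)`, as the weighted count of reduced positive definite
binary quadratic forms of discriminant `−N`. -/
noncomputable def hurwitzClassNumber (N : ℕ) : ℚ :=
  ∑ᶠ t ∈ reducedForms N, hurwitzWeight t


theorem neg_one_zpow_congr {a b : ℤ} (h : Even (a - b)) : (-1 : ℝ) ^ a = (-1) ^ b := by
  have : a = b + (a - b) := by ring
  rw [this, zpow_add₀ (by norm_num), h.neg_one_zpow, mul_one]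

/-- The triples `(i, d, e)` with `d, e > 0` and `i² + d e = n`. -/
noncomputable def windmill (n : ℕ) : Finset (ℤ × ℤ × ℤ) :=
  (Finset.Icc (-n : ℤ) n ×ˢ Finset.Icc 1 (n : ℤ) ×ˢ Finset.Icc 1 (n : ℤ)).filter
    fun t => t.1 ^ 2 + t.2.1 * t.2.2 = n

theorem mem_windmill {n : ℕ} {t : ℤ × ℤ × ℤ} :
    t ∈ windmill n ↔ 0 < t.2.1 ∧ 0 < t.2.2 ∧ t.1 ^ 2 + t.2.1 * t.2.2 = n := by
  obtain ⟨i, d, e⟩ := t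
  simp only [windmill, Finset.mem_filter, Finset.mem_product, Finset.mem_Icc]
  constructor
  · rintro ⟨⟨_, ⟨h1, _⟩, h2, _⟩, h⟩
    exact ⟨by omega, by omega, h⟩
  · rintro ⟨h1, h2, h⟩
    have h3 : 0 < d * e := mul_pos h1 h2
    refine ⟨⟨⟨?_, ?_⟩, ⟨by omega, ?_⟩, by omega, ?_⟩, h⟩ <;> nlinarith [sq_nonneg i]

/-- The sign attached to a triple. -/
noncomputable def windmillSign (t : ℤ × ℤ × ℤ) : ℝ := (-1) ^ (t.1 + t.2.1 + t.2.2)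

theorem sum_windmill_neg {n : ℕ} (f : ℤ → ℤ → ℤ → ℝ) :
    ∑ t ∈ windmill n, f t.1 t.2.1 t.2.2 = ∑ t ∈ windmill n, f (-t.1) t.2.1 t.2.2 := by
  refine Finset.sum_nbij' (fun t => (-t.1, t.2)) (fun t => (-t.1, t.2)) ?_ ?_ ?_ ?_ ?_ <;>
    simp [mem_windmill]

theorem sum_windmill_swap {n : ℕ} (f : ℤ → ℤ → ℤ → ℝ) :
    ∑ t ∈ windmill n, f t.1 t.2.1 t.2.2 = ∑ t ∈ windmill n, f t.1 t.2.2 t.2.1 := by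
  refine Finset.sum_nbij' (fun t => (t.1, t.2.2, t.2.1)) (fun t => (t.1, t.2.2, t.2.1))
    ?_ ?_ ?_ ?_ ?_ <;> simp +contextual [mem_windmill, mul_comm]

theorem windmillSign_congr {t t' : ℤ × ℤ × ℤ}
    (h : Even (t.1 + t.2.1 + t.2.2 - (t'.1 + t'.2.1 + t'.2.2))) :
    windmillSign t = windmillSign t' := neg_one_zpow_congr h

theorem windmill_sum_pos {n : ℕ} (F : ℤ → ℝ) :
    ∑ t ∈ windmill n with t.2.1 + 2 * t.1 < t.2.2, windmillSign t * F (t.2.2 - 2 * t.1) =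
      ∑ t ∈ windmill n with t.2.1 < 2 * t.1 + t.2.2, windmillSign t * F (t.2.1 + t.2.2) := by
  refine Finset.sum_nbij' (fun t => (t.1 + t.2.1, t.2.1, t.2.2 - 2 * t.1 - t.2.1))
    (fun t => (t.1 - t.2.1, t.2.1, t.2.2 + 2 * t.1 - t.2.1)) ?_ ?_ ?_ ?_ ?_ <;>
    rintro ⟨i, d, e⟩ h <;> simp only [Finset.mem_filter, mem_windmill] at h ⊢
  · exact ⟨⟨by omega, by omega, by linarith [h.1.2.2]⟩, by omega⟩
  · exact ⟨⟨by omega, by omega, by linarith [h.1.2.2]⟩, by omega⟩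
  · ext <;> dsimp only <;> ring
  · ext <;> dsimp only <;> ring
  · congr 1
    · exact windmillSign_congr ⟨i, by dsimp only; ring⟩
    · congr 1; ring

theorem windmill_sum_neg {n : ℕ} (F : ℤ → ℝ) (hF : ∀ x, F (-x) = -F x) :
    ∑ t ∈ windmill n with t.2.2 < t.2.1 + 2 * t.1, windmillSign t * F (t.2.2 - 2 * t.1) = 0 := by
  rw [← self_eq_neg, ← Finset.sum_neg_distrib]
  refine Finset.sum_nbij' (fun t => (t.2.2 - t.1, 2 * t.1 + t.2.1 - t.2.2, t.2.2))
    (fun t => (t.2.2 - t.1, 2 * t.1 + t.2.1 - t.2.2, t.2.2)) ?_ ?_ ?_ ?_ ?_ <;>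
    rintro ⟨i, d, e⟩ h <;> simp only [Finset.mem_filter, mem_windmill] at h ⊢
  · exact ⟨⟨by omega, by omega, by linarith [h.1.2.2]⟩, by omega⟩
  · exact ⟨⟨by omega, by omega, by linarith [h.1.2.2]⟩, by omega⟩
  · ext <;> dsimp only <;> ring
  · ext <;> dsimp only <;> ring
  · rw [← mul_neg, ← hF]
    congr 1
    · exact windmillSign_congr ⟨0, by dsimp only; ring⟩
    · congr 1; ring

theorem windmill_sum_half {n : ℕ} (F : ℤ → ℝ) :
    2 * ∑ t ∈ windmill n with t.2.1 < 2 * t.1 + t.2.2, windmillSign t * F (t.2.1 + t.2.2) =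
      ∑ t ∈ windmill n, windmillSign t * F (t.2.1 + t.2.2) -
      ∑ t ∈ windmill n with t.2.1 = 2 * t.1 + t.2.2, windmillSign t * F (t.2.1 + t.2.2) := by
  have h : ∑ t ∈ windmill n with t.2.1 < 2 * t.1 + t.2.2, windmillSign t * F (t.2.1 + t.2.2) =
      ∑ t ∈ windmill n with 2 * t.1 + t.2.2 < t.2.1, windmillSign t * F (t.2.1 + t.2.2) := by
    refine Finset.sum_nbij' (fun t => (-t.1, t.2.2, t.2.1)) (fun t => (-t.1, t.2.2, t.2.1))
      ?_ ?_ ?_ ?_ ?_ <;>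
      rintro ⟨i, d, e⟩ h <;> simp only [Finset.mem_filter, mem_windmill] at h ⊢
    · exact ⟨⟨by omega, by omega, by linarith [h.1.2.2]⟩, by omega⟩
    · exact ⟨⟨by omega, by omega, by linarith [h.1.2.2]⟩, by omega⟩
    · simp
    · simp
    · congr 1
      · exact windmillSign_congr ⟨i, by dsimp only; ring⟩
      · congr 1; ring
  rw [two_mul]
  nth_rewrite 2 [h]
  simp only [Finset.sum_filter, ← Finset.sum_add_distrib, ← Finset.sum_sub_distrib]
  refine Finset.sum_congr rfl fun t _ => ?_
  rcases lt_trichotomy t.2.1 (2 * t.1 + t.2.2) with h | h | h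
  · simp [h, h.ne, h.not_gt]
  · simp [← h]
  · simp [h, h.ne', h.not_gt]

/-- Liouville's identity for an odd function, up to the terms coming from squares. -/
theorem windmill_identity {n : ℕ} (F : ℤ → ℝ) (hF : ∀ x, F (-x) = -F x) :
    2 * ∑ t ∈ windmill n, windmillSign t * F (t.2.2 - 2 * t.1) =
      ∑ t ∈ windmill n, windmillSign t * F (t.2.1 + t.2.2) -
      ∑ t ∈ windmill n with t.2.1 = 2 * t.1 + t.2.2, windmillSign t * F (t.2.1 + t.2.2) +
      2 * ∑ t ∈ windmill n with t.2.2 = t.2.1 + 2 * t.1,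
        windmillSign t * F (t.2.2 - 2 * t.1) := by
  rw [← windmill_sum_half, ← windmill_sum_pos, ← mul_add]
  congr 1
  have h0 := windmill_sum_neg (n := n) F hF
  refine (add_zero _).symm.trans ?_
  rw [← neg_eq_zero, ← Finset.sum_neg_distrib] at h0
  rw [← h0]
  simp only [Finset.sum_filter, ← Finset.sum_add_distrib]
  refine Finset.sum_congr rfl fun t _ => ?_
  rcases lt_trichotomy t.2.2 (t.2.1 + 2 * t.1) with h | h | h
  · simp [h, h.ne, h.not_gt]
  · simp [← h]
  · simp [h, h.ne', h.not_gt]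


theorem windmill_add_eq {s : ℕ} {i d : ℤ} (h : 0 < i + d)
    (hs : i ^ 2 + d * (d + 2 * i) = (s : ℤ) ^ 2) :
    i + d = s := by
  have : (i + d) ^ 2 = (s : ℤ) ^ 2 := by linarith
  rwa [sq_eq_sq₀ h.le (by positivity)] at this

theorem sum_windmill_sq_right {s : ℕ} (F : ℤ → ℝ) :
    ∑ t ∈ windmill (s ^ 2) with t.2.2 = t.2.1 + 2 * t.1, windmillSign t * F (t.2.2 - 2 * t.1) =
      (-1) ^ s * ∑ m ∈ Finset.range (2 * s - 1), (-1) ^ (m + 1) * F (m + 1) := by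
  have key : ∀ i d e : ℤ, (i, d, e) ∈ windmill (s ^ 2) → e = d + 2 * i → i + d = s := by
    rintro i d e h rfl
    rw [mem_windmill] at h
    obtain ⟨h1, h2, h3⟩ := h
    dsimp only at h1 h2 h3
    exact windmill_add_eq (by omega) (by exact_mod_cast h3)
  rw [Finset.mul_sum]
  refine Finset.sum_nbij' (fun t => (t.2.1 - 1).toNat)
    (fun m => ((s : ℤ) - (m + 1), (m : ℤ) + 1, 2 * (s : ℤ) - (m + 1))) ?_ ?_ ?_ ?_ ?_
  · rintro ⟨i, d, e⟩ h
    rw [Finset.mem_filter] at h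
    have h4 := key i d e h.1 h.2
    simp only [mem_windmill, Finset.mem_range] at h ⊢
    omega
  · intro m h
    simp only [Finset.mem_filter, mem_windmill, Finset.mem_range] at h ⊢
    refine ⟨⟨by omega, by omega, by push_cast; ring⟩, by omega⟩
  · rintro ⟨i, d, e⟩ h
    rw [Finset.mem_filter] at h
    have h4 := key i d e h.1 h.2
    simp only [mem_windmill] at h
    ext <;> dsimp only <;> omega
  · intro m h; simp
  · rintro ⟨i, d, e⟩ h
    rw [Finset.mem_filter] at h
    have h4 := key i d e h.1 h.2
    simp only [mem_windmill] at h
    obtain ⟨m, rfl⟩ : ∃ m : ℕ, d = m + 1 := ⟨(d - 1).toNat, by omega⟩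
    obtain rfl : i = s - (m + 1) := by omega
    obtain rfl := h.2
    have hm : ((m : ℤ) + 1 - 1).toNat = m := by omega
    dsimp only
    rw [hm, ← mul_assoc, ← pow_add]
    congr 1
    · rw [← zpow_natCast]
      exact neg_one_zpow_congr ⟨s - m - 1, by push_cast; ring⟩
    · congr 1
      ring

theorem sum_windmill_sq_left {s : ℕ} (F : ℤ → ℝ) :
    ∑ t ∈ windmill (s ^ 2) with t.2.1 = 2 * t.1 + t.2.2, windmillSign t * F (t.2.1 + t.2.2) =
      (-1) ^ s * ∑ m ∈ Finset.range (2 * s - 1), (-1) ^ (m + 1) * F (2 * s) := by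
  rw [← sum_windmill_sq_right (fun _ => F (2 * s))]
  have key : ∀ i d e : ℤ, (i, d, e) ∈ windmill (s ^ 2) → d = 2 * i + e → i + e = s := by
    rintro i d e h rfl
    rw [mem_windmill] at h
    obtain ⟨h1, h2, h3⟩ := h
    dsimp only at h1 h2 h3
    exact windmill_add_eq (by omega) (by push_cast at h3; linarith)
  refine Finset.sum_nbij' (fun t => (t.1, t.2.2, t.2.1)) (fun t => (t.1, t.2.2, t.2.1))
      ?_ ?_ ?_ ?_ ?_
  · rintro ⟨i, d, e⟩ h
    simp only [Finset.mem_filter, mem_windmill] at h ⊢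
    exact ⟨⟨by omega, by omega, by linarith [h.1.2.2]⟩, by omega⟩
  · rintro ⟨i, d, e⟩ h
    simp only [Finset.mem_filter, mem_windmill] at h ⊢
    exact ⟨⟨by omega, by omega, by linarith [h.1.2.2]⟩, by omega⟩
  · simp
  · simp
  · rintro ⟨i, d, e⟩ h
    rw [Finset.mem_filter] at h
    have h4 := key i d e h.1 h.2
    simp only at h ⊢
    congr 1
    · exact windmillSign_congr ⟨0, by dsimp only; ring⟩
    · congr 1; omega

theorem sum_range_neg_one_pow {s : ℕ} (hs : 0 < s) :
    ∑ m ∈ Finset.range (2 * s - 1), (-1 : ℝ) ^ (m + 1) = -1 := by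
  obtain ⟨k, rfl⟩ : ∃ k, s = k + 1 := ⟨s - 1, by omega⟩
  have : 2 * (k + 1) - 1 = 2 * k + 1 := by omega
  rw [this]
  induction k with
  | zero => simp
  | succ k ih =>
    rw [show 2 * (k + 1) + 1 = 2 * k + 1 + 1 + 1 by ring, Finset.sum_range_succ,
      Finset.sum_range_succ, ih (by omega) (by omega)]
    ring

theorem sum_range_neg_one_pow_mul_cube {s : ℕ} (hs : 0 < s) :
    ∑ m ∈ Finset.range (2 * s - 1), (-1 : ℝ) ^ (m + 1) * (m + 1) ^ 3 = -(s : ℝ) ^ 2 * (4 * s - 3) := by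
  obtain ⟨k, rfl⟩ : ∃ k, s = k + 1 := ⟨s - 1, by omega⟩
  have : 2 * (k + 1) - 1 = 2 * k + 1 := by omega
  rw [this]
  induction k with
  | zero => norm_num
  | succ k ih =>
    rw [show 2 * (k + 1) + 1 = 2 * k + 1 + 1 + 1 by ring, Finset.sum_range_succ,
      Finset.sum_range_succ, ih (by omega) (by omega)]
    have h1 : (-1 : ℝ) ^ (2 * k) = 1 := by simp
    push_cast
    simp only [pow_succ (-1 : ℝ), h1]
    ring

theorem windmill_identity_sq {s : ℕ} (hs : 0 < s) (F : ℤ → ℝ) (hF : ∀ x, F (-x) = -F x) :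
    2 * ∑ t ∈ windmill (s ^ 2), windmillSign t * F (t.2.2 - 2 * t.1) =
      ∑ t ∈ windmill (s ^ 2), windmillSign t * F (t.2.1 + t.2.2) + (-1) ^ s * (F (2 * s) +
      2 * ∑ m ∈ Finset.range (2 * s - 1), (-1) ^ (m + 1) * F (m + 1)) := by
  rw [windmill_identity F hF, sum_windmill_sq_left, sum_windmill_sq_right, ← Finset.sum_mul,
    sum_range_neg_one_pow hs]
  ring

theorem windmill_identity_not_sq {n : ℕ} (hn : ¬ IsSquare n) (F : ℤ → ℝ)
    (hF : ∀ x, F (-x) = -F x) :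
    2 * ∑ t ∈ windmill n, windmillSign t * F (t.2.2 - 2 * t.1) =
      ∑ t ∈ windmill n, windmillSign t * F (t.2.1 + t.2.2) := by
  have key : ∀ a : ℤ, a ^ 2 ≠ n := fun a ha =>
    hn ⟨a.natAbs, by zify; rw [← ha, ← sq, sq_abs]⟩
  rw [windmill_identity F hF, Finset.filter_false_of_mem, Finset.filter_false_of_mem]
  · simp
  · rintro ⟨i, d, e⟩ h
    rw [mem_windmill] at h
    dsimp only at h ⊢
    rintro rfl
    exact key (i + d) (by linarith [h.2.2])
  · rintro ⟨i, d, e⟩ h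
    rw [mem_windmill] at h
    dsimp only at h ⊢
    rintro rfl
    exact key (i + e) (by linarith [h.2.2])

theorem sum_windmill_sign_reflect {n : ℕ} (F : ℤ → ℝ) :
    2 * ∑ t ∈ windmill n, windmillSign t * F (t.2.2 - 2 * t.1) =
      ∑ t ∈ windmill n, windmillSign t * (F (t.2.2 - 2 * t.1) + F (t.2.2 + 2 * t.1)) := by
  simp only [mul_add, Finset.sum_add_distrib, two_mul]
  congr 1
  have h := sum_windmill_neg (n := n) fun i d e => windmillSign (i, d, e) * F (e - (i + i))
  refine h.trans (Finset.sum_congr rfl fun t _ => ?_)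
  congr 1
  · exact windmillSign_congr ⟨-t.1, by dsimp only; ring⟩
  · congr 1; ring

theorem sign_add_sign {e : ℤ} (he : 0 < e) (i : ℤ) :
    ((e - 2 * i).sign : ℝ) + (e + 2 * i).sign = 1 + (e - 2 * |i|).sign := by
  have h : (e - 2 * i).sign + (e + 2 * i).sign = 1 + (e - 2 * |i|).sign := by
    rcases abs_cases i with ⟨h, h'⟩ | ⟨h, h'⟩ <;> rw [h]
    · rw [Int.sign_eq_one_of_pos (show 0 < e + 2 * i by omega)]; ring
    · rw [Int.sign_eq_one_of_pos (show 0 < e - 2 * i by omega)]; congr 2; ring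
  exact_mod_cast h

theorem sum_windmill_int_sign {n : ℕ} :
    2 * ∑ t ∈ windmill n, windmillSign t * ((t.2.2 - 2 * t.1).sign : ℝ) =
      ∑ t ∈ windmill n, windmillSign t * ((t.2.1 + t.2.2).sign : ℝ) +
      ∑ t ∈ windmill n, windmillSign t * ((t.2.2 - 2 * |t.1|).sign : ℝ) := by
  rw [sum_windmill_sign_reflect fun x => (x.sign : ℝ), ← Finset.sum_add_distrib]
  refine Finset.sum_congr rfl fun t ht => ?_
  rw [mem_windmill] at ht
  rw [sign_add_sign ht.2.1, Int.sign_eq_one_of_pos (show 0 < t.2.1 + t.2.2 by omega)]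
  push_cast; ring

theorem sum_windmill_sign_sq {s : ℕ} (hs : 0 < s) :
    ∑ t ∈ windmill (s ^ 2), windmillSign t * ((t.2.2 - 2 * |t.1|).sign : ℝ) = -(-1) ^ s := by
  have h := windmill_identity_sq hs (fun x => (x.sign : ℝ)) (by simp)
  rw [sum_windmill_int_sign] at h
  have h1 : ∀ m : ℕ, ((m : ℤ) + 1).sign = 1 := fun m => Int.sign_eq_one_of_pos (by omega)
  simp only [h1, Int.sign_eq_one_of_pos (show 0 < 2 * (s : ℤ) by omega), Int.cast_one, mul_one,
    sum_range_neg_one_pow hs] at h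
  linarith

theorem sum_windmill_sign_not_sq {n : ℕ} (hn : ¬ IsSquare n) :
    ∑ t ∈ windmill n, windmillSign t * ((t.2.2 - 2 * |t.1|).sign : ℝ) = 0 := by
  have h := windmill_identity_not_sq hn (fun x => (x.sign : ℝ)) (by simp)
  rw [sum_windmill_int_sign] at h
  linarith

theorem sum_windmill_cube {n : ℕ} :
    2 * ∑ t ∈ windmill n, windmillSign t * ((t.2.2 - 2 * t.1 : ℤ) : ℝ) ^ 3 =
      ∑ t ∈ windmill n, windmillSign t * ((t.2.1 + t.2.2 : ℤ) : ℝ) ^ 3 -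
      6 * ∑ t ∈ windmill n, windmillSign t * (t.2.2 * (t.2.1 * t.2.2 - 4 * t.1 ^ 2)) := by
  have h1 := sum_windmill_swap (n := n) fun i d e => windmillSign (i, d, e) * (d : ℝ) ^ 3
  have h2 := sum_windmill_swap (n := n) fun i d e => windmillSign (i, d, e) * ((d : ℝ) ^ 2 * e)
  have h3 (i d e : ℤ) : windmillSign (i, e, d) = windmillSign (i, d, e) :=
    windmillSign_congr ⟨0, by dsimp only; ring⟩
  simp only [h3] at h1 h2
  rw [sum_windmill_sign_reflect fun x => (x : ℝ) ^ 3]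
  have e1 : ∑ t ∈ windmill n, windmillSign t *
      (((t.2.2 - 2 * t.1 : ℤ) : ℝ) ^ 3 + ((t.2.2 + 2 * t.1 : ℤ) : ℝ) ^ 3) =
      2 * ∑ t ∈ windmill n, windmillSign t * (t.2.2 : ℝ) ^ 3 +
      24 * ∑ t ∈ windmill n, windmillSign t * (t.2.2 * t.1 ^ 2 : ℝ) := by
    simp only [Finset.mul_sum, ← Finset.sum_add_distrib]
    refine Finset.sum_congr rfl fun t _ => ?_
    push_cast; ring
  have e2 : ∑ t ∈ windmill n, windmillSign t * ((t.2.1 + t.2.2 : ℤ) : ℝ) ^ 3 =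
      ∑ t ∈ windmill n, windmillSign t * (t.2.1 : ℝ) ^ 3 +
      3 * ∑ t ∈ windmill n, windmillSign t * ((t.2.1 : ℝ) ^ 2 * t.2.2) +
      3 * ∑ t ∈ windmill n, windmillSign t * ((t.2.2 : ℝ) ^ 2 * t.2.1) +
      ∑ t ∈ windmill n, windmillSign t * (t.2.2 : ℝ) ^ 3 := by
    simp only [Finset.mul_sum, ← Finset.sum_add_distrib]
    refine Finset.sum_congr rfl fun t _ => ?_
    push_cast; ring
  have e3 : ∑ t ∈ windmill n, windmillSign t * (t.2.2 * (t.2.1 * t.2.2 - 4 * t.1 ^ 2) : ℝ) =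
      ∑ t ∈ windmill n, windmillSign t * ((t.2.2 : ℝ) ^ 2 * t.2.1) -
      4 * ∑ t ∈ windmill n, windmillSign t * (t.2.2 * t.1 ^ 2 : ℝ) := by
    simp only [Finset.mul_sum, ← Finset.sum_sub_distrib]
    refine Finset.sum_congr rfl fun t _ => ?_
    ring
  simp only [Prod.mk.eta] at h1 h2
  rw [e1, e2, e3]
  linarith

theorem sum_windmill_mul_sq {s : ℕ} (hs : 0 < s) :
    ∑ t ∈ windmill (s ^ 2), windmillSign t * (t.2.2 * (t.2.1 * t.2.2 - 4 * t.1 ^ 2) : ℝ) =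
      -((-1) ^ s * s ^ 2) := by
  have h := windmill_identity_sq hs (fun x => (x : ℝ) ^ 3) (fun x => by push_cast; ring)
  rw [sum_windmill_cube] at h
  push_cast at h
  rw [sum_range_neg_one_pow_mul_cube hs] at h
  linarith

theorem sum_windmill_mul_not_sq {n : ℕ} (hn : ¬ IsSquare n) :
    ∑ t ∈ windmill n, windmillSign t * (t.2.2 * (t.2.1 * t.2.2 - 4 * t.1 ^ 2) : ℝ) = 0 := by
  have h := windmill_identity_not_sq hn (fun x => (x : ℝ) ^ 3) (fun x => by push_cast; ring)
  rw [sum_windmill_cube] at h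
  linarith

/-- The power series `∑ f i X ^ N i` -/
noncomputable def genSeries {ι : Type*} (N : ι → ℕ) (f : ι → ℝ) : PowerSeries ℝ :=
  .mk fun n => ∑ᶠ (i) (_ : N i = n), f i

theorem coeff_genSeries {ι : Type*} {N : ι → ℕ} (f : ι → ℝ) {n : ℕ} {S : Finset ι}
    (hS : ∀ i, N i = n ↔ i ∈ S) : (genSeries N f).coeff n = ∑ i ∈ S, f i := by
  rw [genSeries, PowerSeries.coeff_mk]
  exact finsum_cond_eq_sum_of_cond_iff f fun _ => hS _

theorem finite_fiber_add {ι κ : Type*} {N : ι → ℕ} {M : κ → ℕ} (hN : ∀ n, {i | N i = n}.Finite)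
    (hM : ∀ n, {i | M i = n}.Finite) (n : ℕ) : {x : ι × κ | N x.1 + M x.2 = n}.Finite := by
  have h : ((⋃ k ∈ Set.Iic n, {i | N i = k}) ×ˢ ⋃ k ∈ Set.Iic n, {i | M i = k}).Finite :=
    ((Set.finite_Iic n).biUnion fun k _ => hN k).prod ((Set.finite_Iic n).biUnion fun k _ => hM k)
  refine h.subset ?_
  rintro ⟨i, j⟩ (h : _ + _ = _)
  simp only [Set.mem_prod, Set.mem_iUnion, Set.mem_Iic, Set.mem_ofPred_eq, exists_prop,
    exists_eq_right']
  dsimp only at h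
  omega

theorem genSeries_mul {ι κ : Type*} {N : ι → ℕ} {M : κ → ℕ} (hN : ∀ n, {i | N i = n}.Finite)
    (hM : ∀ n, {i | M i = n}.Finite) (f : ι → ℝ) (g : κ → ℝ) :
    genSeries N f * genSeries M g =
      genSeries (fun x : ι × κ => N x.1 + M x.2) fun x => f x.1 * g x.2 := by
  classical
  ext n
  have h := finite_fiber_add hN hM n
  rw [PowerSeries.coeff_mul, coeff_genSeries (S := h.toFinset) _ (by simp),
    ← Finset.sum_fiberwise_of_maps_to (s := h.toFinset) (t := Finset.HasAntidiagonal.antidiagonal n)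
      (g := fun x => (N x.1, M x.2)) (by simp)]
  refine Finset.sum_congr rfl fun k hk => ?_
  rw [coeff_genSeries (S := (hN k.1).toFinset) _ (by simp),
    coeff_genSeries (S := (hM k.2).toFinset) _ (by simp), Finset.sum_mul_sum,
    ← Finset.sum_product']
  refine Finset.sum_congr ?_ fun _ _ => rfl
  ext x
  rw [Finset.HasAntidiagonal.mem_antidiagonal] at hk
  simp only [Finset.mem_product, Set.Finite.mem_toFinset, Set.mem_ofPred_eq, Finset.mem_filter,
    Prod.ext_iff]
  omega

theorem X_mul_derivative_genSeries {ι : Type*} (N : ι → ℕ) (f : ι → ℝ) :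
    PowerSeries.X * PowerSeries.derivative ℝ (genSeries N f) = genSeries N fun i => N i * f i := by
  ext n
  simp only [genSeries]
  cases n with
  | zero =>
    rw [PowerSeries.coeff_zero_X_mul, PowerSeries.coeff_mk]
    symm
    refine finsum_mem_eq_zero_of_forall_eq_zero (s := {i | N i = 0}) fun i (h : N i = 0) => ?_
    simp [h]
  | succ n =>
    rw [PowerSeries.coeff_succ_X_mul, PowerSeries.coeff_derivative, PowerSeries.coeff_mk,
      PowerSeries.coeff_mk, mul_comm, ← smul_eq_mul, smul_finsum]
    refine finsum_congr fun i => ?_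
    rw [smul_finsum]
    refine finsum_congr fun h => ?_
    rw [h, smul_eq_mul]; push_cast; ring

theorem hasSum_genSeries {ι : Type*} {N : ι → ℕ} (hN : ∀ n, {i | N i = n}.Finite) {f : ι → ℝ}
    {q A : ℝ} (h : HasSum (fun i => f i * q ^ N i) A) :
    HasSum (fun n => (genSeries N f).coeff n * q ^ n) A := by
  refine Eq.mp (congrArg (HasSum · A) (funext fun n => ?_)) (h.tsum_fiberwise N)
  symm
  rw [coeff_genSeries (S := (hN n).toFinset) _ (by simp), Finset.sum_mul]
  have : N ⁻¹' {n} = ((hN n).toFinset : Set ι) := by ext; simp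
  rw [this, Finset.tsum_subtype' (hN n).toFinset (fun i => f i * q ^ N i)]
  refine Finset.sum_congr rfl fun i hi => ?_
  rw [Set.Finite.mem_toFinset, Set.mem_ofPred_eq] at hi
  rw [hi]

theorem genSeries_smul {ι : Type*} (N : ι → ℕ) (c : ℝ) (f : ι → ℝ) :
    genSeries N (fun i => c * f i) = c • genSeries N f := by
  ext n
  rw [PowerSeries.coeff_smul]
  simp only [genSeries, PowerSeries.coeff_mk, ← smul_eq_mul, smul_finsum]

theorem norm_leading_term_le {c : ℕ → ℝ} {k : ℕ} (hmin : ∀ j < k, c j = 0)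
    (h : ∀ q : ℝ, 0 < q → q < 1 → HasSum (fun n => c n * q ^ n) 0) {t : ℝ} (h0 : 0 < t)
    (h1 : t < 1) : |c k| * (1 / 2) ^ k ≤ t * ∑' n, |c (n + (k + 1)) * (1 / 2) ^ (n + (k + 1))| := by
  have ha : Summable fun n => |c (n + (k + 1)) * (1 / 2) ^ (n + (k + 1))| :=
    (summable_nat_add_iff (f := fun n => |c n * (1 / 2) ^ n|) (k + 1)).2
      (h (1 / 2) (by norm_num) (by norm_num)).summable.abs
  have h2 := (hasSum_nat_add_iff' (f := fun n => c n * (t / 2) ^ n) (k + 1)).2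
    (h (t / 2) (by linarith) (by linarith))
  have h4 : ∑ i ∈ Finset.range (k + 1), c i * (t / 2) ^ i = c k * (t / 2) ^ k := by
    rw [Finset.sum_range_succ, Finset.sum_eq_zero, zero_add]
    intro i hi
    rw [hmin i (Finset.mem_range.1 hi), zero_mul]
  rw [h4, zero_sub] at h2
  have h3 : ‖-(c k * (t / 2) ^ k)‖ ≤
      t ^ (k + 1) * ∑' n, |c (n + (k + 1)) * (1 / 2) ^ (n + (k + 1))| := by
    rw [← h2.tsum_eq]
    refine tsum_of_norm_bounded (ha.hasSum.mul_left _) fun n => ?_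
    have e : c (n + (k + 1)) * (t / 2) ^ (n + (k + 1)) =
        t ^ (n + (k + 1)) * (c (n + (k + 1)) * (1 / 2) ^ (n + (k + 1))) := by
      rw [div_eq_mul_one_div t, mul_pow]; ring
    rw [Real.norm_eq_abs, e, abs_mul, abs_of_pos (a := t ^ (n + (k + 1))) (by positivity)]
    exact mul_le_mul_of_nonneg_right (pow_le_pow_of_le_one h0.le h1.le (by omega)) (abs_nonneg _)
  rw [norm_neg, Real.norm_eq_abs, abs_mul, abs_of_pos (a := (t / 2) ^ k) (by positivity),
    div_eq_mul_one_div t, mul_pow, pow_succ] at h3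
  refine le_of_mul_le_mul_left ?_ (pow_pos h0 k)
  linarith

theorem eq_zero_of_forall_hasSum_zero {c : ℕ → ℝ}
    (h : ∀ q : ℝ, 0 < q → q < 1 → HasSum (fun n => c n * q ^ n) 0) (k : ℕ) : c k = 0 := by
  induction k using Nat.strong_induction_on with
  | _ k hmin =>
    by_contra hk
    have key := fun t h0 h1 => norm_leading_term_le (t := t) hmin h h0 h1
    have hM : 0 ≤ ∑' n, |c (n + (k + 1)) * (1 / 2) ^ (n + (k + 1))| :=
      tsum_nonneg fun n => abs_nonneg _
    have hx : 0 < |c k| * (1 / 2) ^ k := by positivity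
    generalize |c k| * (1 / 2) ^ k = x at key hx
    generalize ∑' n, |c (n + (k + 1)) * (1 / 2) ^ (n + (k + 1))| = M at key hM
    have := key (x / (x + M + 1)) (by positivity) (by rw [div_lt_one (by positivity)]; linarith)
    rw [div_mul_eq_mul_div, le_div_iff₀ (by positivity)] at this
    nlinarith

theorem powerSeries_ext_of_hasSum {P Q : PowerSeries ℝ} {A : ℝ → ℝ}
    (hP : ∀ q : ℝ, 0 < q → q < 1 → HasSum (fun n => P.coeff n * q ^ n) (A q))
    (hQ : ∀ q : ℝ, 0 < q → q < 1 → HasSum (fun n => Q.coeff n * q ^ n) (A q)) : P = Q := by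
  ext k
  rw [← sub_eq_zero]
  refine eq_zero_of_forall_hasSum_zero (c := fun n => P.coeff n - Q.coeff n)
    (fun q h0 h1 => ?_) k
  simpa [sub_mul] using (hP q h0 h1).sub (hQ q h0 h1)

theorem hasSum_coeff_mul {P Q : PowerSeries ℝ} {q A B : ℝ}
    (hP : HasSum (fun n => P.coeff n * q ^ n) A) (hQ : HasSum (fun n => Q.coeff n * q ^ n) B) :
    HasSum (fun n => (P * Q).coeff n * q ^ n) (A * B) := by
  have := (summable_norm_sum_mul_antidiagonal_of_summable_norm hP.summable.norm
    hQ.summable.norm).of_norm.hasSum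
  rw [← tsum_mul_tsum_eq_tsum_sum_antidiagonal_of_summable_norm hP.summable.norm
    hQ.summable.norm, hP.tsum_eq, hQ.tsum_eq] at this
  refine Eq.mp (congrArg (HasSum · _) (funext fun n => ?_)) this
  symm
  rw [PowerSeries.coeff_mul, Finset.sum_mul]
  refine Finset.sum_congr rfl fun x hx => ?_
  rw [← Finset.HasAntidiagonal.mem_antidiagonal.1 hx, pow_add]
  ring

/-- The exponent of the theta series -/
def sqExp (j : ℤ) : ℕ := j.natAbs ^ 2

/-- The exponent of a Lambert series, with indices shifted to start from `0` -/
def mulExp (x : ℕ × ℕ) : ℕ := (x.1 + 1) * (x.2 + 1)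

theorem finite_sqExp (n : ℕ) : {j | sqExp j = n}.Finite := by
  refine (Set.finite_Icc (-n : ℤ) n).subset ?_
  rintro j (h : j.natAbs ^ 2 = n)
  have : j.natAbs ≤ n := h ▸ Nat.le_self_pow two_ne_zero _
  simp only [Set.mem_Icc]
  omega

theorem finite_mulExp (n : ℕ) : {x | mulExp x = n}.Finite := by
  refine ((Set.finite_Iio n).prod (Set.finite_Iio n)).subset ?_
  rintro ⟨i, k⟩ (rfl : (i + 1) * (k + 1) = n)
  constructor <;> simp only [Set.mem_Iio] <;> nlinarith [Nat.zero_le (i * k)]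

theorem coeff_genSeries_sqExp_sq (f : ℤ → ℝ) {s : ℕ} (hs : 0 < s) :
    (genSeries sqExp f).coeff (s ^ 2) = f s + f (-s) := by
  have h : (s : ℤ) ≠ -s := by omega
  rw [coeff_genSeries (S := {(s : ℤ), -(s : ℤ)}) f, Finset.sum_pair h]
  intro j
  rw [sqExp, Nat.pow_left_injective two_ne_zero |>.eq_iff, Finset.mem_insert,
    Finset.mem_singleton]
  omega

theorem coeff_genSeries_sqExp_zero (f : ℤ → ℝ) : (genSeries sqExp f).coeff 0 = f 0 := by
  rw [coeff_genSeries (S := {(0 : ℤ)}) f, Finset.sum_singleton]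
  simp [sqExp]

theorem coeff_genSeries_sqExp_not_sq (f : ℤ → ℝ) {n : ℕ} (hn : ¬IsSquare n) :
    (genSeries sqExp f).coeff n = 0 := by
  rw [coeff_genSeries (S := ∅) f, Finset.sum_empty]
  intro j
  simp only [Finset.notMem_empty, iff_false, sqExp]
  rintro rfl
  exact hn ⟨_, sq _⟩

theorem coeff_genSeries_windmill (g : ℤ × ℤ × ℤ → ℝ) (n : ℕ) :
    (genSeries (fun x : ℤ × ℕ × ℕ => sqExp x.1 + mulExp x.2)
      fun x => g (x.1, x.2.1 + 1, x.2.2 + 1)).coeff n = ∑ t ∈ windmill n, g t := by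
  have h := finite_fiber_add finite_sqExp finite_mulExp n
  rw [coeff_genSeries (S := h.toFinset) _ (by simp)]
  refine Finset.sum_nbij' (fun x => (x.1, (x.2.1 : ℤ) + 1, (x.2.2 : ℤ) + 1))
    (fun t => (t.1, (t.2.1 - 1).toNat, (t.2.2 - 1).toNat)) ?_ ?_ ?_ ?_ ?_
  · rintro ⟨j, i, k⟩ hx
    simp only [Set.Finite.mem_toFinset, Set.mem_ofPred_eq, sqExp, mulExp] at hx
    rw [mem_windmill, ← hx]
    refine ⟨by positivity, by positivity, ?_⟩
    push_cast
    rw [sq_abs]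
  · rintro ⟨j, a, b⟩ ht
    rw [mem_windmill] at ht
    obtain ⟨ha, hb, h⟩ := ht
    simp only [Set.Finite.mem_toFinset, Set.mem_ofPred_eq, sqExp, mulExp]
    dsimp only at ha hb h
    zify
    rw [sq_abs, Int.toNat_of_nonneg (by omega), Int.toNat_of_nonneg (by omega), ← h]
    ring
  · rintro ⟨j, i, k⟩ -
    simp
  · rintro ⟨j, a, b⟩ ht
    rw [mem_windmill] at ht
    obtain ⟨ha, hb, h⟩ := ht
    dsimp only at ha hb
    simp only [Prod.mk.injEq, true_and]
    omega
  · intro _ _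
    rfl

/-- `∑ (-1)^j q^(j²)` -/
noncomputable def thetaSeries : PowerSeries ℝ := genSeries sqExp fun j => (-1) ^ j

/-- `∑_{m,d ≥ 1} (-1)^(m+d-1) d q^(md)` -/
noncomputable def sigmaSeries : PowerSeries ℝ :=
  genSeries mulExp fun x => (-1) ^ (x.1 + x.2 + 1) * (x.2 + 1)

theorem theta_mul_derivative_sub :
    8 * (thetaSeries * (PowerSeries.X * PowerSeries.derivative ℝ sigmaSeries)) -
      32 * ((PowerSeries.X * PowerSeries.derivative ℝ thetaSeries) * sigmaSeries) =
    4 * (PowerSeries.X * PowerSeries.derivative ℝ thetaSeries) := by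
  have e8 (P : PowerSeries ℝ) : 8 * P = (8 : ℝ) • P := by
    rw [PowerSeries.smul_eq_C_mul]; rfl
  have e32 (P : PowerSeries ℝ) : 32 * P = (32 : ℝ) • P := by
    rw [PowerSeries.smul_eq_C_mul]; rfl
  have e4 (P : PowerSeries ℝ) : 4 * P = (4 : ℝ) • P := by
    rw [PowerSeries.smul_eq_C_mul]; rfl
  rw [e8, e32, e4, thetaSeries, sigmaSeries, X_mul_derivative_genSeries, X_mul_derivative_genSeries,
    genSeries_mul finite_sqExp finite_mulExp, genSeries_mul finite_sqExp finite_mulExp,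
    ← genSeries_smul, ← genSeries_smul]
  ext n
  have hL : ∀ x : ℤ × ℕ × ℕ, (-1 : ℝ) ^ x.1 * (-1) ^ (x.2.1 + x.2.2 + 1) =
      -windmillSign (x.1, x.2.1 + 1, x.2.2 + 1) := by
    intro x
    rw [windmillSign, zpow_add₀ (by norm_num), zpow_add₀ (by norm_num), zpow_add₀ (by norm_num),
      zpow_add₀ (by norm_num), zpow_natCast, zpow_natCast]
    ring
  have key : (genSeries (fun x : ℤ × ℕ × ℕ => sqExp x.1 + mulExp x.2) fun x =>
        8 * ((-1 : ℝ) ^ x.1 * (mulExp x.2 * ((-1) ^ (x.2.1 + x.2.2 + 1) * (x.2.2 + 1))))).coeff n -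
      (genSeries (fun x : ℤ × ℕ × ℕ => sqExp x.1 + mulExp x.2) fun x =>
        32 * ((sqExp x.1 * (-1 : ℝ) ^ x.1) * ((-1) ^ (x.2.1 + x.2.2 + 1) * (x.2.2 + 1)))).coeff n =
      -8 * ∑ t ∈ windmill n, windmillSign t * (t.2.2 * (t.2.1 * t.2.2 - 4 * t.1 ^ 2) : ℝ) := by
    have h1 := coeff_genSeries_windmill
      (fun t => -8 * (windmillSign t * (t.2.2 * (t.2.1 * t.2.2)))) n
    have h2 := coeff_genSeries_windmill
      (fun t => -32 * (windmillSign t * (t.2.2 * t.1 ^ 2))) n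
    rw [show (fun x : ℤ × ℕ × ℕ => 8 * ((-1 : ℝ) ^ x.1 *
        (mulExp x.2 * ((-1) ^ (x.2.1 + x.2.2 + 1) * (x.2.2 + 1))))) = _ from ?_, h1,
      show (fun x : ℤ × ℕ × ℕ => 32 * ((sqExp x.1 * (-1 : ℝ) ^ x.1) *
        ((-1) ^ (x.2.1 + x.2.2 + 1) * (x.2.2 + 1)))) = _ from ?_, h2, ← Finset.sum_sub_distrib,
      Finset.mul_sum]
    · exact Finset.sum_congr rfl fun _ _ => by ring
    · funext x
      have := hL x
      have e : (sqExp x.1 : ℝ) = x.1 ^ 2 := by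
        rw [sqExp]; push_cast; rw [Nat.cast_natAbs, Int.cast_abs, sq_abs]
      push_cast [e]
      linear_combination (32 * (x.1 : ℝ) ^ 2 * (x.2.2 + 1)) * this
    · funext x
      have := hL x
      rw [mulExp]
      push_cast
      linear_combination (8 * (((x.2.1 : ℝ) + 1) * (x.2.2 + 1)) * (x.2.2 + 1)) * this
  rw [map_sub, key, PowerSeries.coeff_smul, smul_eq_mul]
  by_cases hn : IsSquare n
  · obtain ⟨s, rfl⟩ := hn
    rw [← sq]
    rcases Nat.eq_zero_or_pos s with rfl | hs
    · rw [zero_pow two_ne_zero, coeff_genSeries_sqExp_zero, Finset.sum_eq_zero]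
      · simp [sqExp]
      · intro t ht
        rw [mem_windmill] at ht
        obtain ⟨h1, h2, h3⟩ := ht
        exfalso
        push_cast at h3
        nlinarith [sq_nonneg t.1, mul_pos h1 h2]
    · rw [sum_windmill_mul_sq hs, coeff_genSeries_sqExp_sq _ hs]
      have : (-1 : ℝ) ^ (-(s : ℤ)) = (-1) ^ s := by
        rw [← zpow_natCast]; exact neg_one_zpow_congr ⟨-s, by ring⟩
      simp only [this, sqExp, Int.natAbs_neg, Int.natAbs_natCast, zpow_natCast]
      push_cast
      ring
  · rw [sum_windmill_mul_not_sq hn, coeff_genSeries_sqExp_not_sq _ hn, mul_zero, mul_zero]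

theorem theta_pow_four : 1 + 8 * sigmaSeries = thetaSeries ^ 4 := by
  have h0 : PowerSeries.constantCoeff thetaSeries = 1 := by
    rw [← PowerSeries.coeff_zero_eq_constantCoeff_apply, thetaSeries, coeff_genSeries_sqExp_zero]
    simp
  have h1 : PowerSeries.constantCoeff sigmaSeries = 0 := by
    rw [← PowerSeries.coeff_zero_eq_constantCoeff_apply, sigmaSeries, coeff_genSeries (S := ∅)]
    · simp
    · simp [mulExp]
  have hne : thetaSeries ≠ 0 := by
    intro h
    rw [h, map_zero] at h0
    exact zero_ne_one h0
  have hinv : thetaSeries * thetaSeries⁻¹ = 1 := PowerSeries.mul_inv_cancel _ (by simp [h0])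
  have hX := theta_mul_derivative_sub
  have hd : thetaSeries * (8 * PowerSeries.derivative ℝ sigmaSeries) =
      4 * PowerSeries.derivative ℝ thetaSeries * (1 + 8 * sigmaSeries) := by
    refine mul_left_cancel₀ (PowerSeries.X_ne_zero (R := ℝ)) ?_
    linear_combination hX
  have h8 : PowerSeries.derivative ℝ (8 : PowerSeries ℝ) = 0 := by
    rw [show (8 : PowerSeries ℝ) = PowerSeries.C (8 : ℝ) from rfl, PowerSeries.derivative_C]
  suffices h : (1 + 8 * sigmaSeries) * thetaSeries⁻¹ ^ 4 = 1 by
    calc 1 + 8 * sigmaSeries = ((1 + 8 * sigmaSeries) * thetaSeries⁻¹ ^ 4) * thetaSeries ^ 4 := by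
          rw [mul_assoc, ← mul_pow, mul_comm thetaSeries⁻¹, hinv, one_pow, mul_one]
      _ = _ := by rw [h, one_mul]
  refine PowerSeries.derivative.ext ?_ ?_
  · rw [Derivation.leibniz, Derivation.leibniz_pow, map_add, Derivation.leibniz, h8,
      Derivation.map_one_eq_zero, PowerSeries.derivative_inv']
    simp only [smul_eq_mul, nsmul_eq_mul]
    push_cast
    linear_combination thetaSeries⁻¹ ^ 5 * hd -
      (thetaSeries⁻¹ ^ 4 * (8 * PowerSeries.derivative ℝ sigmaSeries)) * hinv
  · simp [h0, h1]

section Lambert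

variable {q : ℝ}

/-- The terms of the theta series at `q` -/
noncomputable def thetaTerm (q : ℝ) (j : ℤ) : ℝ := (-1) ^ j * q ^ sqExp j

/-- `(-1)^m q^m / (1 + q^m)` -/
noncomputable def lambertTerm (q : ℝ) (m : ℤ) : ℝ := (-1) ^ m * (q ^ m / (1 + q ^ m))

theorem thetaTerm_eq_zpow (q : ℝ) (j : ℤ) : thetaTerm q j = (-1) ^ j * q ^ (j ^ 2) := by
  rw [thetaTerm, sqExp, ← zpow_natCast]
  push_cast
  rw [sq_abs]

theorem thetaTerm_neg (q : ℝ) (j : ℤ) : thetaTerm q (-j) = thetaTerm q j := by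
  rw [thetaTerm, thetaTerm, sqExp, sqExp, Int.natAbs_neg, neg_one_zpow_congr ⟨-j, by ring⟩]

theorem abs_thetaTerm (h0 : 0 < q) (j : ℤ) : |thetaTerm q j| = q ^ sqExp j := by
  rw [thetaTerm, abs_mul, abs_neg_one_zpow, one_mul, abs_of_pos (by positivity)]

theorem summable_pow_sqExp (h0 : 0 < q) (h1 : q < 1) : Summable fun j => q ^ sqExp j := by
  have h : Summable fun n : ℕ => q ^ sqExp n := by
    refine Summable.of_nonneg_of_le (fun n => by positivity) (fun n => ?_)
      (summable_geometric_of_lt_one h0.le h1)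
    exact pow_le_pow_of_le_one h0.le h1.le (Nat.le_self_pow two_ne_zero _)
  refine Summable.of_nat_of_neg h ?_
  simpa [sqExp] using h

theorem summable_thetaTerm (h0 : 0 < q) (h1 : q < 1) : Summable (thetaTerm q) := by
  refine Summable.of_norm ?_
  simpa [Real.norm_eq_abs, abs_thetaTerm h0] using summable_pow_sqExp h0 h1

theorem thetaTerm_add_mul (h0 : 0 < q) (j : ℤ) (p m : ℕ) (hp : p ≤ m) :
    thetaTerm q (j + p) * q ^ (p * (m - p)) = thetaTerm q j * (-q ^ (2 * j + m)) ^ p := by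
  rw [thetaTerm_eq_zpow, thetaTerm_eq_zpow, neg_pow, zpow_add₀ (by norm_num), zpow_natCast,
    ← zpow_natCast q, ← zpow_natCast (q ^ (2 * j + (m : ℤ))), ← zpow_mul]
  have : q ^ ((j + p) ^ 2) * q ^ ((p * (m - p) : ℕ) : ℤ) =
      q ^ (j ^ 2) * q ^ ((2 * j + m) * p) := by
    rw [← zpow_add₀ h0.ne', ← zpow_add₀ h0.ne']
    congr 1
    push_cast [hp]
    ring
  linear_combination ((-1) ^ j * (-1) ^ p) * this

theorem one_div_one_add_zpow_le (h0 : 0 < q) (e : ℤ) : |1 / (1 + q ^ e)| ≤ 1 := by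
  have : 0 < q ^ e := zpow_pos h0 e
  rw [abs_of_pos (by positivity), div_le_one (by positivity)]
  linarith

theorem one_div_one_add_zpow_neg (h0 : 0 < q) (e : ℤ) :
    1 / (1 + q ^ (-e)) = 1 - 1 / (1 + q ^ e) := by
  have : 0 < q ^ e := zpow_pos h0 e
  rw [zpow_neg]
  field_simp
  ring

theorem summable_thetaTerm_div (h0 : 0 < q) (h1 : q < 1) (e : ℤ → ℤ) :
    Summable fun j => thetaTerm q j * (1 / (1 + q ^ e j)) := by
  refine Summable.of_norm_bounded (summable_pow_sqExp h0 h1) fun j => ?_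
  rw [Real.norm_eq_abs, abs_mul, abs_thetaTerm h0]
  exact mul_le_of_le_one_right (by positivity) (one_div_one_add_zpow_le h0 _)

theorem tsum_thetaTerm_mul_sum (h0 : 0 < q) (h1 : q < 1) (m : ℕ) :
    (∑' j, thetaTerm q j) * ∑ p ∈ Finset.range m, q ^ (p * (m - p)) =
      2 * (∑' j, thetaTerm q j * (1 / (1 + q ^ (2 * j + m)))) - ∑' j, thetaTerm q j := by
  have hθ := (summable_thetaTerm h0 h1).hasSum
  have hA := (summable_thetaTerm_div h0 h1 fun j => 2 * j + m).hasSum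
  have h2 : HasSum (fun j => ∑ p ∈ Finset.range m, thetaTerm q (j + p) * q ^ (p * (m - p)))
      ((∑' j, thetaTerm q j) * ∑ p ∈ Finset.range m, q ^ (p * (m - p))) := by
    rw [Finset.mul_sum]
    refine hasSum_sum fun p _ => ?_
    exact ((Equiv.addRight (p : ℤ)).hasSum_iff.2 hθ).mul_right _
  have h3 : HasSum (fun j => thetaTerm q (j + m) * (1 / (1 + q ^ (2 * j + m))))
      (∑' j, thetaTerm q j - ∑' j, thetaTerm q j * (1 / (1 + q ^ (2 * j + m)))) := by
    rw [← (Equiv.subLeft (-(m : ℤ))).hasSum_iff]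
    refine Eq.mp (congrArg (HasSum · _) (funext fun j => ?_)) (hθ.sub hA)
    simp only [Function.comp_apply, Equiv.subLeft_apply]
    rw [show -(m : ℤ) - j + m = -j by ring, show 2 * (-(m : ℤ) - j) + m = -(2 * j + m) by ring,
      thetaTerm_neg, one_div_one_add_zpow_neg h0]
    ring
  have h4 : (fun j => ∑ p ∈ Finset.range m, thetaTerm q (j + p) * q ^ (p * (m - p))) =
      fun j => thetaTerm q j * (1 / (1 + q ^ (2 * j + m))) -
        thetaTerm q (j + m) * (1 / (1 + q ^ (2 * j + m))) := by
    funext j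
    have hy : 0 < q ^ (2 * j + (m : ℤ)) := zpow_pos h0 _
    have e := thetaTerm_add_mul h0 j m m le_rfl
    rw [Nat.sub_self, mul_zero, pow_zero, mul_one] at e
    rw [Finset.sum_congr rfl fun p hp =>
      thetaTerm_add_mul h0 j p m (Finset.mem_range.1 hp).le, ← Finset.mul_sum, e,
      geom_sum_eq (by linarith)]
    have : -q ^ (2 * j + (m : ℤ)) - 1 ≠ 0 := by linarith
    field_simp
    ring
  rw [h4] at h2
  rw [h2.unique (hA.sub h3)]
  ring

theorem lambertTerm_neg (h0 : 0 < q) (m : ℤ) :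
    lambertTerm q (-m) = (-1) ^ m - lambertTerm q m := by
  have : 0 < q ^ m := zpow_pos h0 m
  rw [lambertTerm, lambertTerm, neg_one_zpow_congr (a := -m) (b := m) ⟨-m, by ring⟩, zpow_neg]
  field_simp
  ring

theorem abs_lambertTerm_le (h0 : 0 < q) (m : ℤ) : |lambertTerm q m| ≤ q ^ m := by
  have : 0 < q ^ m := zpow_pos h0 m
  rw [lambertTerm, abs_mul, abs_neg_one_zpow, one_mul, abs_of_pos (by positivity)]
  exact div_le_self this.le (by linarith)

theorem summable_pow_succ (h0 : 0 < q) (h1 : q < 1) : Summable fun i : ℕ => q ^ ((i : ℤ) + 1) := by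
  have := (summable_geometric_of_lt_one h0.le h1).mul_right q
  refine Eq.mp (congrArg Summable (funext fun i => ?_)) this
  rw [zpow_add₀ h0.ne', zpow_natCast, zpow_one]

theorem summable_lambertTerm (h0 : 0 < q) (h1 : q < 1) :
    Summable fun i : ℕ => lambertTerm q (i + 1) :=
  Summable.of_norm_bounded (summable_pow_succ h0 h1) fun _ => abs_lambertTerm_le h0 _

theorem hasSum_sub_shift {a : ℕ → ℝ} (ha : Summable a) (N : ℕ) :
    HasSum (fun i => a i - a (i + N)) (∑ i ∈ Finset.range N, a i) := by
  have := ha.hasSum.sub ((hasSum_nat_add_iff' N).2 ha.hasSum)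
  rwa [sub_sub_cancel] at this

/-- The two series, shifted by `N` in opposite directions, telescope to a finite sum. -/
theorem tsum_lambert_div_add (h0 : 0 < q) (h1 : q < 1) {N : ℕ} (hN : Even N) (hpos : 0 < N) :
    ∑' i : ℕ, lambertTerm q (i + 1) * (1 / (1 + q ^ ((N : ℤ) + (i + 1)))) +
      ∑' i : ℕ, lambertTerm q (i + 1) * (1 / (1 + q ^ (-(N : ℤ) + (i + 1)))) =
    ∑ i ∈ Finset.range (N - 1), lambertTerm q (i + 1) + lambertTerm q N / 2 := by
  have hs := summable_lambertTerm h0 h1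
  have hQ : 0 < q ^ N := by positivity
  have hQ1 : q ^ N < 1 := pow_lt_one₀ h0.le h1 hpos.ne'
  have hNe : (-1 : ℝ) ^ N = 1 := hN.neg_one_pow
  have t1 := (hasSum_sub_shift hs N).mul_left (1 / (1 - q ^ N))
  have hs' : Summable fun i : ℕ => lambertTerm q ((i : ℤ) + 1 - N) := by
    rw [← summable_nat_add_iff N]
    refine Eq.mp (congrArg Summable (funext fun i => ?_)) hs
    congr 1
    push_cast
    ring
  have t2 := (hasSum_sub_shift hs' N).mul_left (q ^ N / (1 - q ^ N))
  have e1 : (fun i : ℕ => lambertTerm q (i + 1) * (1 / (1 + q ^ ((N : ℤ) + (i + 1))))) =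
      fun i : ℕ => 1 / (1 - q ^ N) *
        (lambertTerm q (i + 1) - lambertTerm q ((i + N : ℕ) + 1)) := by
    funext i
    have hx : 0 < q ^ ((i : ℤ) + 1) := zpow_pos h0 _
    rw [lambertTerm, lambertTerm, show ((i + N : ℕ) : ℤ) + 1 = N + (i + 1) by push_cast; ring,
      zpow_add₀ (show (-1 : ℝ) ≠ 0 by norm_num) (N : ℤ), zpow_add₀ h0.ne' (N : ℤ),
      zpow_natCast, zpow_natCast, hNe]
    generalize q ^ ((i : ℤ) + 1) = x at *
    have : 1 - q ^ N ≠ 0 := by linarith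
    field_simp
    ring
  have e2 : (fun i : ℕ => lambertTerm q (i + 1) * (1 / (1 + q ^ (-(N : ℤ) + (i + 1))))) =
      fun i : ℕ => q ^ N / (1 - q ^ N) *
        (lambertTerm q ((i : ℤ) + 1 - N) - lambertTerm q (((i + N : ℕ) : ℤ) + 1 - N)) := by
    funext i
    have hx : 0 < q ^ ((i : ℤ) + 1) := zpow_pos h0 _
    rw [lambertTerm, lambertTerm, lambertTerm,
      show ((i + N : ℕ) : ℤ) + 1 - N = i + 1 by push_cast; ring,
      show (i : ℤ) + 1 - N = -N + (i + 1) by ring,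
      zpow_add₀ (show (-1 : ℝ) ≠ 0 by norm_num) (-N : ℤ), zpow_add₀ h0.ne' (-N : ℤ),
      zpow_neg, zpow_neg,
      zpow_natCast, zpow_natCast, hNe]
    generalize q ^ ((i : ℤ) + 1) = x at *
    have : 1 - q ^ N ≠ 0 := by linarith
    field_simp
    ring
  rw [e1, e2, t1.tsum_eq, t2.tsum_eq]
  obtain ⟨M, rfl⟩ : ∃ M, N = M + 1 := ⟨N - 1, by omega⟩
  have e3 : ∑ i ∈ Finset.range (M + 1), lambertTerm q ((i : ℤ) + 1 - (M + 1 : ℕ)) =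
      -(1 / 2 + ∑ i ∈ Finset.range M, lambertTerm q (i + 1)) := by
    rw [← Finset.sum_range_reflect, Finset.sum_congr rfl (g := fun i : ℕ =>
      (-1 : ℝ) ^ i - lambertTerm q i), Finset.sum_sub_distrib,
      Finset.sum_range_succ' (fun i : ℕ => lambertTerm q i)]
    · rw [neg_one_geom_sum, if_pos hN, lambertTerm]
      push_cast
      norm_num
      ring
    · intro i hi
      rw [Finset.mem_range] at hi
      rw [← zpow_natCast, ← lambertTerm_neg h0]
      congr 1
      omega
  rw [e3, Nat.add_sub_cancel, Finset.sum_range_succ]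
  generalize ∑ i ∈ Finset.range M, lambertTerm q (i + 1) = S
  have e4 : lambertTerm q (M + 1) = q ^ (M + 1) / (1 + q ^ (M + 1)) := by
    rw [lambertTerm, ← Nat.cast_succ, zpow_natCast, zpow_natCast, hNe, one_mul]
  have : 1 - q ^ (M + 1) ≠ 0 := by linarith
  push_cast
  rw [e4]
  field_simp
  ring

end Lambert

section LambertIdentity

variable {q : ℝ}

/-- `∑_{m ≥ 1} (-1)^m q^m / ((1 + q^m) (1 + q^(2j+m)))` -/
noncomputable def lambertConv (q : ℝ) (j : ℤ) : ℝ :=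
  ∑' i : ℕ, lambertTerm q (i + 1) * (1 / (1 + q ^ (2 * j + (i + 1))))

/-- `∑_{m ≥ 1} sgn(2|j| - m) (-1)^m q^m / (1 + q^m)` -/
noncomputable def lambertSign (q : ℝ) (j : ℤ) : ℝ :=
  ∑' i : ℕ, lambertTerm q (i + 1) * ((2 * |j| - (i + 1)).sign : ℝ)

theorem abs_intCast_sign_le_one (m : ℤ) : |(m.sign : ℝ)| ≤ 1 := by
  rcases lt_trichotomy m 0 with h | rfl | h
  · simp [Int.sign_eq_neg_one_of_neg h]
  · simp
  · simp [Int.sign_eq_one_of_pos h]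

theorem summable_lambertTerm_mul (h0 : 0 < q) (h1 : q < 1) {c : ℕ → ℝ} (hc : ∀ i, |c i| ≤ 1) :
    Summable fun i : ℕ => lambertTerm q (i + 1) * c i := by
  refine Summable.of_norm_bounded (summable_pow_succ h0 h1) fun i => ?_
  rw [Real.norm_eq_abs, abs_mul, ← mul_one (q ^ ((i : ℤ) + 1))]
  exact mul_le_mul (abs_lambertTerm_le h0 _) (hc i) (abs_nonneg _) (zpow_pos h0 _).le

theorem lambertConv_add_neg_of_pos (h0 : 0 < q) (h1 : q < 1) {j : ℤ} (hj : 0 < j) :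
    lambertConv q j + lambertConv q (-j) =
      (∑' i : ℕ, lambertTerm q (i + 1)) / 2 + lambertSign q j / 2 := by
  obtain ⟨n, rfl⟩ : ∃ n : ℕ, j = (n + 1 : ℕ) := ⟨(j - 1).toNat, by omega⟩
  have h := tsum_lambert_div_add h0 h1 (N := 2 * (n + 1)) (even_two_mul _) (by omega)
  have h2 : HasSum (fun i : ℕ => lambertTerm q (i + 1) / 2 +
      lambertTerm q (i + 1) * ((2 * |((n + 1 : ℕ) : ℤ)| - (i + 1)).sign : ℝ) / 2)
      (∑ i ∈ Finset.range (2 * (n + 1) - 1), lambertTerm q (i + 1) +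
        lambertTerm q (2 * (n + 1) : ℕ) / 2) := by
    have h3 := hasSum_sum_of_ne_finset_zero (f := fun i : ℕ => lambertTerm q (i + 1) / 2 +
      lambertTerm q (i + 1) * ((2 * |((n + 1 : ℕ) : ℤ)| - (i + 1)).sign : ℝ) / 2)
      (s := Finset.range (2 * n + 1 + 1)) (L := SummationFilter.unconditional ℕ) ?_
    · convert h3 using 1
      rw [Finset.sum_range_succ]
      congr 1
      · refine Finset.sum_congr rfl fun i hi => ?_
        rw [Finset.mem_range] at hi
        rw [Int.sign_eq_one_of_pos (by rw [Nat.abs_cast]; omega)]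
        push_cast
        ring
      · rw [show (2 * |((n + 1 : ℕ) : ℤ)| - ((2 * n + 1 : ℕ) + 1)) = 0 by
          rw [Nat.abs_cast]; push_cast; ring]
        push_cast
        ring_nf
        simp
    · intro i hi
      rw [Finset.mem_range] at hi
      rw [Int.sign_eq_neg_one_of_neg (by rw [Nat.abs_cast]; omega)]
      push_cast
      ring
  have h4 := ((summable_lambertTerm h0 h1).hasSum.div_const 2).add
    ((summable_lambertTerm_mul h0 h1 fun i =>
      abs_intCast_sign_le_one (2 * |((n + 1 : ℕ) : ℤ)| - (i + 1))).hasSum.div_const 2)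
  rw [lambertSign, h4.unique h2, ← h, lambertConv, lambertConv]
  push_cast
  congr 5

theorem lambertConv_add_neg (h0 : 0 < q) (h1 : q < 1) (j : ℤ) :
    lambertConv q j + lambertConv q (-j) = (if j = 0 then 2 * lambertConv q 0 else 0) +
      (∑' i : ℕ, lambertTerm q (i + 1)) / 2 + lambertSign q j / 2 := by
  rcases lt_trichotomy j 0 with hj | rfl | hj
  · have h := lambertConv_add_neg_of_pos h0 h1 (neg_pos.2 hj)
    rw [neg_neg, lambertSign, abs_neg] at h
    rw [if_neg hj.ne, add_comm, h, zero_add, lambertSign]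
  · have : lambertSign q 0 = -∑' i : ℕ, lambertTerm q (i + 1) := by
      rw [lambertSign, ← tsum_neg]
      refine tsum_congr fun i => ?_
      rw [Int.sign_eq_neg_one_of_neg (by rw [abs_zero]; omega)]
      push_cast
      ring
    rw [if_pos rfl, this, neg_zero]
    ring
  · rw [lambertConv_add_neg_of_pos h0 h1 hj, if_neg hj.ne', zero_add]

theorem theta_mul_lambert (h0 : 0 < q) (h1 : q < 1) {S : ℝ}
    (hS : HasSum (fun i : ℕ => lambertTerm q (i + 1) *
      ∑ p ∈ Finset.range (i + 1), q ^ (p * (i + 1 - p))) S)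
    (hW : ∑' j, thetaTerm q j + 2 * ∑' j, thetaTerm q j * lambertSign q j = 1) :
    (∑' j, thetaTerm q j) * (1 + 2 * (∑' i : ℕ, lambertTerm q (i + 1)) + 4 * S) =
      1 + 8 * lambertConv q 0 := by
  have hθ := (summable_thetaTerm h0 h1).hasSum
  have hD := (summable_lambertTerm h0 h1).hasSum
  have hG : Summable (Function.uncurry fun (i : ℕ) (j : ℤ) =>
      lambertTerm q (i + 1) * (thetaTerm q j * (1 / (1 + q ^ (2 * j + (i + 1)))))) := by
    refine Summable.of_norm_bounded ((summable_pow_succ h0 h1).mul_of_nonneg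
      (summable_pow_sqExp h0 h1) (fun i => (zpow_pos h0 _).le) fun j => by positivity) ?_
    rintro ⟨i, j⟩
    rw [Function.uncurry_apply_pair, Real.norm_eq_abs, abs_mul, abs_mul, abs_thetaTerm h0]
    refine mul_le_mul (abs_lambertTerm_le h0 _) ?_ (by positivity) (zpow_pos h0 _).le
    exact mul_le_of_le_one_right (by positivity) (one_div_one_add_zpow_le h0 _)
  have e1 : ∀ j : ℤ, ∑' i : ℕ,
      lambertTerm q (i + 1) * (thetaTerm q j * (1 / (1 + q ^ (2 * j + (i + 1))))) =
      thetaTerm q j * lambertConv q j := by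
    intro j
    rw [lambertConv, ← tsum_mul_left]
    exact tsum_congr fun i => by ring
  have hswap := hG.tsum_comm
  rw [tsum_congr e1] at hswap
  have hZ : HasSum (fun j => thetaTerm q j * lambertConv q j)
      (∑' j, thetaTerm q j * lambertConv q j) := by
    have := ((Equiv.prodComm ℤ ℕ).summable_iff.2 hG).prod
    refine (Eq.mp (congrArg Summable (funext fun j => ?_)) this).hasSum
    exact e1 j
  have hA : HasSum (fun i : ℕ => lambertTerm q (i + 1) *
      ∑' j, thetaTerm q j * (1 / (1 + q ^ (2 * j + (i + 1)))))
      (∑' j, thetaTerm q j * lambertConv q j) := by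
    rw [hswap]
    simp only [tsum_mul_left]
    have := hG.prod
    simp only [Function.uncurry_apply_pair, tsum_mul_left] at this
    exact this.hasSum
  generalize ∑' j, thetaTerm q j * lambertConv q j = Z at hZ hA
  have hSZ : (∑' j, thetaTerm q j) * S =
      2 * Z - (∑' i : ℕ, lambertTerm q (i + 1)) * ∑' j, thetaTerm q j := by
    refine (hS.mul_left _).unique ?_
    refine Eq.mp (congrArg (HasSum · _) (funext fun i => ?_))
      ((hA.mul_left 2).sub (hD.mul_right _))
    rw [mul_left_comm (∑' j, thetaTerm q j), tsum_thetaTerm_mul_sum h0 h1]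
    push_cast
    ring
  have hZ' : HasSum (fun j => thetaTerm q j * lambertConv q (-j)) Z := by
    rw [← (Equiv.neg ℤ).hasSum_iff]
    refine Eq.mp (congrArg (HasSum · _) (funext fun j => ?_)) hZ
    simp [thetaTerm_neg]
  have hW' := ((hZ.add hZ').sub (hasSum_ite_eq (0 : ℤ) (2 * lambertConv q 0))).sub
    (hθ.mul_right ((∑' i : ℕ, lambertTerm q (i + 1)) / 2))
  have hW'' : HasSum (fun j => thetaTerm q j * lambertSign q j) (2 *
      (Z + Z - 2 * lambertConv q 0 -
        (∑' j, thetaTerm q j) * ((∑' i : ℕ, lambertTerm q (i + 1)) / 2))) := by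
    refine Eq.mp (congrArg (HasSum · _) (funext fun j => ?_)) (hW'.mul_left 2)
    have e := lambertConv_add_neg h0 h1 j
    rcases eq_or_ne j 0 with rfl | hj
    · have e0 : thetaTerm q 0 = 1 := by simp [thetaTerm, sqExp]
      rw [if_pos rfl] at e ⊢
      rw [e0]
      linear_combination 2 * e
    · rw [if_neg hj] at e ⊢
      linear_combination (2 * thetaTerm q j) * e
  rw [hW''.tsum_eq] at hW
  linear_combination hW + 4 * hSZ

end LambertIdentity

/-- `∑_{m,d ≥ 1} (-1)^(m+d-1) q^(md)` -/
noncomputable def divisorSeries : PowerSeries ℝ :=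
  genSeries mulExp fun x => (-1) ^ (x.1 + x.2 + 1)

/-- `x = (p, i, k)` is sent to `pq + qr + rp` with `q = i + 1`, `r = k + 1`. -/
def tripleExp (x : ℕ × ℕ × ℕ) : ℕ :=
  x.1 * (x.2.1 + 1) + (x.2.1 + 1) * (x.2.2 + 1) + (x.2.2 + 1) * x.1

/-- `∑_{p ≥ 0, q, r ≥ 1} (-1)^(p+q+r-1) X^(pq+qr+rp)` -/
noncomputable def tripleSeries : PowerSeries ℝ :=
  genSeries tripleExp fun x => (-1) ^ (x.1 + x.2.1 + x.2.2 + 1)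

theorem finite_tripleExp (n : ℕ) : {x | tripleExp x = n}.Finite := by
  refine ((Set.finite_Iic n).prod ((Set.finite_Iic n).prod (Set.finite_Iic n))).subset ?_
  rintro ⟨p, i, k⟩ (rfl : p * (i + 1) + (i + 1) * (k + 1) + (k + 1) * p = n)
  refine ⟨?_, ?_, ?_⟩ <;> simp only [Set.mem_Iic] <;> nlinarith [Nat.zero_le (i * k),
    Nat.zero_le (p * i), Nat.zero_le (p * k)]

theorem hasSum_of_eq {ι : Type*} {f g : ι → ℝ} {a b : ℝ} (h : HasSum f a) (hg : ∀ i, g i = f i)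
    (hb : b = a) : HasSum g b := by
  rwa [hb, funext hg]

section Evaluation

variable {q : ℝ}

theorem summable_pow_mulExp (h0 : 0 < q) (h1 : q < 1) : Summable fun x => q ^ mulExp x := by
  have hg := summable_geometric_of_lt_one h0.le h1
  refine Summable.of_nonneg_of_le (fun x => by positivity) (fun x => ?_)
    (hg.mul_of_nonneg hg (fun _ => by positivity) fun _ => by positivity)
  rw [← pow_add]
  refine pow_le_pow_of_le_one h0.le h1.le ?_
  rw [mulExp]
  nlinarith [Nat.zero_le (x.1 * x.2)]

theorem abs_neg_one_pow_mul (n : ℕ) (x : ℝ) : |(-1) ^ n * x| = |x| := by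
  rw [abs_mul, abs_neg_one_pow, one_mul]

theorem hasSum_alternating_geometric (h0 : 0 < q) (h1 : q < 1) (m : ℕ) :
    HasSum (fun k : ℕ => (-1 : ℝ) ^ (m + 1 + k) * q ^ ((m + 1) * (k + 1)))
      (lambertTerm q (m + 1)) := by
  have hy : q ^ (m + 1) < 1 := pow_lt_one₀ h0.le h1 (by omega)
  have hy0 : 0 < q ^ (m + 1) := by positivity
  have hg := (hasSum_geometric_of_norm_lt_one (ξ := -q ^ (m + 1))
    (by rwa [norm_neg, Real.norm_eq_abs, abs_of_pos hy0])).mul_left ((-1) ^ (m + 1) * q ^ (m + 1))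
  refine hasSum_of_eq hg (fun k => ?_) ?_
  · rw [neg_pow (q ^ (m + 1)), ← pow_mul]
    ring
  · rw [lambertTerm, ← Nat.cast_add_one, zpow_natCast, zpow_natCast, sub_neg_eq_add]
    ring

theorem hasSum_lambert (h0 : 0 < q) (h1 : q < 1) {c : ℕ → ℝ} (hc : ∀ i, |c i| ≤ 1) :
    HasSum (fun x : ℕ × ℕ => (-1) ^ (x.1 + x.2 + 1) * c x.2 * q ^ mulExp x)
      (∑' i : ℕ, lambertTerm q (i + 1) * c i) := by
  have hs : Summable fun x : ℕ × ℕ => (-1) ^ (x.1 + x.2 + 1) * c x.2 * q ^ mulExp x := by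
    refine Summable.of_norm_bounded (summable_pow_mulExp h0 h1) fun x => ?_
    rw [Real.norm_eq_abs, mul_assoc, abs_neg_one_pow_mul, abs_mul,
      abs_of_pos (a := q ^ mulExp x) (by positivity)]
    exact mul_le_of_le_one_left (by positivity) (hc _)
  have h := ((Equiv.prodComm ℕ ℕ).hasSum_iff.2 hs.hasSum).prod_fiberwise
    (g := fun i : ℕ => lambertTerm q (i + 1) * c i) fun i => ?_
  · rw [h.tsum_eq]
    exact hs.hasSum
  · refine Eq.mp (congrArg (HasSum · _) (funext fun k => ?_))
      ((hasSum_alternating_geometric h0 h1 i).mul_right (c i))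
    simp only [Function.comp_apply, Equiv.prodComm_apply, Prod.swap_prod_mk, mulExp]
    ring

theorem hasSum_thetaSeries (h0 : 0 < q) (h1 : q < 1) :
    HasSum (fun n => thetaSeries.coeff n * q ^ n) (∑' j, thetaTerm q j) :=
  hasSum_genSeries finite_sqExp (summable_thetaTerm h0 h1).hasSum

theorem hasSum_divisorSeries (h0 : 0 < q) (h1 : q < 1) :
    HasSum (fun n => divisorSeries.coeff n * q ^ n) (∑' i : ℕ, lambertTerm q (i + 1)) := by
  refine hasSum_genSeries finite_mulExp ?_
  simpa using hasSum_lambert h0 h1 (c := fun _ => 1) (by simp)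

theorem hasSum_sigmaSeries (h0 : 0 < q) (h1 : q < 1) :
    HasSum (fun n => sigmaSeries.coeff n * q ^ n) (lambertConv q 0) := by
  refine hasSum_genSeries finite_mulExp ?_
  have hs : Summable fun x : ℕ × ℕ =>
      (-1) ^ (x.1 + x.2 + 1) * ((x.2 : ℝ) + 1) * q ^ mulExp x := by
    have hg := summable_geometric_of_lt_one h0.le h1
    have hg' : Summable fun k : ℕ => ((k : ℝ) + 1) * q ^ k := by
      have := (summable_pow_mul_geometric_of_norm_lt_one (R := ℝ) 1
        (r := q) (by rwa [Real.norm_eq_abs, abs_of_pos h0])).add hg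
      refine Eq.mp (congrArg Summable (funext fun k => ?_)) this
      ring
    refine Summable.of_norm_bounded (hg.mul_of_nonneg hg' (fun _ => by positivity)
      fun _ => by positivity) fun x => ?_
    rw [Real.norm_eq_abs, mul_assoc, abs_neg_one_pow_mul, abs_of_pos (by positivity),
      mul_left_comm, ← pow_add]
    refine mul_le_mul_of_nonneg_left (pow_le_pow_of_le_one h0.le h1.le ?_) (by positivity)
    rw [mulExp]
    nlinarith [Nat.zero_le (x.1 * x.2)]
  have h := hs.hasSum.prod_fiberwise (g := fun i : ℕ =>
    lambertTerm q (i + 1) * (1 / (1 + q ^ (2 * (0 : ℤ) + (i + 1))))) fun i => ?_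
  · rw [lambertConv, h.tsum_eq]
    exact hs.hasSum
  · have hy : q ^ (i + 1) < 1 := pow_lt_one₀ h0.le h1 (by omega)
    have hy0 : 0 < q ^ (i + 1) := by positivity
    have hg := (hasSum_nat_add_iff' 1).2 (hasSum_coe_mul_geometric_of_norm_lt_one
      (r := -q ^ (i + 1)) (by rwa [norm_neg, Real.norm_eq_abs, abs_of_pos hy0]))
    refine hasSum_of_eq (hg.mul_left ((-1) ^ i)) (fun k => ?_) ?_
    · rw [mulExp, neg_pow (q ^ (i + 1)), ← pow_mul]
      push_cast
      ring
    · rw [lambertTerm, ← Nat.cast_add_one, mul_zero, zero_add, zpow_natCast, zpow_natCast]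
      simp only [Finset.range_one, Finset.sum_singleton, Nat.cast_zero, zero_mul, sub_zero,
        sub_neg_eq_add]
      field_simp
      ring

theorem hasSum_tripleSeries (h0 : 0 < q) (h1 : q < 1) :
    ∃ S, HasSum (fun i : ℕ => lambertTerm q (i + 1) *
        ∑ p ∈ Finset.range (i + 1), q ^ (p * (i + 1 - p))) S ∧
      HasSum (fun n => tripleSeries.coeff n * q ^ n) S := by
  have hs : Summable fun x : ℕ × ℕ × ℕ =>
      (-1) ^ (x.1 + x.2.1 + x.2.2 + 1) * q ^ tripleExp x := by
    have hg := summable_geometric_of_lt_one h0.le h1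
    refine Summable.of_norm_bounded (hg.mul_of_nonneg (hg.mul_of_nonneg hg (fun _ => by positivity)
      fun _ => by positivity) (fun _ => by positivity) fun _ => by positivity) fun x => ?_
    rw [Real.norm_eq_abs, abs_neg_one_pow_mul, abs_of_pos (by positivity), ← pow_add, ← pow_add]
    refine pow_le_pow_of_le_one h0.le h1.le ?_
    rw [tripleExp]
    nlinarith [Nat.zero_le (x.1 * x.2.1), Nat.zero_le (x.2.1 * x.2.2), Nat.zero_le (x.2.2 * x.1)]
  refine ⟨_, ?_, hasSum_genSeries finite_tripleExp hs.hasSum⟩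
  have h2 := ((Equiv.prodAssoc ℕ ℕ ℕ).hasSum_iff.2 hs.hasSum).prod_fiberwise
    (g := fun y : ℕ × ℕ => lambertTerm q ((y.1 + y.2 : ℕ) + 1) * q ^ (y.1 * (y.2 + 1)))
    fun y => ?_
  · have h3 := (Finset.HasAntidiagonal.sigmaAntidiagonalEquivProd (A := ℕ)).hasSum_iff.2 h2
    have h4 := h3.sigma (g := fun i : ℕ => lambertTerm q (i + 1) *
        ∑ p ∈ Finset.range (i + 1), q ^ (p * (i + 1 - p))) fun i => ?_
    · exact h4
    · refine hasSum_of_eq (hasSum_fintype _) (fun _ => rfl) ?_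
      rw [Finset.mul_sum, ← Finset.Nat.sum_antidiagonal_eq_sum_range_succ
        (fun p r => lambertTerm q (i + 1) * q ^ (p * (i + 1 - p))), ← Finset.sum_coe_sort]
      refine Finset.sum_congr rfl fun x _ => ?_
      have hx := Finset.HasAntidiagonal.mem_antidiagonal.1 x.2
      simp only [Function.comp_apply, Finset.HasAntidiagonal.sigmaAntidiagonalEquivProd_apply]
      rw [hx, show i + 1 - x.1.1 = x.1.2 + 1 by omega]
  · refine Eq.mp (congrArg (HasSum · _) (funext fun k => ?_))
      ((hasSum_alternating_geometric h0 h1 (y.1 + y.2)).mul_right (q ^ (y.1 * (y.2 + 1))))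
    simp only [Function.comp_apply, Equiv.prodAssoc_apply, tripleExp]
    ring

/-- `∑ (-1)^(j+m+d-1) sgn(2|j|-m) X^(j²+md)` -/
noncomputable def signSeries : PowerSeries ℝ :=
  genSeries (fun x : ℤ × ℕ × ℕ => sqExp x.1 + mulExp x.2) fun x =>
    (-1) ^ x.1 * ((-1) ^ (x.2.1 + x.2.2 + 1) * ((2 * |x.1| - (x.2.2 + 1)).sign : ℝ))

theorem hasSum_signSeries (h0 : 0 < q) (h1 : q < 1) :
    HasSum (fun n => signSeries.coeff n * q ^ n) (∑' j, thetaTerm q j * lambertSign q j) := by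
  refine hasSum_genSeries (finite_fiber_add finite_sqExp finite_mulExp) ?_
  have hs : Summable fun x : ℤ × ℕ × ℕ =>
      (-1) ^ x.1 * ((-1) ^ (x.2.1 + x.2.2 + 1) * ((2 * |x.1| - (x.2.2 + 1)).sign : ℝ)) *
        q ^ (sqExp x.1 + mulExp x.2) := by
    refine Summable.of_norm_bounded ((summable_pow_sqExp h0 h1).mul_of_nonneg
      (summable_pow_mulExp h0 h1) (fun _ => by positivity) fun _ => by positivity) fun x => ?_
    rw [Real.norm_eq_abs, ← pow_add, abs_mul, abs_mul, abs_neg_one_zpow, one_mul,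
      abs_neg_one_pow_mul, abs_of_pos (a := q ^ (sqExp x.1 + mulExp x.2)) (by positivity)]
    exact mul_le_of_le_one_left (by positivity) (abs_intCast_sign_le_one _)
  have h := hs.hasSum.prod_fiberwise (g := fun j => thetaTerm q j * lambertSign q j) fun j => ?_
  · rw [h.tsum_eq]
    exact hs.hasSum
  · refine Eq.mp (congrArg (HasSum · _) (funext fun x => ?_)) ((hasSum_lambert h0 h1 fun i =>
      abs_intCast_sign_le_one (2 * |j| - (i + 1))).mul_left (thetaTerm q j))
    rw [thetaTerm, pow_add]
    ring

end Evaluation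

theorem theta_add_two_mul_signSeries : thetaSeries + (2 : ℝ) • signSeries = 1 := by
  have hc : ∀ n, signSeries.coeff n =
      ∑ t ∈ windmill n, windmillSign t * ((t.2.2 - 2 * |t.1|).sign : ℝ) := by
    intro n
    rw [← coeff_genSeries_windmill, signSeries]
    congr 2
    funext x
    rw [windmillSign, zpow_add₀ (by norm_num), zpow_add₀ (by norm_num), zpow_add₀ (by norm_num),
      zpow_add₀ (by norm_num), zpow_natCast, zpow_natCast,
      show ((x.2.2 : ℤ) + 1 - 2 * |x.1|) = -(2 * |x.1| - (x.2.2 + 1)) by ring, Int.sign_neg]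
    push_cast
    ring
  ext n
  rw [map_add, PowerSeries.coeff_smul, hc, PowerSeries.coeff_one, smul_eq_mul, thetaSeries]
  by_cases hn : IsSquare n
  · obtain ⟨s, rfl⟩ := hn
    rw [← sq]
    rcases Nat.eq_zero_or_pos s with rfl | hs
    · rw [zero_pow two_ne_zero, coeff_genSeries_sqExp_zero, Finset.sum_eq_zero]
      · simp
      · intro t ht
        rw [mem_windmill] at ht
        obtain ⟨h1, h2, h3⟩ := ht
        exfalso
        push_cast at h3
        nlinarith [sq_nonneg t.1, mul_pos h1 h2]
    · rw [sum_windmill_sign_sq hs, coeff_genSeries_sqExp_sq _ hs, if_neg (by positivity)]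
      have : (-1 : ℝ) ^ (-(s : ℤ)) = (-1) ^ s := by
        rw [← zpow_natCast]; exact neg_one_zpow_congr ⟨-s, by ring⟩
      rw [this, zpow_natCast]
      ring
  · rw [sum_windmill_sign_not_sq hn, coeff_genSeries_sqExp_not_sq _ hn, if_neg]
    · simp
    · rintro rfl
      exact hn ⟨0, rfl⟩

theorem theta_pow_three : thetaSeries ^ 3 = 1 + 2 * divisorSeries + 4 * tripleSeries := by
  have hne : thetaSeries ≠ 0 := by
    intro h
    have := coeff_genSeries_sqExp_zero fun j => (-1) ^ j
    rw [← thetaSeries, h] at this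
    simp at this
  have e (c : ℝ) (P : PowerSeries ℝ) : PowerSeries.C c * P = c • P :=
    (PowerSeries.smul_eq_C_mul _ _).symm
  have hone (q : ℝ) : HasSum (fun n => (1 : PowerSeries ℝ).coeff n * q ^ n) 1 := by
    refine hasSum_of_eq (hasSum_ite_eq 0 1) (fun n => ?_) rfl
    rcases eq_or_ne n 0 with rfl | hn <;> simp [PowerSeries.coeff_one, *]
  have hadd {q A B : ℝ} {P Q : PowerSeries ℝ} (hP : HasSum (fun n => P.coeff n * q ^ n) A)
      (hQ : HasSum (fun n => Q.coeff n * q ^ n) B) :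
      HasSum (fun n => (P + Q).coeff n * q ^ n) (A + B) := by
    simpa [add_mul] using hP.add hQ
  have hsmul {q A : ℝ} {P : PowerSeries ℝ} (c : ℝ) (hP : HasSum (fun n => P.coeff n * q ^ n) A) :
      HasSum (fun n => (PowerSeries.C c * P).coeff n * q ^ n) (c * A) := by
    simpa [mul_assoc] using hP.mul_left c
  refine mul_left_cancel₀ hne ?_
  rw [← pow_succ', ← theta_pow_four]
  refine powerSeries_ext_of_hasSum (A := fun q => 1 + 8 * lambertConv q 0)
    (fun q h0 h1 => hadd (hone q) (hsmul 8 (hasSum_sigmaSeries h0 h1))) fun q h0 h1 => ?_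
  obtain ⟨S, hS, hT⟩ := hasSum_tripleSeries h0 h1
  have hW := hadd (hasSum_thetaSeries h0 h1) (hsmul 2 (hasSum_signSeries h0 h1))
  rw [e, theta_add_two_mul_signSeries] at hW
  rw [← theta_mul_lambert h0 h1 hS (hW.unique (hone q))]
  exact hasSum_coeff_mul (hasSum_thetaSeries h0 h1)
    (hadd (hadd (hone q) (hsmul 2 (hasSum_divisorSeries h0 h1))) (hsmul 4 hT))

theorem neg_one_pow_congr_mod {a b : ℕ} (h : a % 2 = b % 2) : (-1 : ℝ) ^ a = (-1) ^ b := by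
  rw [neg_one_pow_eq_pow_mod_two, h, ← neg_one_pow_eq_pow_mod_two]

theorem coeff_theta_pow_three (n : ℕ) : (thetaSeries ^ 3).coeff n = (-1) ^ n * r3 n := by
  have h2 := finite_fiber_add finite_sqExp finite_sqExp
  have h3 := finite_fiber_add finite_sqExp h2 n
  rw [pow_succ', sq, thetaSeries, genSeries_mul finite_sqExp finite_sqExp,
    genSeries_mul finite_sqExp h2, coeff_genSeries (S := h3.toFinset) _ (by simp),
    Finset.sum_congr rfl (g := fun _ => (-1 : ℝ) ^ n), Finset.sum_const, nsmul_eq_mul, mul_comm,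
    r3, ← Set.ncard_eq_toFinset_card _ h3]
  · congr 3
    ext x
    simp only [Set.mem_ofPred_eq, sqExp]
    zify
    simp only [sq_abs, add_assoc]
  · rintro ⟨x, y, z⟩ hx
    simp only [Set.Finite.mem_toFinset, Set.mem_ofPred_eq, sqExp] at hx
    zify at hx
    simp only [sq_abs] at hx
    rw [← zpow_natCast (-1 : ℝ) n, ← zpow_add₀ (by norm_num), ← zpow_add₀ (by norm_num), ← hx]
    refine neg_one_zpow_congr ?_
    have e (m : ℤ) : Even (m - m ^ 2) := by
      have := (Int.even_mul_succ_self (m - 1)).neg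
      rwa [show -((m - 1) * (m - 1 + 1)) = m - m ^ 2 by ring] at this
    rw [show x + (y + z) - (x ^ 2 + (y ^ 2 + z ^ 2)) = x - x ^ 2 + (y - y ^ 2 + (z - z ^ 2)) by ring]
    exact (e x).add ((e y).add (e z))

theorem mulExp_parity {n : ℕ} (hn : n % 4 = 1 ∨ n % 4 = 2) {x : ℕ × ℕ} (hx : mulExp x = n) :
    (x.1 + x.2 + 1) % 2 = n % 2 := by
  rw [mulExp] at hx
  have h4 : ((x.1 % 4 + 1) * (x.2 % 4 + 1)) % 4 = n % 4 := by
    rw [← hx]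
    simp [Nat.mul_mod, Nat.add_mod]
  have ha : x.1 % 4 < 4 := Nat.mod_lt _ (by norm_num)
  have hb : x.2 % 4 < 4 := Nat.mod_lt _ (by norm_num)
  generalize ea : x.1 % 4 = a at *
  generalize eb : x.2 % 4 = b at *
  interval_cases a <;> interval_cases b <;> omega

theorem tripleExp_parity {n : ℕ} (hn : n % 4 = 1 ∨ n % 4 = 2) {x : ℕ × ℕ × ℕ}
    (hx : tripleExp x = n) : (x.1 + x.2.1 + x.2.2 + 1) % 2 = n % 2 := by
  rw [tripleExp] at hx
  have h4 : ((x.1 % 4) * (x.2.1 % 4 + 1) + (x.2.1 % 4 + 1) * (x.2.2 % 4 + 1) +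
      (x.2.2 % 4 + 1) * (x.1 % 4)) % 4 = n % 4 := by
    rw [← hx]
    simp [Nat.mul_mod, Nat.add_mod]
  have ha : x.1 % 4 < 4 := Nat.mod_lt _ (by norm_num)
  have hb : x.2.1 % 4 < 4 := Nat.mod_lt _ (by norm_num)
  have hc : x.2.2 % 4 < 4 := Nat.mod_lt _ (by norm_num)
  generalize ea : x.1 % 4 = a at *
  generalize eb : x.2.1 % 4 = b at *
  generalize ec : x.2.2 % 4 = c at *
  interval_cases a <;> interval_cases b <;> interval_cases c <;> omega

theorem r3_eq_card {n : ℕ} (hn : n % 4 = 1 ∨ n % 4 = 2) :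
    r3 n = 2 * {x | mulExp x = n}.ncard + 4 * {x | tripleExp x = n}.ncard := by
  have h := coeff_theta_pow_three n
  have e2 : (2 : PowerSeries ℝ) = PowerSeries.C (2 : ℝ) := rfl
  have e4 : (4 : PowerSeries ℝ) = PowerSeries.C (4 : ℝ) := rfl
  have hd : divisorSeries.coeff n = (-1) ^ n * {x | mulExp x = n}.ncard := by
    have hf := finite_mulExp n
    rw [divisorSeries, coeff_genSeries (S := hf.toFinset) _ (by simp),
      Finset.sum_congr rfl (g := fun _ => (-1 : ℝ) ^ n), Finset.sum_const, nsmul_eq_mul, mul_comm,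
      ← Set.ncard_eq_toFinset_card _ hf]
    intro x hx
    exact neg_one_pow_congr_mod (mulExp_parity hn (by simpa using hx))
  have ht : tripleSeries.coeff n = (-1) ^ n * {x | tripleExp x = n}.ncard := by
    have hf := finite_tripleExp n
    rw [tripleSeries, coeff_genSeries (S := hf.toFinset) _ (by simp),
      Finset.sum_congr rfl (g := fun _ => (-1 : ℝ) ^ n), Finset.sum_const, nsmul_eq_mul, mul_comm,
      ← Set.ncard_eq_toFinset_card _ hf]
    intro x hx
    exact neg_one_pow_congr_mod (tripleExp_parity hn (by simpa using hx))
  rw [theta_pow_three, map_add, map_add, e2, e4, PowerSeries.coeff_C_mul, PowerSeries.coeff_C_mul,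
    hd, ht, PowerSeries.coeff_one, if_neg (by omega)] at h
  have hne : (-1 : ℝ) ^ n ≠ 0 := by positivity
  have : (r3 n : ℝ) = 2 * {x | mulExp x = n}.ncard + 4 * {x | tripleExp x = n}.ncard := by
    refine mul_left_cancel₀ hne ?_
    linear_combination -h
  exact_mod_cast this

/-- The triples `(p, q, r)` of natural numbers with `pq + qr + rp = n` -/
def triples (n : ℕ) : Finset (ℕ × ℕ × ℕ) :=
  (Finset.range (n + 1) ×ˢ Finset.range (n + 1) ×ˢ Finset.range (n + 1)).filter
    fun x => x.1 * x.2.1 + x.2.1 * x.2.2 + x.2.2 * x.1 = n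

theorem mem_triples {n : ℕ} (hn : 0 < n) {p q r : ℕ} :
    (p, q, r) ∈ triples n ↔ p * q + q * r + r * p = n := by
  simp only [triples, Finset.mem_filter, Finset.mem_product, Finset.mem_range, and_iff_right_iff_imp]
  rintro h
  have key : ∀ a b c : ℕ, a * b + b * c + c * a = n → a < n + 1 := by
    intro a b c h
    rcases Nat.eq_zero_or_pos (b + c) with h' | h'
    · obtain ⟨rfl, rfl⟩ : b = 0 ∧ c = 0 := by omega
      omega
    · nlinarith [Nat.mul_le_mul_left a h', Nat.zero_le (b * c)]
  exact ⟨key p q r h, key q r p (by linarith), key r p q (by linarith)⟩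

theorem sum_triples_swap_left {n : ℕ} (hn : 0 < n) (f : ℕ → ℕ → ℕ → ℚ) :
    ∑ x ∈ triples n, f x.2.1 x.1 x.2.2 = ∑ x ∈ triples n, f x.1 x.2.1 x.2.2 := by
  refine Finset.sum_nbij' (fun x => (x.2.1, x.1, x.2.2)) (fun x => (x.2.1, x.1, x.2.2)) ?_ ?_ ?_ ?_ ?_
  any_goals simp
  all_goals
    intro a b c
    rw [mem_triples hn, mem_triples hn]
    intro h
    linarith

theorem sum_triples_swap_right {n : ℕ} (hn : 0 < n) (f : ℕ → ℕ → ℕ → ℚ) :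
    ∑ x ∈ triples n, f x.1 x.2.2 x.2.1 = ∑ x ∈ triples n, f x.1 x.2.1 x.2.2 := by
  refine Finset.sum_nbij' (fun x => (x.1, x.2.2, x.2.1)) (fun x => (x.1, x.2.2, x.2.1)) ?_ ?_ ?_ ?_ ?_
  any_goals simp
  all_goals
    intro a b c
    rw [mem_triples hn, mem_triples hn]
    intro h
    linarith

/-- The sum of `f` over all permutations of its arguments -/
def symmetrize (f : ℕ → ℕ → ℕ → ℚ) (p q r : ℕ) : ℚ :=
  f p q r + f q p r + f p r q + f q r p + f r p q + f r q p

theorem sum_symmetrize {n : ℕ} (hn : 0 < n) (f : ℕ → ℕ → ℕ → ℚ) :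
    ∑ x ∈ triples n, symmetrize f x.1 x.2.1 x.2.2 = 6 * ∑ x ∈ triples n, f x.1 x.2.1 x.2.2 := by
  have hl := sum_triples_swap_left hn
  have hr := sum_triples_swap_right hn
  simp only [symmetrize, Finset.sum_add_distrib]
  have h1 := hl f
  have h2 := hr f
  have h3 : ∑ x ∈ triples n, f x.2.1 x.2.2 x.1 = _ := hl fun p q r => f p r q
  have h4 : ∑ x ∈ triples n, f x.2.2 x.1 x.2.1 = _ := hr fun p q r => f q p r
  have h5 : ∑ x ∈ triples n, f x.2.2 x.2.1 x.1 = _ := hl fun p q r => f r p q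
  rw [h5, h4, h3, h1, h2]
  ring

/-- The weight counting representations as sums of three squares -/
def squaresWeight (p q r : ℕ) : ℚ := if p = 0 then 6 else if q ≠ 0 ∧ r ≠ 0 then 4 else 0

/-- The weight counting the reduced forms `(p + r, ± 2r, q + r)` -/
def formsWeight (p q r : ℕ) : ℚ :=
  if r ≤ p ∧ p ≤ q then
    (if r = 0 ∧ p = q then 6 else if p = r ∧ r = q then 4 else 12) +
      if 0 < r ∧ r < p ∧ p < q then 12 else 0
  else 0

theorem symmetrize_swap_left (f : ℕ → ℕ → ℕ → ℚ) (p q r : ℕ) :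
    symmetrize f q p r = symmetrize f p q r := by
  simp only [symmetrize]; ring

theorem symmetrize_swap_right (f : ℕ → ℕ → ℕ → ℚ) (p q r : ℕ) :
    symmetrize f p r q = symmetrize f p q r := by
  simp only [symmetrize]; ring

theorem symmetrize_weight_of_le {p q r : ℕ} (h1 : r ≤ p) (h2 : p ≤ q) (hp : 0 < p) :
    symmetrize squaresWeight p q r = symmetrize formsWeight p q r := by
  have hq : 0 < q := by omega
  rcases h1.eq_or_lt with rfl | h1
  · rcases h2.eq_or_lt with rfl | h2
    · simp [symmetrize, squaresWeight, formsWeight, hp.ne']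
    · simp [symmetrize, squaresWeight, formsWeight, hp.ne', hq.ne', h2.le, h2.not_ge, h2.ne]
      norm_num
  · rcases h2.eq_or_lt with rfl | h2
    · rcases Nat.eq_zero_or_pos r with rfl | hr
      · simp [symmetrize, squaresWeight, formsWeight, hp.ne', hp.not_ge]
      · simp [symmetrize, squaresWeight, formsWeight, hp.ne', hr.ne', h1.le, h1.not_ge, h1.ne']
        norm_num
    · have h3 := h1.trans h2
      rcases Nat.eq_zero_or_pos r with rfl | hr
      · simp [symmetrize, squaresWeight, formsWeight, hp.ne', hq.ne', h2.le, h2.not_ge, h2.ne]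
        norm_num
      · simp [symmetrize, squaresWeight, formsWeight, hp.ne', hq.ne', hr.ne', h2.le, h2.not_ge,
          h2.ne, h1.le, h1.not_ge, h1.ne', h3.le, h3.not_ge, h1, h2, hr]
        norm_num

theorem symmetrize_weight {p q r : ℕ} (h : p * q + q * r + r * p ≠ 0) :
    symmetrize squaresWeight p q r = symmetrize formsWeight p q r := by
  have hp : (p = 0 → q ≠ 0 ∧ r ≠ 0) ∧ (q = 0 → r ≠ 0) := by
    refine ⟨?_, ?_⟩
    · rintro rfl
      simpa using h
    · rintro rfl rfl
      simp at h
  have e1 (f) : symmetrize f p q r = symmetrize f q p r := (symmetrize_swap_left f p q r).symm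
  have e2 (f) : symmetrize f p q r = symmetrize f p r q := (symmetrize_swap_right f p q r).symm
  have e3 (f) : symmetrize f p q r = symmetrize f q r p := by simp only [symmetrize]; ring
  have e4 (f) : symmetrize f p q r = symmetrize f r p q := by simp only [symmetrize]; ring
  have e5 (f) : symmetrize f p q r = symmetrize f r q p := by simp only [symmetrize]; ring
  rcases le_total p q with h1 | h1 <;> rcases le_total q r with h2 | h2
  · rw [e3, e3]
    exact symmetrize_weight_of_le h1 h2 (by omega)
  · rcases le_total p r with h3 | h3
    · rw [e5, e5]
      exact symmetrize_weight_of_le h3 h2 (by omega)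
    · exact symmetrize_weight_of_le h3 h1 (by omega)
  · rcases le_total p r with h3 | h3
    · rw [e2, e2]
      exact symmetrize_weight_of_le h1 h3 (by omega)
    · rw [e4, e4]
      exact symmetrize_weight_of_le h2 h3 (by omega)
  · rw [e1, e1]
    exact symmetrize_weight_of_le h2 h1 (by omega)

theorem sum_squaresWeight_eq_sum_formsWeight {n : ℕ} (hn : 0 < n) :
    ∑ x ∈ triples n, squaresWeight x.1 x.2.1 x.2.2 =
      ∑ x ∈ triples n, formsWeight x.1 x.2.1 x.2.2 := by
  have h : ∑ x ∈ triples n, symmetrize squaresWeight x.1 x.2.1 x.2.2 =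
      ∑ x ∈ triples n, symmetrize formsWeight x.1 x.2.1 x.2.2 := by
    refine Finset.sum_congr rfl ?_
    rintro ⟨p, q, r⟩ hx
    rw [mem_triples hn] at hx
    exact symmetrize_weight (by dsimp only; omega)
  rw [sum_symmetrize hn, sum_symmetrize hn] at h
  linarith

theorem sum_squaresWeight {n : ℕ} (hn : 0 < n) :
    ∑ x ∈ triples n, squaresWeight x.1 x.2.1 x.2.2 =
      2 * {x | mulExp x = n}.ncard + 4 * {x | tripleExp x = n}.ncard := by
  have h1 : ((triples n).filter fun x => x.1 = 0).card = {x | mulExp x = n}.ncard := by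
    rw [← Set.ncard_coe_finset]
    symm
    refine Set.ncard_congr (fun x _ => (0, x.1 + 1, x.2 + 1)) ?_ ?_ ?_
    · rintro ⟨i, k⟩ hx
      simpa [mem_triples hn, mulExp] using hx
    · rintro ⟨i, k⟩ ⟨i', k'⟩ _ _ h
      simpa using h
    · rintro ⟨p, q, r⟩ hx
      simp only [Finset.coe_filter, Set.mem_ofPred_eq, mem_triples hn] at hx
      obtain ⟨hx, rfl⟩ := hx
      simp only [zero_mul, mul_zero, zero_add, add_zero] at hx
      obtain ⟨i, rfl⟩ := Nat.exists_eq_succ_of_ne_zero (n := q) (by rintro rfl; simp at hx; omega)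
      obtain ⟨k, rfl⟩ := Nat.exists_eq_succ_of_ne_zero (n := r) (by rintro rfl; simp at hx; omega)
      exact ⟨(i, k), hx, rfl⟩
  have h2 : ((triples n).filter fun x => x.2.1 ≠ 0 ∧ x.2.2 ≠ 0).card =
      {x | tripleExp x = n}.ncard := by
    rw [← Set.ncard_coe_finset]
    symm
    refine Set.ncard_congr (fun x _ => (x.1, x.2.1 + 1, x.2.2 + 1)) ?_ ?_ ?_
    · rintro ⟨p, i, k⟩ hx
      simpa [mem_triples hn, tripleExp] using hx
    · rintro ⟨p, i, k⟩ ⟨p', i', k'⟩ _ _ h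
      simpa using h
    · rintro ⟨p, q, r⟩ hx
      simp only [Finset.coe_filter, Set.mem_ofPred_eq, mem_triples hn] at hx
      obtain ⟨hx, hq, hr⟩ := hx
      obtain ⟨i, rfl⟩ := Nat.exists_eq_succ_of_ne_zero hq
      obtain ⟨k, rfl⟩ := Nat.exists_eq_succ_of_ne_zero hr
      exact ⟨(p, i, k), hx, rfl⟩
  rw [← h1, ← h2, Finset.card_filter, Finset.card_filter, Nat.cast_sum, Nat.cast_sum,
    Finset.mul_sum, Finset.mul_sum, ← Finset.sum_add_distrib]
  refine Finset.sum_congr rfl ?_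
  rintro ⟨p, q, r⟩ hx
  rw [mem_triples hn] at hx
  dsimp only
  rw [squaresWeight]
  by_cases hp : p = 0
  · subst hp
    have hqr : q ≠ 0 ∧ r ≠ 0 := by
      constructor
      · rintro rfl
        simp at hx
        omega
      · rintro rfl
        simp at hx
        omega
    rw [if_pos rfl, if_pos rfl, if_pos hqr]
    norm_num
  · rw [if_neg hp, if_neg hp]
    split_ifs <;> norm_num

/-- The reduced form `(p + r, 2r, q + r)` -/
def formOfTriple (x : ℕ × ℕ × ℕ) : ℤ × ℤ × ℤ := (x.1 + x.2.2, 2 * x.2.2, x.2.1 + x.2.2)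

/-- The reduced form `(p + r, -2r, q + r)` -/
def conjFormOfTriple (x : ℕ × ℕ × ℕ) : ℤ × ℤ × ℤ := (x.1 + x.2.2, -2 * x.2.2, x.2.1 + x.2.2)

theorem reducedForms_four_mul {n : ℕ} (hn : 0 < n) :
    reducedForms (4 * n) =
      formOfTriple '' ((triples n).filter fun x => x.2.2 ≤ x.1 ∧ x.1 ≤ x.2.1) ∪
      conjFormOfTriple '' ((triples n).filter fun x => 0 < x.2.2 ∧ x.2.2 < x.1 ∧ x.1 < x.2.1) := by
  ext ⟨a, b, c⟩
  simp only [reducedForms, Set.mem_ofPred_eq, Set.mem_union, Set.mem_image, Finset.coe_filter,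
    Prod.exists, mem_triples hn, formOfTriple, conjFormOfTriple, Prod.mk.injEq]
  constructor
  · rintro ⟨ha, hd, hb, hac, hsgn⟩
    obtain ⟨e, rfl⟩ : ∃ e, b = 2 * e := by
      have : Even (b ^ 2) := ⟨2 * (a * c) - 2 * n, by push_cast at hd; linarith⟩
      obtain ⟨e, rfl⟩ := (Int.even_pow' two_ne_zero).1 this
      exact ⟨e, by ring⟩
    push_cast at hd
    rcases le_or_gt 0 e with he | he
    · rw [abs_of_nonneg (by omega)] at hb
      left
      refine ⟨(a - e).toNat, (c - e).toNat, e.toNat, ⟨?_, by omega, by omega⟩, by omega, by omega,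
        by omega⟩
      zify
      rw [Int.toNat_of_nonneg (by omega), Int.toNat_of_nonneg (by omega),
        Int.toNat_of_nonneg (by omega)]
      linarith
    · rw [abs_of_neg (by omega)] at hb hsgn
      right
      refine ⟨(a + e).toNat, (c + e).toNat, (-e).toNat, ⟨?_, by omega, by omega, by omega⟩,
        by omega, by omega, by omega⟩
      zify
      rw [Int.toNat_of_nonneg (by omega), Int.toNat_of_nonneg (by omega),
        Int.toNat_of_nonneg (by omega)]
      linarith
  · rintro (⟨p, q, r, ⟨h, h1, h2⟩, rfl, rfl, rfl⟩ | ⟨p, q, r, ⟨h, h0, h1, h2⟩, rfl, rfl, rfl⟩)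
    · have hp : 0 < p := by
        rcases Nat.eq_zero_or_pos p with rfl | hp
        · obtain rfl : r = 0 := by omega
          simp at h
          omega
        · exact hp
      refine ⟨by omega, ?_, ?_, by omega, fun _ => by omega⟩
      · rw [← h]
        push_cast
        ring
      · rw [abs_of_nonneg (by omega)]
        omega
    · have habs : |-2 * (r : ℤ)| = 2 * r := by rw [abs_of_neg (by omega)]; ring
      rw [habs]
      refine ⟨by omega, ?_, by omega, by omega, by omega⟩
      rw [← h]
      push_cast
      ring

theorem twelve_mul_hurwitzClassNumber {n : ℕ} (hn : 0 < n) :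
    12 * hurwitzClassNumber (4 * n) = ∑ x ∈ triples n, formsWeight x.1 x.2.1 x.2.2 := by
  have hi1 : Function.Injective formOfTriple := by
    rintro ⟨p, q, r⟩ ⟨p', q', r'⟩ h
    simp only [formOfTriple, Prod.mk.injEq] at h ⊢
    omega
  have hi2 : Function.Injective conjFormOfTriple := by
    rintro ⟨p, q, r⟩ ⟨p', q', r'⟩ h
    simp only [conjFormOfTriple, Prod.mk.injEq] at h ⊢
    omega
  rw [hurwitzClassNumber, reducedForms_four_mul hn, finsum_mem_union,
    finsum_mem_image hi1.injOn, finsum_mem_image hi2.injOn, finsum_mem_coe_finset,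
    finsum_mem_coe_finset, Finset.sum_filter, Finset.sum_filter, ← Finset.sum_add_distrib,
    Finset.mul_sum]
  · refine Finset.sum_congr rfl ?_
    rintro ⟨p, q, r⟩ hx
    have e1 : ((2 * (r : ℤ) = 0 ∧ (p : ℤ) + r = q + r) ↔ (r = 0 ∧ p = q)) := by omega
    have e2 : (((p : ℤ) + r = 2 * r ∧ 2 * (r : ℤ) = q + r) ↔ (p = r ∧ r = q)) := by omega
    have w1 : hurwitzWeight (formOfTriple (p, q, r)) =
        if r = 0 ∧ p = q then 1 / 2 else if p = r ∧ r = q then 1 / 3 else 1 := by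
      simp only [hurwitzWeight, formOfTriple, e1, e2]
    have w2 (hr : 0 < r) : hurwitzWeight (conjFormOfTriple (p, q, r)) = 1 := by
      rw [hurwitzWeight, if_neg, if_neg] <;> simp only [conjFormOfTriple] <;> omega
    dsimp only
    rw [formsWeight, w1]
    by_cases hs : 0 < r ∧ r < p ∧ p < q
    · have c1 : r ≤ p ∧ p ≤ q := by omega
      have c2 : ¬(r = 0 ∧ p = q) := by omega
      have c3 : ¬(p = r ∧ r = q) := by omega
      rw [w2 hs.1, if_pos hs, if_pos c1, if_pos c1, if_pos hs, if_neg c2, if_neg c3, if_neg c2,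
        if_neg c3]
      norm_num
    · rw [if_neg hs, if_neg hs]
      split_ifs <;> norm_num
  · rw [Set.disjoint_left]
    rintro _ ⟨⟨p, q, r⟩, -, rfl⟩ ⟨⟨p', q', r'⟩, h, h'⟩
    simp only [Finset.coe_filter, Set.mem_ofPred_eq] at h
    simp only [formOfTriple, conjFormOfTriple, Prod.mk.injEq] at h'
    omega
  · exact (Finset.finite_toSet _).image _
  · exact (Finset.finite_toSet _).image _

/-- Gauss: `r₃(n) = 12 H(4n)` for `n ≡ 1, 2, 5, 6 (mod 8)`. -/
theorem r3_eq_twelve_hurwitz (n : ℕ) (hn : 0 < n)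
    (h : n % 8 = 1 ∨ n % 8 = 2 ∨ n % 8 = 5 ∨ n % 8 = 6) :
    (r3 n : ℚ) = 12 * hurwitzClassNumber (4 * n) := by
  rw [twelve_mul_hurwitzClassNumber hn, ← sum_squaresWeight_eq_sum_formsWeight hn,
    sum_squaresWeight hn, r3_eq_card (by omega)]
  push_cast
  rfl
end

section
/- For every positive integer n with n ≡ 3 (mod 8), r_3(n) = 24·H(n). -/
theorem ncard_eq_of_inverse {α β : Type*} {s : Set α} {t : Set β} (f : α → β) (g : β → α)
    (hf : ∀ a ∈ s, f a ∈ t ∧ g (f a) = a) (hg : ∀ b ∈ t, g b ∈ s ∧ f (g b) = b) :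
    s.ncard = t.ncard :=
  Set.ncard_congr (fun a _ => f a) (fun a ha => (hf a ha).1)
    (fun a b ha hb hab => by rw [← (hf a ha).2, ← (hf b hb).2, hab])
    (fun b hb => ⟨g b, (hg b hb).1, (hg b hb).2⟩)

theorem ncard_eq_add_ncard {α : Type*} {s : Set α} (hs : s.Finite) (P : α → Prop) :
    s.ncard = {a ∈ s | P a}.ncard + {a ∈ s | ¬ P a}.ncard := by
  rw [← Set.ncard_union_eq _ (hs.subset fun a ha => ha.1) (hs.subset fun a ha => ha.1)]
  · congr 1
    ext a
    simp only [Set.mem_union, Set.mem_ofPred_eq]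
    tauto
  · rw [Set.disjoint_left]
    rintro a ⟨_, h⟩ ⟨_, h'⟩
    exact h' h

/-- Odd positive integers. -/
def OddPos (x : ℤ) : Prop := 0 < x ∧ x % 2 = 1

/-- Quadruples of odd positive integers with `w² + xy + yz + zx = 4m`. -/
def classSols (m : ℤ) : Set (ℤ × ℤ × ℤ × ℤ) :=
  {v | OddPos v.1 ∧ OddPos v.2.1 ∧ OddPos v.2.2.1 ∧ OddPos v.2.2.2 ∧
    v.1 ^ 2 + v.2.1 * v.2.2.1 + v.2.2.1 * v.2.2.2 + v.2.2.2 * v.2.1 = 4 * m}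

/-- Quadruples `(e, c, n, d)` with `e > 0`, the others odd positive, `d < 2n` and
`e² + ed + nc = m`. -/
def middleSols (m : ℤ) : Set (ℤ × ℤ × ℤ × ℤ) :=
  {v | 0 < v.1 ∧ OddPos v.2.1 ∧ OddPos v.2.2.1 ∧ OddPos v.2.2.2 ∧ v.2.2.2 < 2 * v.2.2.1 ∧
    v.1 ^ 2 + v.1 * v.2.2.2 + v.2.2.1 * v.2.1 = m}

/-- Quadruples `(e, b, p, n)` with `eb + pn = m`, `|p| < e`, `|n| < b - e` and suitable parities. -/
def coneSols (m : ℤ) : Set (ℤ × ℤ × ℤ × ℤ) :=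
  {v | v.1 * v.2.1 + v.2.2.1 * v.2.2.2 = m ∧ |v.2.2.1| < v.1 ∧ |v.2.2.2| < v.2.1 - v.1 ∧
    v.2.2.2 % 2 = 1 ∧ (v.2.1 - v.1) % 2 = 0 ∧ (v.2.2.1 + v.1) % 2 = 1}

theorem finite_of_box {s : Set (ℤ × ℤ × ℤ × ℤ)} (k : ℤ)
    (h : ∀ v ∈ s, |v.1| ≤ k ∧ |v.2.1| ≤ k ∧ |v.2.2.1| ≤ k ∧ |v.2.2.2| ≤ k) : s.Finite := by
  refine (Set.finite_Icc ((-k, -k, -k, -k) : ℤ × ℤ × ℤ × ℤ) (k, k, k, k)).subset ?_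
  rintro ⟨a, b, c, d⟩ hv
  have := h _ hv
  simp only [abs_le] at this
  obtain ⟨⟨_, _⟩, ⟨_, _⟩, ⟨_, _⟩, _, _⟩ := this
  refine ⟨⟨?_, ?_, ?_, ?_⟩, ⟨?_, ?_, ?_, ?_⟩⟩ <;> assumption

theorem classSols_finite (m : ℤ) : (classSols m).Finite := by
  refine finite_of_box (4 * m) ?_
  rintro ⟨w, x, y, z⟩ ⟨⟨hw, _⟩, ⟨hx, _⟩, ⟨hy, _⟩, ⟨hz, _⟩, h⟩
  dsimp only at *
  rw [abs_of_pos hw, abs_of_pos hx, abs_of_pos hy, abs_of_pos hz]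
  have h1 := mul_pos hx hy
  have h2 := mul_pos hy hz
  have h3 := mul_pos hz hx
  refine ⟨?_, ?_, ?_, ?_⟩ <;> nlinarith

theorem middleSols_finite (m : ℤ) : (middleSols m).Finite := by
  refine finite_of_box (2 * m) ?_
  rintro ⟨e, c, n, d⟩ ⟨he, ⟨hc, _⟩, ⟨hn, _⟩, ⟨hd, _⟩, _, h⟩
  dsimp only at *
  rw [abs_of_pos he, abs_of_pos hc, abs_of_pos hn, abs_of_pos hd]
  have h1 := mul_pos he hd
  have h2 := mul_pos hn hc
  refine ⟨?_, ?_, ?_, ?_⟩ <;> nlinarith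

theorem coneSols_finite (m : ℤ) : (coneSols m).Finite := by
  refine finite_of_box m ?_
  rintro ⟨e, b, p, n⟩ ⟨h, hp, hn, _⟩
  dsimp only at *
  have he : 0 < e := (abs_nonneg p).trans_lt hp
  have hb : 0 < b - e := (abs_nonneg n).trans_lt hn
  have h1 : -(p * n) ≤ (e - 1) * (b - e - 1) := by
    calc -(p * n) ≤ |p * n| := neg_le_abs _
      _ = |p| * |n| := abs_mul _ _
      _ ≤ (e - 1) * (b - e - 1) := by
        apply mul_le_mul <;> first | omega | positivity
  have hbm : b ≤ m := by nlinarith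
  have : |b| = b := abs_of_pos (by linarith)
  have : |e| = e := abs_of_pos he
  refine ⟨?_, ?_, ?_, ?_⟩ <;> omega

theorem classSols_parity {m w x y z : ℤ} (hm : m % 2 = 1) (h : (w, x, y, z) ∈ classSols m) :
    (x + y) % 4 = 2 ∧ (y + z) % 4 = 2 ∧ (z + x) % 4 = 2 := by
  obtain ⟨⟨_, hw⟩, ⟨_, hx⟩, ⟨_, hy⟩, ⟨_, hz⟩, h⟩ := h
  dsimp only at *
  have key : ∀ a b c : ℤ, a % 2 = 1 → b % 2 = 1 → c % 2 = 1 →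
      w ^ 2 + a * b + b * c + c * a = 4 * m → (a + b) % 4 = 2 ∧ (b + c) % 4 = 2 := by
    intro a b c ha hb hc h
    obtain ⟨k, hk⟩ : (8 : ℤ) ∣ w ^ 2 - b ^ 2 :=
by
        have h2 := dvd_sub (Int.eight_dvd_sq_sub_one_of_odd (Int.odd_iff.2 hw))
          (Int.eight_dvd_sq_sub_one_of_odd (Int.odd_iff.2 hb))
        rwa [sub_sub_sub_cancel_right] at h2
    obtain ⟨s, hs⟩ : ∃ s, a + b = 2 * s := ⟨(a + b) / 2, by omega⟩
    obtain ⟨t, ht⟩ : ∃ t, b + c = 2 * t := ⟨(b + c) / 2, by omega⟩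
    have hst : s * t = m - 2 * k := by
      have : (a + b) * (b + c) = 4 * m - 8 * k := by rw [← hk]; linarith
      rw [hs, ht] at this
      linarith
    have hodd : Odd (s * t) := Int.odd_iff.2 (by omega)
    rw [Int.odd_mul, Int.odd_iff, Int.odd_iff] at hodd
    omega
  have h1 := key x y z hx hy hz h
  have h2 := key y z x hy hz hx (by linarith)
  exact ⟨h1.1, h1.2, h2.2⟩

theorem ncard_classSols_gt {m : ℤ} (hm : m % 2 = 1) :
    {v ∈ classSols m | v.2.2.1 < v.1}.ncard =
      {v ∈ middleSols m | v.2.2.2 < 2 * v.2.1}.ncard := by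
  refine ncard_eq_of_inverse
    (fun v => ((v.1 - v.2.2.1) / 2, (v.2.2.1 + v.2.2.2) / 2, (v.2.1 + v.2.2.1) / 2, v.2.2.1))
    (fun v => (2 * v.1 + v.2.2.2, 2 * v.2.2.1 - v.2.2.2, v.2.2.2, 2 * v.2.1 - v.2.2.2)) ?_ ?_
  · rintro ⟨w, x, y, z⟩ ⟨hv, hwy⟩
    have hpar := classSols_parity hm hv
    obtain ⟨⟨hw0, hw⟩, ⟨hx0, hx⟩, ⟨hy0, hy⟩, ⟨hz0, hz⟩, h⟩ := hv
    dsimp only at *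
    obtain ⟨e, he⟩ : ∃ e, w = y + 2 * e := ⟨(w - y) / 2, by omega⟩
    obtain ⟨c, hc⟩ : ∃ c, z = 2 * c - y := ⟨(y + z) / 2, by omega⟩
    obtain ⟨n, hn⟩ : ∃ n, x = 2 * n - y := ⟨(x + y) / 2, by omega⟩
    subst he hc hn
    have e1 : (y + 2 * e - y) / 2 = e := by omega
    have e2 : (y + (2 * c - y)) / 2 = c := by omega
    have e3 : (2 * n - y + y) / 2 = n := by omega
    rw [e1, e2, e3]
    refine ⟨⟨⟨?_, ⟨?_, ?_⟩, ⟨?_, ?_⟩, ⟨?_, ?_⟩, ?_, ?_⟩, ?_⟩, ?_⟩ <;> try dsimp only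
    any_goals omega
    · linarith
    · ext <;> dsimp only <;> ring
  · rintro ⟨e, c, n, d⟩ ⟨⟨he, ⟨hc0, hc⟩, ⟨hn0, hn⟩, ⟨hd0, hd⟩, hdn, h⟩, hdc⟩
    dsimp only at *
    refine ⟨⟨⟨⟨?_, ?_⟩, ⟨?_, ?_⟩, ⟨?_, ?_⟩, ⟨?_, ?_⟩, ?_⟩, ?_⟩, ?_⟩ <;> try dsimp only
    any_goals omega
    · linarith
    · ext <;> dsimp only <;> omega

theorem ncard_classSols_lt {m : ℤ} (hm : m % 2 = 1) :
    {v ∈ classSols m | v.1 < v.2.2.1}.ncard =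
      {v ∈ middleSols m | 2 * v.2.2.1 < 2 * v.2.1 + 4 * v.1 + v.2.2.2}.ncard := by
  refine ncard_eq_of_inverse
    (fun v => if v.2.2.1 < v.2.2.2 + 2 * v.1 then
        ((v.2.2.1 - v.1) / 2, (v.2.2.2 + 2 * v.1 - v.2.2.1) / 2, (v.2.1 + v.2.2.1) / 2, v.2.1)
      else
        ((v.2.2.2 + v.1) / 2, (v.2.2.1 - 2 * v.1 - v.2.2.2) / 2, (v.2.1 + v.2.2.2) / 2, v.2.1))
    (fun v => if 0 < 2 * v.2.2.1 - v.2.2.2 - 2 * v.1 then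
        (2 * v.2.2.1 - v.2.2.2 - 2 * v.1, v.2.2.2, 2 * v.2.2.1 - v.2.2.2,
          2 * v.2.1 + 4 * v.1 + v.2.2.2 - 2 * v.2.2.1)
      else
        (2 * v.1 + v.2.2.2 - 2 * v.2.2.1, v.2.2.2, 2 * v.2.1 + 4 * v.1 + v.2.2.2 - 2 * v.2.2.1,
          2 * v.2.2.1 - v.2.2.2)) ?_ ?_
  · rintro ⟨w, x, y, z⟩ ⟨hv, hwy⟩
    have hpar := classSols_parity hm hv
    obtain ⟨⟨hw0, hw⟩, ⟨hx0, hx⟩, ⟨hy0, hy⟩, ⟨hz0, hz⟩, h⟩ := hv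
    dsimp only at *
    by_cases hyz : y < z + 2 * w
    · rw [if_pos hyz]
      obtain ⟨e, he⟩ : ∃ e, w = y - 2 * e := ⟨(y - w) / 2, by omega⟩
      obtain ⟨n, hn⟩ : ∃ n, y = 2 * n - x := ⟨(x + y) / 2, by omega⟩
      obtain ⟨c, hc⟩ : ∃ c, z = 2 * c + y - 2 * w := ⟨(z + 2 * w - y) / 2, by omega⟩
      subst hc he hn
      have e1 : (2 * n - x - (2 * n - x - 2 * e)) / 2 = e := by omega
      have e2 : (2 * c + (2 * n - x) - 2 * (2 * n - x - 2 * e) + 2 * (2 * n - x - 2 * e) -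
        (2 * n - x)) / 2 = c := by omega
      have e3 : (x + (2 * n - x)) / 2 = n := by omega
      rw [e1, e2, e3]
      refine ⟨⟨⟨?_, ⟨?_, ?_⟩, ⟨?_, ?_⟩, ⟨?_, ?_⟩, ?_, ?_⟩, ?_⟩, ?_⟩
      any_goals (dsimp only; omega)
      · dsimp only; linarith
      · dsimp only
        rw [if_pos (by omega)]
        ext <;> dsimp only <;> ring
    · rw [if_neg hyz]
      obtain ⟨e, he⟩ : ∃ e, z = 2 * e - w := ⟨(z + w) / 2, by omega⟩
      obtain ⟨n, hn⟩ : ∃ n, z = 2 * n - x := ⟨(x + z) / 2, by omega⟩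
      obtain ⟨c, hc⟩ : ∃ c, y = 2 * c + 2 * w + z := ⟨(y - 2 * w - z) / 2, by omega⟩
      have e1 : (z + w) / 2 = e := by omega
      have e2 : (y - 2 * w - z) / 2 = c := by omega
      have e3 : (x + z) / 2 = n := by omega
      rw [e1, e2, e3]
      obtain rfl : w = 2 * e - 2 * n + x := by omega
      subst hc hn
      refine ⟨⟨⟨?_, ⟨?_, ?_⟩, ⟨?_, ?_⟩, ⟨?_, ?_⟩, ?_, ?_⟩, ?_⟩, ?_⟩
      any_goals (dsimp only; omega)
      · dsimp only; linarith
      · dsimp only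
        rw [if_neg (by omega)]
        ext <;> dsimp only <;> ring
  · rintro ⟨e, c, n, d⟩ ⟨⟨he, ⟨hc0, hc⟩, ⟨hn0, hn⟩, ⟨hd0, hd⟩, hdn, h⟩, hdc⟩
    dsimp only at *
    by_cases hw : 0 < 2 * n - d - 2 * e
    · rw [if_pos hw]
      refine ⟨⟨⟨⟨?_, ?_⟩, ⟨?_, ?_⟩, ⟨?_, ?_⟩, ⟨?_, ?_⟩, ?_⟩, ?_⟩, ?_⟩
      any_goals (dsimp only; omega)
      · dsimp only; linarith
      · dsimp only
        rw [if_pos (by omega)]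
        ext <;> dsimp only <;> omega
    · rw [if_neg hw]
      refine ⟨⟨⟨⟨?_, ?_⟩, ⟨?_, ?_⟩, ⟨?_, ?_⟩, ⟨?_, ?_⟩, ?_⟩, ?_⟩, ?_⟩
      any_goals (dsimp only; omega)
      · dsimp only; linarith
      · dsimp only
        rw [if_neg (by omega)]
        ext <;> dsimp only <;> omega

theorem ncard_middleSols_lt_eq_lt {m : ℤ} :
    {v ∈ middleSols m | 2 * v.2.2.1 < 2 * v.2.1 + 4 * v.1 + v.2.2.2}.ncard =
      {v ∈ middleSols m | v.2.2.2 < 2 * v.2.1}.ncard := by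
  have key : {v ∈ middleSols m | ¬ v.2.2.2 < 2 * v.2.1}.ncard =
      {v ∈ middleSols m | ¬ 2 * v.2.2.1 < 2 * v.2.1 + 4 * v.1 + v.2.2.2}.ncard := by
    refine ncard_eq_of_inverse
      (fun v => (v.1, v.2.1, v.2.2.1 + 2 * v.1, v.2.2.2 - 2 * v.2.1))
      (fun v => (v.1, v.2.1, v.2.2.1 - 2 * v.1, v.2.2.2 + 2 * v.2.1)) ?_ ?_
    all_goals
      rintro ⟨e, c, n, d⟩ ⟨⟨he, ⟨hc0, hc⟩, ⟨hn0, hn⟩, ⟨hd0, hd⟩, hdn, h⟩, hdc⟩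
      dsimp only at *
      refine ⟨⟨⟨?_, ⟨?_, ?_⟩, ⟨?_, ?_⟩, ⟨?_, ?_⟩, ?_, ?_⟩, ?_⟩, ?_⟩
      any_goals (dsimp only; omega)
      · dsimp only; linarith
      · ext <;> dsimp only <;> ring
  have h1 := ncard_eq_add_ncard (middleSols_finite m) fun v => v.2.2.2 < 2 * v.2.1
  have h2 := ncard_eq_add_ncard (middleSols_finite m)
    fun v => 2 * v.2.2.1 < 2 * v.2.1 + 4 * v.1 + v.2.2.2
  omega

theorem ncard_middleSols {m : ℤ} :
    (middleSols m).ncard = {v ∈ coneSols m | 0 < v.2.2.2}.ncard := by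
  refine ncard_eq_of_inverse
    (fun v => (v.1, v.1 + (2 * (v.2.1 / (2 * v.1)) + 1) * v.2.2.1 + v.2.2.2,
      v.2.1 % (2 * v.1) - v.1, v.2.2.1))
    (fun v => (v.1, 2 * v.1 * ((v.2.1 - v.1 - v.2.2.2) / (2 * v.2.2.2)) + (v.1 + v.2.2.1),
      v.2.2.2, (v.2.1 - v.1 - v.2.2.2) % (2 * v.2.2.2))) ?_ ?_
  · rintro ⟨e, c, n, d⟩ ⟨he, ⟨hc0, hc⟩, ⟨hn0, hn⟩, ⟨hd0, hd⟩, hdn, h⟩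
    dsimp only at *
    obtain ⟨j, r, hj, hr, hcj, hr0, hre⟩ : ∃ j r, c / (2 * e) = j ∧ c % (2 * e) = r ∧
        c = 2 * e * j + r ∧ 0 ≤ r ∧ r < 2 * e :=
      ⟨_, _, rfl, rfl, (Int.mul_ediv_add_emod c (2 * e)).symm, Int.emod_nonneg _ (by omega),
        Int.emod_lt_of_pos _ (by omega)⟩
    have hj0 : 0 ≤ j := hj ▸ Int.ediv_nonneg hc0.le (by omega)
    have hr2 : r % 2 = 1 := by
      rw [hcj, mul_assoc] at hc
      omega
    rw [hj, hr]
    have hjn : 0 ≤ j * n := by positivity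
    have e1 : e + (2 * j + 1) * n + d = e + 2 * (j * n) + n + d := by ring
    have e2 : e + (2 * j + 1) * n + d - e - n = d + 2 * n * j := by ring
    rw [e2, Int.add_mul_ediv_left _ _ (by omega), Int.add_mul_emod_self_left,
      Int.ediv_eq_zero_of_lt hd0.le hdn, Int.emod_eq_of_lt hd0.le hdn]
    refine ⟨⟨⟨?_, ?_, ?_, ?_, ?_, ?_⟩, ?_⟩, ?_⟩ <;> try dsimp only
    · rw [← h, hcj]; ring
    · rw [abs_lt]; omega
    · rw [abs_lt]; omega
    any_goals omega
    · ext <;> try dsimp only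
      rw [hcj]; ring
  · rintro ⟨e, b, p, n⟩ ⟨⟨h, hp, hn, hn2, hb2, hp2⟩, hn0⟩
    dsimp only at *
    rw [abs_lt] at hp hn
    obtain ⟨j, d, hj, hd, hbj, hd0, hdn⟩ : ∃ j d, (b - e - n) / (2 * n) = j ∧
        (b - e - n) % (2 * n) = d ∧ b - e - n = 2 * n * j + d ∧ 0 ≤ d ∧ d < 2 * n :=
      ⟨_, _, rfl, rfl, (Int.mul_ediv_add_emod _ _).symm, Int.emod_nonneg _ (by omega),
        Int.emod_lt_of_pos _ (by omega)⟩
    have hj0 : 0 ≤ j := hj ▸ Int.ediv_nonneg (by omega) (by omega)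
    have hd2 : d % 2 = 1 := by
      rw [mul_assoc] at hbj
      omega
    rw [hj, hd]
    have hjn : 0 ≤ e * j := mul_nonneg (by omega) hj0
    rw [add_comm (2 * e * j) (e + p), Int.add_mul_ediv_left _ _ (by omega),
      Int.add_mul_emod_self_left, Int.ediv_eq_zero_of_lt (by omega) (by omega),
      Int.emod_eq_of_lt (by omega) (by omega)]
    refine ⟨⟨?_, ⟨?_, ?_⟩, ⟨?_, ?_⟩, ⟨?_, ?_⟩, ?_, ?_⟩, ?_⟩ <;> try dsimp only
    any_goals (rw [mul_assoc]; omega)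
    any_goals omega
    · obtain rfl : b = 2 * n * j + d + e + n := by omega
      rw [← h]; ring
    · ext <;> try dsimp only
      · obtain rfl : b = 2 * n * j + d + e + n := by omega
        ring
      · ring

theorem ncard_middleSols_ge {m : ℤ} :
    {v ∈ middleSols m | ¬ v.2.2.2 < 2 * v.2.1}.ncard =
      {v ∈ coneSols m | v.2.2.1 < 0}.ncard := by
  refine ncard_eq_of_inverse
    (fun v => (v.2.1 + v.1, v.2.2.1 + v.1, -v.1, v.2.2.1 + v.2.1 - v.2.2.2))
    (fun v => (-v.2.2.1, v.1 + v.2.2.1, v.2.1 + v.2.2.1, v.1 + v.2.1 + 2 * v.2.2.1 - v.2.2.2))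
    ?_ ?_
  · rintro ⟨e, c, n, d⟩ ⟨⟨he, ⟨hc0, hc⟩, ⟨hn0, hn⟩, ⟨hd0, hd⟩, hdn, h⟩, hdc⟩
    dsimp only at *
    refine ⟨⟨⟨?_, ?_, ?_, ?_, ?_, ?_⟩, ?_⟩, ?_⟩ <;> try dsimp only
    · rw [← h]; ring
    any_goals (rw [abs_lt])
    any_goals omega
    · ext <;> dsimp only <;> ring
  · rintro ⟨e, b, p, n⟩ ⟨⟨h, hp, hn, hn2, hb2, hp2⟩, hp0⟩
    dsimp only at *
    rw [abs_lt] at hp hn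
    refine ⟨⟨⟨?_, ⟨?_, ?_⟩, ⟨?_, ?_⟩, ⟨?_, ?_⟩, ?_, ?_⟩, ?_⟩, ?_⟩ <;> try dsimp only
    any_goals omega
    · rw [← h]; ring
    · ext <;> dsimp only <;> ring

theorem ncard_middleSols_lt {m : ℤ} :
    {v ∈ middleSols m | v.2.2.2 < 2 * v.2.1}.ncard =
      {v ∈ coneSols m | v.2.2.1 = 0 ∧ 0 < v.2.2.2}.ncard := by
  have h1 := ncard_eq_add_ncard (middleSols_finite m) fun v => v.2.2.2 < 2 * v.2.1
  rw [ncard_middleSols, ncard_middleSols_ge] at h1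
  have hfin := coneSols_finite m
  have h2 := ncard_eq_add_ncard (s := {v ∈ coneSols m | 0 < v.2.2.2})
    (hfin.subset fun v hv => hv.1) fun v => v.2.2.1 < 0
  have h3 := ncard_eq_add_ncard (s := {v ∈ coneSols m | v.2.2.1 < 0})
    (hfin.subset fun v hv => hv.1) fun v => 0 < v.2.2.2
  have h4 := ncard_eq_add_ncard (s := {v ∈ {v ∈ coneSols m | 0 < v.2.2.2} | ¬ v.2.2.1 < 0})
    (hfin.subset fun v hv => hv.1.1) fun v => v.2.2.1 = 0
  have h5 : {v ∈ {v ∈ coneSols m | 0 < v.2.2.2} | v.2.2.1 < 0} =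
      {v ∈ {v ∈ coneSols m | v.2.2.1 < 0} | 0 < v.2.2.2} := by
    ext v; simp only [Set.mem_ofPred_eq]; tauto
  have h6 : {v ∈ {v ∈ {v ∈ coneSols m | 0 < v.2.2.2} | ¬ v.2.2.1 < 0} | v.2.2.1 = 0} =
      {v ∈ coneSols m | v.2.2.1 = 0 ∧ 0 < v.2.2.2} := by
    ext v; simp only [Set.mem_ofPred_eq]
    constructor
    · tauto
    · rintro ⟨ha, hb, hc⟩
      exact ⟨⟨⟨ha, hc⟩, by omega⟩, hb⟩
  have h7 : {v ∈ {v ∈ {v ∈ coneSols m | 0 < v.2.2.2} | ¬ v.2.2.1 < 0} | ¬ v.2.2.1 = 0}.ncard =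
      {v ∈ {v ∈ coneSols m | v.2.2.1 < 0} | ¬ 0 < v.2.2.2}.ncard := by
    refine ncard_eq_of_inverse (fun v => (v.1, v.2.1, -v.2.2.1, -v.2.2.2))
      (fun v => (v.1, v.2.1, -v.2.2.1, -v.2.2.2)) ?_ ?_
    all_goals
      rintro ⟨e, b, p, n⟩ hv
      simp only [Set.mem_ofPred_eq, coneSols, abs_neg, neg_mul_neg, neg_neg, and_true] at hv ⊢
      omega
  rw [h5] at h2
  rw [h6, h7] at h4
  omega

/-- Factorizations `m = ab` into positive factors. -/
noncomputable def divisorPairs (m : ℤ) : Finset (ℤ × ℤ) :=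
  {v ∈ Finset.Icc 1 m ×ˢ Finset.Icc 1 m | v.1 * v.2 = m}

theorem mem_divisorPairs {m : ℤ} {v : ℤ × ℤ} :
    v ∈ divisorPairs m ↔ 0 < v.1 ∧ 0 < v.2 ∧ v.1 * v.2 = m := by
  simp only [divisorPairs, Finset.mem_filter, Finset.mem_product, Finset.mem_Icc]
  constructor
  · rintro ⟨⟨⟨_, _⟩, _, _⟩, h⟩
    exact ⟨by omega, by omega, h⟩
  · rintro ⟨h1, h2, h⟩
    refine ⟨⟨⟨by omega, by nlinarith⟩, by omega, by nlinarith⟩, h⟩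

theorem odd_of_mem_divisorPairs {m : ℤ} (hm : m % 2 = 1) {v : ℤ × ℤ} (hv : v ∈ divisorPairs m) :
    v.1 % 2 = 1 ∧ v.2 % 2 = 1 := by
  obtain ⟨_, _, h⟩ := mem_divisorPairs.1 hv
  rw [← h, ← Int.odd_iff, Int.odd_mul, Int.odd_iff, Int.odd_iff] at hm
  exact hm

/-- The sum of the positive divisors of `m`. -/
noncomputable def divisorSum (m : ℤ) : ℤ := ∑ v ∈ divisorPairs m, v.1

theorem ncard_eq_sum_fiber {α β : Type*} [DecidableEq β] {s : Set α} (hs : s.Finite) (f : α → β)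
    (t : Finset β) (h : ∀ a ∈ s, f a ∈ t) :
    s.ncard = ∑ b ∈ t, {a ∈ s | f a = b}.ncard := by
  classical
  rw [Set.ncard_eq_toFinset_card s hs,
    Finset.card_eq_sum_card_fiberwise (f := f) (t := t) (fun a ha => h a (by simpa using ha))]
  refine Finset.sum_congr rfl fun b _ => ?_
  rw [← Set.ncard_coe_finset]
  congr 1
  ext a
  simp

theorem ncard_Ico_int (k : ℤ) : (Set.Ico 0 k).ncard = k.toNat := by
  rw [← Finset.coe_Ico, Set.ncard_coe_finset, Int.card_Ico, sub_zero]

theorem ncard_coneSols_zero {m : ℤ} (hm : m % 2 = 1) :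
    {v ∈ coneSols m | v.2.2.1 = 0 ∧ 0 < v.2.2.2}.ncard =
      ∑ v ∈ divisorPairs m, ((v.2 - v.1) / 2).toNat := by
  rw [ncard_eq_sum_fiber ((coneSols_finite m).subset fun v hv => hv.1) (fun v => (v.1, v.2.1))
    (divisorPairs m)]
  · refine Finset.sum_congr rfl fun ⟨e, b⟩ hv => ?_
    have hodd := odd_of_mem_divisorPairs hm hv
    obtain ⟨he, hb, h⟩ := mem_divisorPairs.1 hv
    dsimp only at *
    rw [← ncard_Ico_int]
    refine ncard_eq_of_inverse (fun v => v.2.2.2 / 2) (fun i => (e, b, 0, 2 * i + 1)) ?_ ?_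
    · rintro ⟨e', b', p, n⟩ ⟨⟨⟨h1, h2, h3, h4, h5, h6⟩, h7, h8⟩, h9⟩
      simp only [Prod.mk.injEq] at *
      obtain ⟨rfl, rfl⟩ := h9
      rw [abs_of_pos h8] at h3
      refine ⟨⟨?_, ?_⟩, rfl, rfl, h7.symm, ?_⟩ <;> omega
    · rintro i ⟨h0, hi⟩
      refine ⟨⟨⟨⟨?_, ?_, ?_, ?_, ?_, ?_⟩, rfl, ?_⟩, rfl⟩, ?_⟩ <;> dsimp only
      · linarith
      · rw [abs_zero]; exact he
      · rw [abs_lt]; omega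
      all_goals omega
  · rintro ⟨e, b, p, n⟩ ⟨⟨h1, h2, h3, h4, h5, h6⟩, h7, h8⟩
    dsimp only at *
    subst h7
    rw [abs_zero] at h2
    rw [abs_of_pos h8] at h3
    exact mem_divisorPairs.2 ⟨h2, by dsimp only; omega, by simpa using h1⟩

theorem ncard_classSols_eq {m : ℤ} (hm : m % 2 = 1) :
    {v ∈ classSols m | v.1 = v.2.2.1}.ncard =
      ∑ v ∈ divisorPairs m, (min v.1 v.2).toNat := by
  rw [ncard_eq_sum_fiber ((classSols_finite m).subset fun v hv => hv.1)
    (fun v => ((v.2.1 + v.2.2.1) / 2, (v.2.2.1 + v.2.2.2) / 2)) (divisorPairs m)]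
  · refine Finset.sum_congr rfl fun ⟨e, b⟩ hv => ?_
    have hodd := odd_of_mem_divisorPairs hm hv
    obtain ⟨he, hb, h⟩ := mem_divisorPairs.1 hv
    dsimp only at *
    rw [← ncard_Ico_int]
    refine ncard_eq_of_inverse (fun v => v.1 / 2)
      (fun i => (2 * i + 1, 2 * e - 2 * i - 1, 2 * i + 1, 2 * b - 2 * i - 1)) ?_ ?_
    · rintro ⟨w, x, y, z⟩ ⟨⟨⟨⟨hw0, hw⟩, ⟨hx0, hx⟩, ⟨hy0, hy⟩, ⟨hz0, hz⟩, h1⟩, h7⟩, h9⟩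
      simp only [Prod.mk.injEq] at *
      refine ⟨⟨?_, ?_⟩, ?_, ?_, ?_, ?_⟩ <;> omega
    · rintro i ⟨h0, hi⟩
      refine ⟨⟨⟨⟨⟨?_, ?_⟩, ⟨?_, ?_⟩, ⟨?_, ?_⟩, ⟨?_, ?_⟩, ?_⟩, rfl⟩, ?_⟩, ?_⟩ <;> dsimp only
      any_goals omega
      · linarith
      · ext <;> dsimp only <;> omega
  · rintro ⟨w, x, y, z⟩ ⟨hv, hwy⟩
    obtain rfl : w = y := hwy
    have hpar := classSols_parity hm hv
    obtain ⟨⟨hw0, hw⟩, ⟨hx0, hx⟩, -, ⟨hz0, hz⟩, h⟩ := hv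
    dsimp only at *
    obtain ⟨e, he⟩ : ∃ e, x + w = 2 * e := ⟨(x + w) / 2, by omega⟩
    obtain ⟨b, hb⟩ : ∃ b, w + z = 2 * b := ⟨(w + z) / 2, by omega⟩
    refine mem_divisorPairs.2 ⟨?_, ?_, ?_⟩ <;> dsimp only
    · omega
    · omega
    · rw [he, hb, Int.mul_ediv_cancel_left _ two_ne_zero, Int.mul_ediv_cancel_left _ two_ne_zero]
      have : (x + w) * (w + z) = 4 * m := by linarith
      rw [he, hb] at this
      linarith

theorem divisorSum_eq_snd (m : ℤ) : divisorSum m = ∑ v ∈ divisorPairs m, v.2 := by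
  refine Finset.sum_nbij' Prod.swap Prod.swap ?_ ?_ ?_ ?_ ?_
  all_goals
    rintro ⟨a, b⟩ h
    simp only [mem_divisorPairs, Prod.swap_prod_mk, mul_comm] at *
    try tauto

theorem ncard_classSols {m : ℤ} (hm : m % 2 = 1) : ((classSols m).ncard : ℤ) = divisorSum m := by
  have h1 := ncard_eq_add_ncard (classSols_finite m) fun v => v.2.2.1 < v.1
  have h2 := ncard_eq_add_ncard (s := {v ∈ classSols m | ¬ v.2.2.1 < v.1})
    ((classSols_finite m).subset fun v hv => hv.1) fun v => v.1 < v.2.2.1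
  have h3 : {v ∈ {v ∈ classSols m | ¬ v.2.2.1 < v.1} | v.1 < v.2.2.1} =
      {v ∈ classSols m | v.1 < v.2.2.1} := by
    ext v; simp only [Set.mem_ofPred_eq]
    exact ⟨fun h => ⟨h.1.1, h.2⟩, fun h => ⟨⟨h.1, by omega⟩, h.2⟩⟩
  have h4 : {v ∈ {v ∈ classSols m | ¬ v.2.2.1 < v.1} | ¬ v.1 < v.2.2.1} =
      {v ∈ classSols m | v.1 = v.2.2.1} := by
    ext v; simp only [Set.mem_ofPred_eq]
    exact ⟨fun h => ⟨h.1.1, by omega⟩, fun h => ⟨⟨h.1, by omega⟩, by omega⟩⟩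
  rw [h3, h4, ncard_classSols_lt hm, ncard_middleSols_lt_eq_lt, ncard_middleSols_lt,
    ncard_coneSols_zero hm, ncard_classSols_eq hm] at h2
  rw [h2, ncard_classSols_gt hm, ncard_middleSols_lt, ncard_coneSols_zero hm,
    ← Finset.sum_add_distrib, ← Finset.sum_add_distrib] at h1
  rw [h1, divisorSum_eq_snd, Nat.cast_sum]
  refine Finset.sum_congr rfl fun ⟨e, b⟩ hv => ?_
  have hodd := odd_of_mem_divisorPairs hm hv
  obtain ⟨he, hb, h⟩ := mem_divisorPairs.1 hv
  dsimp only at *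
  omega

/-- Quadruples of odd positive integers whose squares sum to `k`. -/
def fourSquareSols (k : ℤ) : Set (ℤ × ℤ × ℤ × ℤ) :=
  {v | OddPos v.1 ∧ OddPos v.2.1 ∧ OddPos v.2.2.1 ∧ OddPos v.2.2.2 ∧
    v.1 ^ 2 + v.2.1 ^ 2 + v.2.2.1 ^ 2 + v.2.2.2 ^ 2 = k}

/-- Quintuples of odd positive integers whose squares sum to `k`. -/
def fiveSquareSols (k : ℤ) : Set (ℤ × ℤ × ℤ × ℤ × ℤ) :=
  {v | OddPos v.1 ∧ OddPos v.2.1 ∧ OddPos v.2.2.1 ∧ OddPos v.2.2.2.1 ∧ OddPos v.2.2.2.2 ∧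
    v.1 ^ 2 + v.2.1 ^ 2 + v.2.2.1 ^ 2 + v.2.2.2.1 ^ 2 + v.2.2.2.2 ^ 2 = k}

theorem fiveSquareSols_finite (k : ℤ) : (fiveSquareSols k).Finite := by
  refine (Set.finite_Icc ((0, 0, 0, 0, 0) : ℤ × ℤ × ℤ × ℤ × ℤ) (k, k, k, k, k)).subset ?_
  rintro ⟨a, b, c, d, e⟩ ⟨⟨ha, _⟩, ⟨hb, _⟩, ⟨hc, _⟩, ⟨hd, _⟩, ⟨he, _⟩, h⟩
  dsimp only at *
  refine ⟨⟨ha.le, hb.le, hc.le, hd.le, he.le⟩, ⟨?_, ?_, ?_, ?_, ?_⟩⟩ <;> dsimp only <;> nlinarith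

instance : DecidablePred OddPos := fun x => inferInstanceAs (Decidable (0 < x ∧ x % 2 = 1))

/-- Odd positive integers up to `k`. -/
noncomputable def oddsUpTo (k : ℤ) : Finset ℤ := {x ∈ Finset.Icc 1 k | OddPos x}

theorem mem_oddsUpTo {k x : ℤ} : x ∈ oddsUpTo k ↔ OddPos x ∧ x ≤ k := by
  rw [oddsUpTo, Finset.mem_filter, Finset.mem_Icc]
  exact ⟨fun h => ⟨h.2, h.1.2⟩, fun h => ⟨⟨h.1.1, h.2⟩, h.1⟩⟩

theorem sum_fiveSquareSols (k : ℤ) :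
    ∑ x ∈ oddsUpTo k, (k - 5 * x ^ 2) * ((fourSquareSols (k - x ^ 2)).ncard : ℤ) = 0 := by
  set F := (fiveSquareSols_finite k).toFinset with hF
  have hmem : ∀ v, v ∈ F ↔ v ∈ fiveSquareSols k := fun v => by simp [hF]
  have h1 : ∑ v ∈ F, v.2.1 ^ 2 = ∑ v ∈ F, v.1 ^ 2 := by
    refine Finset.sum_nbij' (fun v => (v.2.1, v.1, v.2.2)) (fun v => (v.2.1, v.1, v.2.2))
      ?_ ?_ (fun _ _ => rfl) (fun _ _ => rfl) (fun _ _ => rfl) <;>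
    · rintro ⟨a, b, c, d, e⟩ h
      rw [hmem] at *
      obtain ⟨h1, h2, h3, h4, h5, h⟩ := h
      exact ⟨h2, h1, h3, h4, h5, by dsimp only at *; linarith⟩
  have h2 : ∑ v ∈ F, v.2.2.1 ^ 2 = ∑ v ∈ F, v.1 ^ 2 := by
    refine Finset.sum_nbij' (fun v => (v.2.2.1, v.2.1, v.1, v.2.2.2))
      (fun v => (v.2.2.1, v.2.1, v.1, v.2.2.2))
      ?_ ?_ (fun _ _ => rfl) (fun _ _ => rfl) (fun _ _ => rfl) <;>
    · rintro ⟨a, b, c, d, e⟩ h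
      rw [hmem] at *
      obtain ⟨h1, h2, h3, h4, h5, h⟩ := h
      exact ⟨h3, h2, h1, h4, h5, by dsimp only at *; linarith⟩
  have h3 : ∑ v ∈ F, v.2.2.2.1 ^ 2 = ∑ v ∈ F, v.1 ^ 2 := by
    refine Finset.sum_nbij' (fun v => (v.2.2.2.1, v.2.1, v.2.2.1, v.1, v.2.2.2.2))
      (fun v => (v.2.2.2.1, v.2.1, v.2.2.1, v.1, v.2.2.2.2))
      ?_ ?_ (fun _ _ => rfl) (fun _ _ => rfl) (fun _ _ => rfl) <;>
    · rintro ⟨a, b, c, d, e⟩ h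
      rw [hmem] at *
      obtain ⟨h1, h2, h3, h4, h5, h⟩ := h
      exact ⟨h4, h2, h3, h1, h5, by dsimp only at *; linarith⟩
  have h4 : ∑ v ∈ F, v.2.2.2.2 ^ 2 = ∑ v ∈ F, v.1 ^ 2 := by
    refine Finset.sum_nbij' (fun v => (v.2.2.2.2, v.2.1, v.2.2.1, v.2.2.2.1, v.1))
      (fun v => (v.2.2.2.2, v.2.1, v.2.2.1, v.2.2.2.1, v.1))
      ?_ ?_ (fun _ _ => rfl) (fun _ _ => rfl) (fun _ _ => rfl) <;>
    · rintro ⟨a, b, c, d, e⟩ h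
      rw [hmem] at *
      obtain ⟨h1, h2, h3, h4, h5, h⟩ := h
      exact ⟨h5, h2, h3, h4, h1, by dsimp only at *; linarith⟩
  have hsum : ∑ v ∈ F, (k - 5 * v.1 ^ 2) = 0 := by
    have : ∑ v ∈ F, (k - 5 * v.1 ^ 2) = ∑ v ∈ F, ((v.1 ^ 2 + v.2.1 ^ 2 + v.2.2.1 ^ 2 +
        v.2.2.2.1 ^ 2 + v.2.2.2.2 ^ 2) - 5 * v.1 ^ 2) :=
      Finset.sum_congr rfl fun v hv => by rw [((hmem v).1 hv).2.2.2.2.2]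
    rw [this]
    simp only [Finset.sum_sub_distrib, Finset.sum_add_distrib, h1, h2, h3, h4, ← Finset.mul_sum]
    ring
  rw [← hsum, ← Finset.sum_fiberwise_of_maps_to (s := F) (t := oddsUpTo k) (g := fun v => v.1)]
  · refine Finset.sum_congr rfl fun x hx => ?_
    have hx' := (mem_oddsUpTo.1 hx).1
    rw [Finset.sum_congr (g := fun _ => k - 5 * x ^ 2) rfl
      (fun v hv => by rw [(Finset.mem_filter.1 hv).2]), Finset.sum_const, nsmul_eq_mul, mul_comm,
      ← Set.ncard_coe_finset]
    congr 2
    refine ncard_eq_of_inverse (fun v => (x, v)) (fun v => v.2) ?_ ?_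
    · rintro ⟨a, b, c, d⟩ ⟨h1, h2, h3, h4, h⟩
      simp only [Finset.coe_filter, hmem, Set.mem_ofPred_eq]
      exact ⟨⟨⟨hx', h1, h2, h3, h4, by dsimp only at *; linarith⟩, trivial⟩, trivial⟩
    · rintro ⟨a, b, c, d, e⟩ h
      simp only [Finset.coe_filter, hmem, Set.mem_ofPred_eq] at h
      obtain ⟨⟨h1, h2, h3, h4, h5, h⟩, rfl⟩ := h
      exact ⟨⟨h2, h3, h4, h5, by dsimp only at *; linarith⟩, rfl⟩
  · rintro ⟨a, b, c, d, e⟩ h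
    obtain ⟨h1, h2, h3, h4, h5, h⟩ := (hmem _).1 h
    refine mem_oddsUpTo.2 ⟨h1, ?_⟩
    dsimp only at *
    nlinarith [h1.1, sq_nonneg b, sq_nonneg c, sq_nonneg d, sq_nonneg e]

/-- Triples `(x, a, b)` of odd integers with `a, b > 0` and `x² + 4ab = n`. -/
def quadSols (n : ℤ) : Set (ℤ × ℤ × ℤ) :=
  {v | v.1 % 2 = 1 ∧ OddPos v.2.1 ∧ OddPos v.2.2 ∧ v.1 ^ 2 + 4 * v.2.1 * v.2.2 = n}

theorem quadSols_finite (n : ℤ) : (quadSols n).Finite := by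
  refine (Set.finite_Icc ((-n, 0, 0) : ℤ × ℤ × ℤ) (n, n, n)).subset ?_
  rintro ⟨x, a, b⟩ ⟨hx, ⟨ha, _⟩, ⟨hb, _⟩, h⟩
  dsimp only at *
  have := mul_pos ha hb
  refine ⟨⟨?_, ha.le, hb.le⟩, ⟨?_, ?_, ?_⟩⟩ <;> dsimp only <;> nlinarith [sq_nonneg x]

theorem sum_quadSols (n : ℤ) :
    ∑ v ∈ (quadSols_finite n).toFinset, v.2.1 * (v.2.1 * v.2.2 - v.1 ^ 2) = 0 := by
  set Q := (quadSols_finite n).toFinset with hQ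
  have hmem : ∀ v, v ∈ Q ↔ v ∈ quadSols n := fun v => by simp [hQ]
  let f : ℤ × ℤ × ℤ → ℤ := fun v => (v.2.1 + v.2.2) * (v.2.1 + v.1) * (v.2.2 - v.1)
  have hlow : ∑ v ∈ Q with v.2.1 + v.1 < v.2.2, f v = 0 := by
    have : ∑ v ∈ Q with v.2.1 + v.1 < v.2.2, f v =
        ∑ v ∈ Q with v.2.1 + v.1 < v.2.2, -f v := by
      refine Finset.sum_nbij' (fun v => (-v.1 - 2 * v.2.1, v.2.1, v.2.2 - v.1 - v.2.1))
        (fun v => (-v.1 - 2 * v.2.1, v.2.1, v.2.2 - v.1 - v.2.1)) ?_ ?_ ?_ ?_ ?_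
      iterate 2
        rintro ⟨x, a, b⟩ h
        simp only [Finset.mem_filter, hmem] at h ⊢
        obtain ⟨⟨hx, ⟨ha0, ha⟩, ⟨hb0, hb⟩, h⟩, hlt⟩ := h
        dsimp only at *
        refine ⟨⟨?_, ⟨?_, ?_⟩, ⟨?_, ?_⟩, ?_⟩, ?_⟩ <;> try dsimp only
        any_goals omega
        linarith
      iterate 2
        rintro ⟨x, a, b⟩ h
        ext <;> (try dsimp only) <;> ring
      rintro ⟨x, a, b⟩ h
      simp only [f]
      ring
    rw [Finset.sum_neg_distrib] at this
    linarith
  have hhigh : ∑ v ∈ Q with ¬ v.2.1 + v.1 < v.2.2, f v =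
      ∑ v ∈ Q with v.2.1 + v.1 < v.2.2, f v := by
    refine Finset.sum_nbij' (fun v => (-v.1, v.2.2, v.2.1)) (fun v => (-v.1, v.2.2, v.2.1))
      ?_ ?_ ?_ ?_ ?_
    iterate 2
      rintro ⟨x, a, b⟩ h
      simp only [Finset.mem_filter, hmem] at h ⊢
      obtain ⟨⟨hx, ⟨ha0, ha⟩, ⟨hb0, hb⟩, h⟩, hlt⟩ := h
      dsimp only at *
      refine ⟨⟨?_, ⟨?_, ?_⟩, ⟨?_, ?_⟩, ?_⟩, ?_⟩ <;> try dsimp only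
      any_goals omega
      linarith
    iterate 2
      rintro ⟨x, a, b⟩ h
      ext <;> (try dsimp only) <;> ring
    rintro ⟨x, a, b⟩ h
    simp only [f]
    ring
  have hf : ∑ v ∈ Q, f v = 0 := by
    rw [← Finset.sum_filter_add_sum_filter_not Q (fun v => v.2.1 + v.1 < v.2.2), hhigh, hlow,
      add_zero]
  have hneg : ∑ v ∈ Q, f v = ∑ v ∈ Q, f (-v.1, v.2) := by
    refine Finset.sum_nbij' (fun v => (-v.1, v.2)) (fun v => (-v.1, v.2)) ?_ ?_ ?_ ?_ ?_
    iterate 2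
      rintro ⟨x, a, b⟩ h
      rw [hmem] at *
      obtain ⟨hx, ha, hb, h⟩ := h
      exact ⟨by dsimp only at *; omega, ha, hb, by dsimp only at *; linarith⟩
    all_goals
      rintro ⟨x, a, b⟩ h
      simp
  have hswap : ∑ v ∈ Q, v.2.2 * (v.2.1 * v.2.2 - v.1 ^ 2) =
      ∑ v ∈ Q, v.2.1 * (v.2.1 * v.2.2 - v.1 ^ 2) := by
    refine Finset.sum_nbij' (fun v => (v.1, v.2.2, v.2.1)) (fun v => (v.1, v.2.2, v.2.1))
      ?_ ?_ (fun _ _ => rfl) (fun _ _ => rfl) ?_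
    iterate 2
      rintro ⟨x, a, b⟩ h
      rw [hmem] at *
      obtain ⟨hx, ha, hb, h⟩ := h
      exact ⟨hx, hb, ha, by dsimp only at *; linarith⟩
    rintro ⟨x, a, b⟩ h
    dsimp only
    ring
  have h2 : ∑ v ∈ Q, (f v + f (-v.1, v.2)) = ∑ v ∈ Q, (2 * (v.2.1 * (v.2.1 * v.2.2 - v.1 ^ 2)) +
      2 * (v.2.2 * (v.2.1 * v.2.2 - v.1 ^ 2))) :=
    Finset.sum_congr rfl fun v _ => by simp only [f]; ring
  rw [Finset.sum_add_distrib, Finset.sum_add_distrib, ← hneg, hf, ← Finset.mul_sum,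
    ← Finset.mul_sum, hswap] at h2
  linarith

theorem sum_divisorSum {n : ℤ} (hn : n % 8 = 5) :
    ∑ x ∈ oddsUpTo n, (n - 5 * x ^ 2) * divisorSum ((n - x ^ 2) / 4) = 0 := by
  set Q := (quadSols_finite n).toFinset with hQ
  have hmem : ∀ v, v ∈ Q ↔ v ∈ quadSols n := fun v => by simp [hQ]
  have hneg : ∑ v ∈ Q with ¬ 0 < v.1, v.2.1 * (v.2.1 * v.2.2 - v.1 ^ 2) =
      ∑ v ∈ Q with 0 < v.1, v.2.1 * (v.2.1 * v.2.2 - v.1 ^ 2) := by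
    refine Finset.sum_nbij' (fun v => (-v.1, v.2)) (fun v => (-v.1, v.2)) ?_ ?_ ?_ ?_ ?_
    iterate 2
      rintro ⟨x, a, b⟩ h
      simp only [Finset.mem_filter, hmem] at h ⊢
      obtain ⟨⟨hx, ha, hb, h⟩, hpos⟩ := h
      dsimp only at *
      exact ⟨⟨by dsimp only at *; omega, ha, hb, by dsimp only at *; linarith⟩, by omega⟩
    all_goals
      rintro ⟨x, a, b⟩ h
      simp
  have hpos : ∑ v ∈ Q with 0 < v.1, v.2.1 * (v.2.1 * v.2.2 - v.1 ^ 2) = 0 := by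
    have := sum_quadSols n
    rw [← hQ, ← Finset.sum_filter_add_sum_filter_not Q (fun v => 0 < v.1), hneg] at this
    linarith
  have hdiv : ∀ x, x % 2 = 1 → n - x ^ 2 = 4 * ((n - x ^ 2) / 4) ∧ (n - x ^ 2) / 4 % 2 = 1 := by
    intro x hx
    have := Int.eight_dvd_sq_sub_one_of_odd (Int.odd_iff.2 hx)
    omega
  have hsig : ∑ x ∈ oddsUpTo n, (n - 5 * x ^ 2) * divisorSum ((n - x ^ 2) / 4) =
      ∑ p ∈ (oddsUpTo n).sigma fun x => divisorPairs ((n - x ^ 2) / 4),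
        4 * (p.2.1 * (p.2.1 * p.2.2 - p.1 ^ 2)) := by
    rw [Finset.sum_sigma]
    refine Finset.sum_congr rfl fun x hx => ?_
    have h4 := (hdiv x (mem_oddsUpTo.1 hx).1.2).1
    rw [divisorSum, Finset.mul_sum]
    refine Finset.sum_congr rfl fun ⟨a, b⟩ hab => ?_
    obtain ⟨-, -, h⟩ := mem_divisorPairs.1 hab
    dsimp only at *
    rw [← h] at h4
    linear_combination a * h4
  rw [hsig, ← Finset.mul_sum, ← mul_zero (4 : ℤ), ← hpos]
  congr 1
  refine Finset.sum_nbij' (fun p => (p.1, p.2)) (fun v => ⟨v.1, v.2⟩) ?_ ?_ (fun _ _ => rfl)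
    (fun _ _ => rfl) (fun _ _ => rfl)
  · rintro ⟨x, a, b⟩ h
    obtain ⟨hx, hab⟩ := Finset.mem_sigma.1 h
    have h1 := (mem_oddsUpTo.1 hx).1
    obtain ⟨h4, h2⟩ := hdiv x h1.2
    have hodd := odd_of_mem_divisorPairs h2 hab
    obtain ⟨ha, hb, h⟩ := mem_divisorPairs.1 hab
    simp only [Finset.mem_filter, hmem]
    exact ⟨⟨h1.2, ⟨ha, hodd.1⟩, ⟨hb, hodd.2⟩, by dsimp only at *; linarith⟩, h1.1⟩
  · rintro ⟨x, a, b⟩ h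
    simp only [Finset.mem_filter, hmem] at h
    obtain ⟨⟨hx, ⟨ha, _⟩, ⟨hb, _⟩, h⟩, hpos⟩ := h
    have h4 := (hdiv x hx).1
    dsimp only at *
    have := mul_pos ha hb
    refine Finset.mem_sigma.2 ⟨mem_oddsUpTo.2 ⟨⟨hpos, hx⟩, ?_⟩, mem_divisorPairs.2 ⟨ha, hb, ?_⟩⟩
    · dsimp only; nlinarith
    · dsimp only; linarith

theorem eq_zero_of_sum_oddsUpTo {k : ℤ} (hk : 0 < k) {f : ℤ → ℤ}
    (hsum : ∑ x ∈ oddsUpTo k, f x = 0) (h : ∀ x, x % 2 = 1 → 3 ≤ x → f x = 0) : f 1 = 0 := by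
  rwa [Finset.sum_eq_single_of_mem 1 (mem_oddsUpTo.2 ⟨⟨one_pos, rfl⟩, by omega⟩)] at hsum
  intro x hx hx1
  obtain ⟨⟨h1, h2⟩, -⟩ := mem_oddsUpTo.1 hx
  exact h x h2 (by omega)

theorem fourSquareSols_eq_empty {k : ℤ} (hk : k ≤ 0) : fourSquareSols k = ∅ := by
  refine Set.eq_empty_of_forall_notMem ?_
  rintro ⟨a, b, c, d⟩ ⟨⟨ha, _⟩, -, -, -, h⟩
  dsimp only at *
  nlinarith [sq_nonneg b, sq_nonneg c, sq_nonneg d]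

theorem divisorSum_of_nonpos {k : ℤ} (hk : k ≤ 0) : divisorSum k = 0 := by
  refine Finset.sum_eq_zero fun v hv => ?_
  obtain ⟨h1, h2, h⟩ := mem_divisorPairs.1 hv
  have := mul_pos h1 h2
  omega

theorem ncard_fourSquareSols {m : ℤ} (hm : m % 2 = 1) (hm0 : 0 < m) :
    ((fourSquareSols (4 * m)).ncard : ℤ) = divisorSum m := by
  obtain ⟨k, rfl⟩ := Int.eq_ofNat_of_zero_le hm0.le
  induction k using Nat.strong_induction_on with
  | _ k ih =>
  rcases eq_or_ne k 1 with rfl | hk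
  · have h1 : fourSquareSols (4 * ((1 : ℕ) : ℤ)) = {(1, 1, 1, 1)} := by
      refine Set.eq_singleton_iff_unique_mem.2 ⟨by simp [fourSquareSols, OddPos], ?_⟩
      rintro ⟨a, b, c, d⟩ ⟨⟨ha, _⟩, ⟨hb, _⟩, ⟨hc, _⟩, ⟨hd, _⟩, h⟩
      dsimp only at *
      push_cast at h
      ext <;> dsimp only <;> nlinarith
    have h2 : divisorPairs ((1 : ℕ) : ℤ) = {(1, 1)} := by
      refine Finset.eq_singleton_iff_unique_mem.2 ⟨by simp [mem_divisorPairs], ?_⟩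
      rintro ⟨a, b⟩ h
      obtain ⟨ha, hb, h⟩ := mem_divisorPairs.1 h
      dsimp only at *
      push_cast at h
      ext <;> dsimp only <;> nlinarith
    rw [h1, divisorSum, h2]
    simp
  · have h1 := sum_fiveSquareSols (4 * (k : ℤ) + 1)
    have h2 := sum_divisorSum (n := 4 * (k : ℤ) + 1) (by omega)
    have h3 := sub_eq_zero.2 (h1.trans h2.symm)
    rw [← Finset.sum_sub_distrib] at h3
    have h4 := eq_zero_of_sum_oddsUpTo (by omega) h3 ?_
    · have e1 : 4 * (k : ℤ) + 1 - 1 ^ 2 = 4 * k := by ring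
      have e2 : 4 * (k : ℤ) / 4 = k := by omega
      rw [e1, e2, ← mul_sub, mul_eq_zero] at h4
      rcases h4 with h4 | h4 <;> omega
    · intro x hx hx3
      have h8 := Int.eight_dvd_sq_sub_one_of_odd (Int.odd_iff.2 hx)
      have h9 : 3 ^ 2 ≤ x ^ 2 := pow_le_pow_left₀ (by norm_num) hx3 2
      rcases le_or_gt (4 * (k : ℤ) + 1 - x ^ 2) 0 with hle | hgt
      · rw [fourSquareSols_eq_empty hle, divisorSum_of_nonpos (by omega)]
        simp
      · obtain ⟨j, hj⟩ : ∃ j : ℕ, 4 * (k : ℤ) + 1 - x ^ 2 = 4 * j :=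
          ⟨((4 * (k : ℤ) + 1 - x ^ 2) / 4).toNat, by omega⟩
        have e2 : 4 * (j : ℤ) / 4 = j := by omega
        rw [hj, e2, ih j (by omega) (by omega) (by omega), sub_self]

/-- Triples of odd positive integers with `xy + yz + zx = n`. -/
def pairSumSols (n : ℤ) : Set (ℤ × ℤ × ℤ) :=
  {v | OddPos v.1 ∧ OddPos v.2.1 ∧ OddPos v.2.2 ∧ v.1 * v.2.1 + v.2.1 * v.2.2 + v.2.2 * v.1 = n}

/-- Triples of odd positive integers whose squares sum to `n`. -/
def threeSquareSols (n : ℤ) : Set (ℤ × ℤ × ℤ) :=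
  {v | OddPos v.1 ∧ OddPos v.2.1 ∧ OddPos v.2.2 ∧ v.1 ^ 2 + v.2.1 ^ 2 + v.2.2 ^ 2 = n}

theorem pairSumSols_finite (n : ℤ) : (pairSumSols n).Finite := by
  refine (Set.finite_Icc ((0, 0, 0) : ℤ × ℤ × ℤ) (n, n, n)).subset ?_
  rintro ⟨x, y, z⟩ ⟨⟨hx, _⟩, ⟨hy, _⟩, ⟨hz, _⟩, h⟩
  dsimp only at *
  have h1 := mul_pos hx hy
  have h2 := mul_pos hy hz
  have h3 := mul_pos hz hx
  refine ⟨⟨hx.le, hy.le, hz.le⟩, ⟨?_, ?_, ?_⟩⟩ <;> dsimp only <;> nlinarith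

theorem fourSquareSols_finite (k : ℤ) : (fourSquareSols k).Finite := by
  refine (Set.finite_Icc ((0, 0, 0, 0) : ℤ × ℤ × ℤ × ℤ) (k, k, k, k)).subset ?_
  rintro ⟨a, b, c, d⟩ ⟨⟨ha, _⟩, ⟨hb, _⟩, ⟨hc, _⟩, ⟨hd, _⟩, h⟩
  dsimp only at *
  refine ⟨⟨ha.le, hb.le, hc.le, hd.le⟩, ⟨?_, ?_, ?_, ?_⟩⟩ <;> dsimp only <;> nlinarith

theorem pairSumSols_eq_empty {n : ℤ} (hn : n ≤ 0) : pairSumSols n = ∅ := by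
  refine Set.eq_empty_of_forall_notMem ?_
  rintro ⟨x, y, z⟩ ⟨⟨hx, _⟩, ⟨hy, _⟩, ⟨hz, _⟩, h⟩
  dsimp only at *
  linarith [mul_pos hx hy, mul_pos hy hz, mul_pos hz hx]

theorem threeSquareSols_eq_empty {n : ℤ} (hn : n ≤ 0) : threeSquareSols n = ∅ := by
  refine Set.eq_empty_of_forall_notMem ?_
  rintro ⟨x, y, z⟩ ⟨⟨hx, _⟩, -, -, h⟩
  dsimp only at *
  nlinarith [sq_nonneg y, sq_nonneg z]

theorem ncard_classSols_eq_sum (m : ℤ) :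
    (classSols m).ncard = ∑ w ∈ oddsUpTo (4 * m), (pairSumSols (4 * m - w ^ 2)).ncard := by
  rw [ncard_eq_sum_fiber (classSols_finite m) (fun v => v.1) (oddsUpTo (4 * m))]
  · refine Finset.sum_congr rfl fun w hw => ?_
    have hw' := (mem_oddsUpTo.1 hw).1
    refine ncard_eq_of_inverse (fun v => v.2) (fun v => (w, v)) ?_ ?_
    · rintro ⟨w, x, y, z⟩ ⟨⟨h1, h2, h3, h4, h⟩, rfl⟩
      exact ⟨⟨h2, h3, h4, by dsimp only at *; linarith⟩, rfl⟩
    · rintro ⟨x, y, z⟩ ⟨h2, h3, h4, h⟩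
      exact ⟨⟨⟨hw', h2, h3, h4, by dsimp only at *; linarith⟩, rfl⟩, rfl⟩
  · rintro ⟨w, x, y, z⟩ ⟨h1, h2, h3, h4, h⟩
    refine mem_oddsUpTo.2 ⟨h1, ?_⟩
    dsimp only at *
    nlinarith [h1.1, mul_pos h2.1 h3.1, mul_pos h3.1 h4.1, mul_pos h4.1 h2.1]

theorem ncard_fourSquareSols_eq_sum (k : ℤ) :
    (fourSquareSols k).ncard = ∑ w ∈ oddsUpTo k, (threeSquareSols (k - w ^ 2)).ncard := by
  rw [ncard_eq_sum_fiber (fourSquareSols_finite k) (fun v => v.1) (oddsUpTo k)]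
  · refine Finset.sum_congr rfl fun w hw => ?_
    have hw' := (mem_oddsUpTo.1 hw).1
    refine ncard_eq_of_inverse (fun v => v.2) (fun v => (w, v)) ?_ ?_
    · rintro ⟨w, x, y, z⟩ ⟨⟨h1, h2, h3, h4, h⟩, rfl⟩
      exact ⟨⟨h2, h3, h4, by dsimp only at *; linarith⟩, rfl⟩
    · rintro ⟨x, y, z⟩ ⟨h2, h3, h4, h⟩
      exact ⟨⟨⟨hw', h2, h3, h4, by dsimp only at *; linarith⟩, rfl⟩, rfl⟩
  · rintro ⟨w, x, y, z⟩ ⟨h1, h2, h3, h4, h⟩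
    refine mem_oddsUpTo.2 ⟨h1, ?_⟩
    dsimp only at *
    nlinarith [h1.1, sq_nonneg x, sq_nonneg y, sq_nonneg z]

theorem ncard_pairSumSols {n : ℕ} (hn : n % 8 = 3) :
    (pairSumSols n).ncard = (threeSquareSols n).ncard := by
  induction n using Nat.strong_induction_on with
  | _ n ih =>
  obtain ⟨m, hm⟩ : ∃ m : ℤ, (n : ℤ) = 4 * m - 1 := ⟨(n + 1) / 4, by omega⟩
  have h1 := (ncard_classSols (m := m) (by omega)).trans
    (ncard_fourSquareSols (m := m) (by omega) (by omega)).symm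
  rw [ncard_classSols_eq_sum, ncard_fourSquareSols_eq_sum, Nat.cast_sum, Nat.cast_sum,
    ← sub_eq_zero, ← Finset.sum_sub_distrib] at h1
  have h2 := eq_zero_of_sum_oddsUpTo (by omega) h1 ?_
  · rw [one_pow, ← hm] at h2
    omega
  · intro x hx hx3
    have h8 := Int.eight_dvd_sq_sub_one_of_odd (Int.odd_iff.2 hx)
    have h9 : 3 ^ 2 ≤ x ^ 2 := pow_le_pow_left₀ (by norm_num) hx3 2
    rcases le_or_gt (4 * m - x ^ 2) 0 with hle | hgt
    · simp [pairSumSols_eq_empty hle, threeSquareSols_eq_empty hle]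
    · obtain ⟨j, hj⟩ := Int.eq_ofNat_of_zero_le hgt.le
      rw [hj, ih j (by omega) (by omega), sub_self]

theorem ncard_sum_three_squares {n : ℤ} (hn : n % 8 = 3) :
    {v : ℤ × ℤ × ℤ | v.1 ^ 2 + v.2.1 ^ 2 + v.2.2 ^ 2 = n}.ncard =
      8 * (threeSquareSols n).ncard := by
  set U : Set ℤ := {1, -1} with hU
  have hcard : U.ncard = 2 := Set.ncard_pair (by norm_num)
  have hsq : ∀ x : ℤ, x ^ 2 % 4 = x % 2 := fun x => by
    rcases Int.emod_two_eq_zero_or_one x with h | h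
    · obtain ⟨k, rfl⟩ := Int.dvd_of_emod_eq_zero h
      rw [mul_pow]
      omega
    · have := Int.eight_dvd_sq_sub_one_of_odd (Int.odd_iff.2 h)
      omega
  have habs : ∀ x : ℤ, x % 2 = 1 → OddPos |x| ∧ SignType.sign x * |x| = x ∧
      (SignType.sign x : ℤ) ∈ U := by
    intro x hx
    rcases lt_trichotomy x 0 with h | h | h
    · simp [OddPos, abs_of_neg h, h, hU]
      omega
    · omega
    · simp [OddPos, abs_of_pos h, h, hU, hx]
  have hsign : ∀ x u : ℤ, OddPos x → u ∈ U →
      (u * x) ^ 2 = x ^ 2 ∧ |u * x| = x ∧ (SignType.sign (u * x) : ℤ) = u := by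
    rintro x u ⟨hx, -⟩ (rfl | rfl)
    · simp [hx, abs_of_pos]
    · simp [hx, abs_of_pos]
  have hmul : (threeSquareSols n ×ˢ U ×ˢ U ×ˢ U).ncard = 8 * (threeSquareSols n).ncard := by
    simp only [Set.ncard_prod, hcard]
    ring
  rw [← hmul]
  refine ncard_eq_of_inverse
    (fun v => ((|v.1|, |v.2.1|, |v.2.2|),
      ((SignType.sign v.1 : ℤ), (SignType.sign v.2.1 : ℤ), (SignType.sign v.2.2 : ℤ))))
    (fun p => (p.2.1 * p.1.1, p.2.2.1 * p.1.2.1, p.2.2.2 * p.1.2.2)) ?_ ?_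
  · rintro ⟨x, y, z⟩ h
    simp only [Set.mem_ofPred_eq] at h
    have hx := hsq x
    have hy := hsq y
    have hz := hsq z
    obtain ⟨x1, x2, x3⟩ := habs x (by omega)
    obtain ⟨y1, y2, y3⟩ := habs y (by omega)
    obtain ⟨z1, z2, z3⟩ := habs z (by omega)
    refine ⟨⟨⟨x1, y1, z1, by simpa only [sq_abs] using h⟩, x3, y3, z3⟩, ?_⟩
    simp only [x2, y2, z2]
  · rintro ⟨⟨x, y, z⟩, u, v, w⟩ ⟨⟨hx, hy, hz, h⟩, hu, hv, hw⟩
    dsimp only at *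
    obtain ⟨x1, x2, x3⟩ := hsign x u hx hu
    obtain ⟨y1, y2, y3⟩ := hsign y v hy hv
    obtain ⟨z1, z2, z3⟩ := hsign z w hz hw
    refine ⟨?_, ?_⟩
    · simp only [Set.mem_ofPred_eq, x1, y1, z1, h]
    · simp only [x2, y2, z2, x3, y3, z3]

/-- A fundamental domain for cyclic permutations of triples. -/
def CyclicNormal (v : ℤ × ℤ × ℤ) : Prop :=
  v.2.2 ≤ v.1 ∧ v.1 ≤ v.2.1 ∨ v.2.2 < v.2.1 ∧ v.2.1 < v.1

theorem ncard_pairSumSols_eq (n : ℤ) :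
    (pairSumSols n).ncard =
      3 * {v ∈ pairSumSols n | CyclicNormal v ∧ ¬ (v.1 = v.2.1 ∧ v.2.1 = v.2.2)}.ncard +
        {v ∈ pairSumSols n | CyclicNormal v ∧ v.1 = v.2.1 ∧ v.2.1 = v.2.2}.ncard := by
  have hfin : ∀ P : ℤ × ℤ × ℤ → Prop, {v ∈ pairSumSols n | P v}.Finite := fun P =>
    (pairSumSols_finite n).subset fun v hv => hv.1
  have h1 := ncard_eq_add_ncard (pairSumSols_finite n) fun v => v.1 = v.2.1 ∧ v.2.1 = v.2.2
  have h2 := ncard_eq_add_ncard (hfin fun v => ¬ (v.1 = v.2.1 ∧ v.2.1 = v.2.2)) CyclicNormal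
  have h3 := ncard_eq_add_ncard ((hfin fun v => ¬ (v.1 = v.2.1 ∧ v.2.1 = v.2.2)).subset
    fun v (hv : v ∈ {v ∈ _ | ¬ CyclicNormal v}) => hv.1) fun v => CyclicNormal (v.2.1, v.2.2, v.1)
  have e0 : {v ∈ pairSumSols n | v.1 = v.2.1 ∧ v.2.1 = v.2.2} =
      {v ∈ pairSumSols n | CyclicNormal v ∧ v.1 = v.2.1 ∧ v.2.1 = v.2.2} := by
    ext ⟨x, y, z⟩
    simp only [Set.mem_ofPred_eq, CyclicNormal]
    refine and_congr_right fun _ => ?_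
    omega
  have e1 : {v ∈ {v ∈ pairSumSols n | ¬ (v.1 = v.2.1 ∧ v.2.1 = v.2.2)} | CyclicNormal v} =
      {v ∈ pairSumSols n | CyclicNormal v ∧ ¬ (v.1 = v.2.1 ∧ v.2.1 = v.2.2)} := by
    ext v
    simp only [Set.mem_ofPred_eq]
    tauto
  have e2 : {v ∈ {v ∈ {v ∈ pairSumSols n | ¬ (v.1 = v.2.1 ∧ v.2.1 = v.2.2)} |
      ¬ CyclicNormal v} | CyclicNormal (v.2.1, v.2.2, v.1)}.ncard =
      {v ∈ pairSumSols n | CyclicNormal v ∧ ¬ (v.1 = v.2.1 ∧ v.2.1 = v.2.2)}.ncard := by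
    refine ncard_eq_of_inverse (fun v => (v.2.1, v.2.2, v.1)) (fun v => (v.2.2, v.1, v.2.1)) ?_ ?_
    · rintro ⟨x, y, z⟩ ⟨⟨⟨⟨hx, hy, hz, h⟩, hne⟩, hc⟩, hc'⟩
      refine ⟨⟨⟨hy, hz, hx, by dsimp only at *; linarith⟩, hc', ?_⟩, rfl⟩
      dsimp only at *
      omega
    · rintro ⟨x, y, z⟩ ⟨⟨hx, hy, hz, h⟩, hc, hne⟩
      refine ⟨⟨⟨⟨⟨hz, hx, hy, by dsimp only at *; linarith⟩, ?_⟩, ?_⟩, hc⟩, rfl⟩ <;>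
      · simp only [CyclicNormal] at *
        omega
  have e3 : {v ∈ {v ∈ {v ∈ pairSumSols n | ¬ (v.1 = v.2.1 ∧ v.2.1 = v.2.2)} |
      ¬ CyclicNormal v} | ¬ CyclicNormal (v.2.1, v.2.2, v.1)}.ncard =
      {v ∈ pairSumSols n | CyclicNormal v ∧ ¬ (v.1 = v.2.1 ∧ v.2.1 = v.2.2)}.ncard := by
    refine ncard_eq_of_inverse (fun v => (v.2.2, v.1, v.2.1)) (fun v => (v.2.1, v.2.2, v.1)) ?_ ?_
    · rintro ⟨x, y, z⟩ ⟨⟨⟨⟨hx, hy, hz, h⟩, hne⟩, hc⟩, hc'⟩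
      refine ⟨⟨⟨hz, hx, hy, by dsimp only at *; linarith⟩, ?_, ?_⟩, rfl⟩ <;>
      · simp only [CyclicNormal] at *
        omega
    · rintro ⟨x, y, z⟩ ⟨⟨hx, hy, hz, h⟩, hc, hne⟩
      refine ⟨⟨⟨⟨⟨hy, hz, hx, by dsimp only at *; linarith⟩, ?_⟩, ?_⟩, ?_⟩, rfl⟩ <;>
      · simp only [CyclicNormal] at *
        omega
  rw [e0] at h1
  rw [e1] at h2
  omega

theorem reducedForms_finite (N : ℕ) : (reducedForms N).Finite := by
  refine (Set.finite_Icc ((0, -N, 0) : ℤ × ℤ × ℤ) (N, N, N)).subset ?_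
  rintro ⟨a, b, c⟩ ⟨ha, h, hb, hc, -⟩
  dsimp only at *
  obtain ⟨hb1, hb2⟩ := abs_le.1 hb
  have h1 : b ^ 2 ≤ a ^ 2 := sq_le_sq' hb1 hb2
  have hcN : c ≤ N := by nlinarith
  exact ⟨⟨ha.le, by dsimp only; omega, by dsimp only; omega⟩,
    ⟨by dsimp only; omega, by dsimp only; omega, hcN⟩⟩

theorem odd_of_mem_reducedForms {N : ℕ} (hN : N % 2 = 1) {t : ℤ × ℤ × ℤ}
    (ht : t ∈ reducedForms N) : t.2.1 % 2 = 1 := by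
  have h := ht.2.1
  by_contra hb
  obtain ⟨k, hk⟩ : 2 ∣ t.2.1 := by omega
  rw [hk, mul_pow, mul_assoc] at h
  omega

theorem ncard_cyclicNormal {n : ℕ} (hn : n % 2 = 1) (P : Prop → Prop) :
    {v ∈ pairSumSols n | CyclicNormal v ∧ P (v.1 = v.2.1 ∧ v.2.1 = v.2.2)}.ncard =
      {t ∈ reducedForms n | P (t.1 = t.2.1 ∧ t.2.1 = t.2.2)}.ncard := by
  refine ncard_eq_of_inverse
    (fun v => if v.1 ≤ v.2.1 then ((v.1 + v.2.2) / 2, v.2.2, (v.2.1 + v.2.2) / 2)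
      else ((v.2.1 + v.2.2) / 2, -v.2.2, (v.1 + v.2.2) / 2))
    (fun t => if 0 < t.2.1 then (2 * t.1 - t.2.1, 2 * t.2.2 - t.2.1, t.2.1)
      else (2 * t.2.2 + t.2.1, 2 * t.1 + t.2.1, -t.2.1)) ?_ ?_
  · rintro ⟨x, y, z⟩ ⟨⟨⟨hx, hx'⟩, ⟨hy, hy'⟩, ⟨hz, hz'⟩, h⟩, hcyc, hP⟩
    simp only [CyclicNormal] at *
    obtain ⟨a, ha⟩ : ∃ a, x = 2 * a - z := ⟨(x + z) / 2, by omega⟩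
    obtain ⟨c, hc⟩ : ∃ c, y = 2 * c - z := ⟨(y + z) / 2, by omega⟩
    subst ha hc
    have e1 : (2 * a - z + z) / 2 = a := by omega
    have e2 : (2 * c - z + z) / 2 = c := by omega
    rw [e1, e2]
    by_cases hxy : 2 * a - z ≤ 2 * c - z
    · simp only [if_pos hxy]
      refine ⟨⟨⟨by dsimp only; omega, by dsimp only; linarith, ?_⟩, ?_⟩, ?_⟩
      · dsimp only
        rw [abs_of_pos hz]
        omega
      · exact Eq.mpr (congrArg P (propext (by dsimp only; omega))) hP
      · simp only [if_pos hz]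
    · simp only [if_neg hxy]
      refine ⟨⟨⟨by dsimp only; omega, by dsimp only; linarith, ?_⟩, ?_⟩, ?_⟩
      · dsimp only
        rw [abs_neg, abs_of_pos hz]
        omega
      · exact Eq.mpr (congrArg P (propext (by dsimp only; omega))) hP
      · rw [if_neg (by omega)]
        ext <;> dsimp only <;> omega
  · rintro ⟨a, b, c⟩ ⟨ht, hP⟩
    have hodd := odd_of_mem_reducedForms hn ht
    obtain ⟨ha, h, hba, hac, hb0⟩ := ht
    dsimp only at *
    by_cases hb : 0 < b
    · rw [abs_of_pos hb] at *
      simp only [if_pos hb]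
      refine ⟨⟨⟨⟨by dsimp only; omega, by dsimp only; omega⟩,
        ⟨by dsimp only; omega, by dsimp only; omega⟩,
        ⟨hb, hodd⟩, by dsimp only; linarith⟩, ?_, ?_⟩, ?_⟩
      · simp only [CyclicNormal]
        omega
      · exact Eq.mpr (congrArg P (propext (by dsimp only; omega))) hP
      · rw [if_pos (by omega)]
        ext <;> dsimp only <;> omega
    · rw [abs_of_neg (by omega)] at *
      simp only [if_neg hb]
      refine ⟨⟨⟨⟨by dsimp only; omega, by dsimp only; omega⟩,
        ⟨by dsimp only; omega, by dsimp only; omega⟩,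
        ⟨by dsimp only; omega, by dsimp only; omega⟩, by dsimp only; linarith⟩, ?_, ?_⟩, ?_⟩
      · simp only [CyclicNormal]
        omega
      · exact Eq.mpr (congrArg P (propext (by dsimp only; omega))) hP
      · rw [if_neg (by omega)]
        ext <;> dsimp only <;> omega

theorem three_mul_hurwitzClassNumber {n : ℕ} (hn : n % 2 = 1) :
    3 * hurwitzClassNumber n = (pairSumSols n).ncard := by
  classical
  have hw : ∀ t ∈ reducedForms n,
      hurwitzWeight t = if t.1 = t.2.1 ∧ t.2.1 = t.2.2 then 1 / 3 else 1 := fun t ht => by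
    have := odd_of_mem_reducedForms hn ht
    rw [hurwitzWeight, if_neg (by omega)]
  have heq := ncard_cyclicNormal hn id
  simp only [id] at heq
  rw [hurwitzClassNumber, finsum_mem_congr rfl hw,
    finsum_mem_eq_finite_toFinset_sum _ (reducedForms_finite n), Finset.sum_ite, Finset.sum_const,
    Finset.sum_const, ncard_pairSumSols_eq, ncard_cyclicNormal hn Not, heq,
    ← Set.ncard_coe_finset, ← Set.ncard_coe_finset]
  simp only [Finset.coe_filter, Set.Finite.mem_toFinset, nsmul_eq_mul]
  push_cast
  ring

/-- Gauss: `r₃(n) = 24 H(n)` for `n ≡ 3 (mod 8)`. -/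
theorem r3_eq_twentyfour_hurwitz (n : ℕ) (hn : 0 < n) (h : n % 8 = 3) :
    (r3 n : ℚ) = 24 * hurwitzClassNumber n := by
  have h8 : ((n : ℕ) : ℤ) % 8 = 3 := by omega
  rw [r3, ncard_sum_three_squares h8, ← ncard_pairSumSols h, Nat.cast_mul,
    ← three_mul_hurwitzClassNumber (by omega)]
  push_cast
  ring
end

section
/- For every positive integer n with n ≡ 3 (mod 4): if n ≡ 3 (mod 8) then H(4n) = 4·H(n), and if n ≡ 7 (mod 8) then H(4n) = 2·H(n). -/
open Finset in
/-- The triples of nonnegative integers of equal parity with `xy + yz + zx = N`, i.e. the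
Selling parameters of the positive definite binary quadratic forms of discriminant `-N`. -/
noncomputable def sellingTriples (N : ℕ) : Finset (ℤ × ℤ × ℤ) :=
  (Icc 0 (N : ℤ) ×ˢ Icc 0 (N : ℤ) ×ˢ Icc 0 (N : ℤ)).filter fun t =>
    t.1 % 2 = t.2.1 % 2 ∧ t.2.1 % 2 = t.2.2 % 2 ∧
      t.1 * t.2.1 + t.2.1 * t.2.2 + t.2.2 * t.1 = N

/-- The weight of a Selling triple: boundary triples count one half. -/
def sellingWeight (t : ℤ × ℤ × ℤ) : ℚ :=
  if t.1 = 0 ∨ t.2.1 = 0 ∨ t.2.2 = 0 then 1/2 else 1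

lemma le_of_mul_add_eq {x y z N : ℤ} (hN : 0 < N) (hx : 0 ≤ x) (hy : 0 ≤ y) (hz : 0 ≤ z)
    (h : x * y + y * z + z * x = N) : x ≤ N := by
  have hyz : 1 ≤ y + z := by
    by_contra hlt
    have h1 : y = 0 := by lia
    have h2 : z = 0 := by lia
    subst h1 h2
    simp at h
    lia
  nlinarith [mul_nonneg hx (sub_nonneg.2 hyz), mul_nonneg hy hz]

lemma mem_sellingTriples {N : ℕ} (hN : 0 < N) {x y z : ℤ} :
    (x, y, z) ∈ sellingTriples N ↔ 0 ≤ x ∧ 0 ≤ y ∧ 0 ≤ z ∧ x % 2 = y % 2 ∧ y % 2 = z % 2 ∧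
      x * y + y * z + z * x = N := by
  have hN' : (0 : ℤ) < N := by exact_mod_cast hN
  simp only [sellingTriples, Finset.mem_filter, Finset.mem_product, Finset.mem_Icc]
  constructor
  · rintro ⟨⟨⟨h1, -⟩, ⟨h2, -⟩, h3, -⟩, h4, h5, h6⟩
    exact ⟨h1, h2, h3, h4, h5, h6⟩
  · rintro ⟨h1, h2, h3, h4, h5, h6⟩
    exact ⟨⟨⟨h1, le_of_mul_add_eq hN' h1 h2 h3 h6⟩,
      ⟨h2, le_of_mul_add_eq hN' h2 h3 h1 (by linarith)⟩,
      h3, le_of_mul_add_eq hN' h3 h1 h2 (by linarith)⟩, h4, h5, h6⟩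

lemma sum_sellingTriples_rotate {N : ℕ} (hN : 0 < N) (f : ℤ × ℤ × ℤ → ℚ) :
    ∑ t ∈ sellingTriples N, f (t.2.1, t.2.2, t.1) = ∑ t ∈ sellingTriples N, f t := by
  refine Finset.sum_nbij' (fun t => (t.2.1, t.2.2, t.1)) (fun t => (t.2.2, t.1, t.2.1))
    ?_ ?_ (fun _ _ => rfl) (fun _ _ => rfl) (fun _ _ => rfl)
  all_goals
    rintro ⟨x, y, z⟩ h
    rw [mem_sellingTriples hN] at h ⊢
    refine ⟨?_, ?_, ?_, ?_, ?_, ?_⟩ <;> lia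

lemma sum_sellingTriples_swap {N : ℕ} (hN : 0 < N) (f : ℤ × ℤ × ℤ → ℚ) :
    ∑ t ∈ sellingTriples N, f (t.2.1, t.1, t.2.2) = ∑ t ∈ sellingTriples N, f t := by
  refine Finset.sum_nbij' (fun t => (t.2.1, t.1, t.2.2)) (fun t => (t.2.1, t.1, t.2.2))
    ?_ ?_ (fun _ _ => rfl) (fun _ _ => rfl) (fun _ _ => rfl)
  all_goals
    rintro ⟨x, y, z⟩ h
    rw [mem_sellingTriples hN] at h ⊢
    refine ⟨?_, ?_, ?_, ?_, ?_, ?_⟩ <;> lia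

/-- The ordered Selling triples representing reduced forms. -/
def IsReducedTriple (t : ℤ × ℤ × ℤ) : Prop :=
  (0 < t.2.2 ∧ t.2.2 < t.1 ∧ t.1 < t.2.1) ∨ (t.2.2 ≤ t.2.1 ∧ t.2.1 ≤ t.1)

instance : DecidablePred IsReducedTriple := fun _ => inferInstanceAs (Decidable (_ ∨ _))

/-- The Hurwitz weight in terms of Selling parameters. -/
def reducedTripleWeight (t : ℤ × ℤ × ℤ) : ℚ :=
  if t.2.2 = 0 ∧ t.1 = t.2.1 then 1/2
  else if t.1 = t.2.1 ∧ t.2.1 = t.2.2 then 1/3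
  else 1

/-- The Selling triple of a reduced form. -/
def toSellingTriple (t : ℤ × ℤ × ℤ) : ℤ × ℤ × ℤ :=
  if t.2.1 < 0 then (2 * t.1 + t.2.1, 2 * t.2.2 + t.2.1, -t.2.1)
  else (2 * t.2.2 - t.2.1, 2 * t.1 - t.2.1, t.2.1)

lemma bijOn_toSellingTriple {N : ℕ} (hN : 0 < N) :
    Set.BijOn toSellingTriple (reducedForms N) {t ∈ sellingTriples N | IsReducedTriple t} := by
  refine ⟨?_, ?_, ?_⟩
  · rintro ⟨a, b, c⟩ ⟨h1, h2, h3, h4, h5⟩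
    simp only [toSellingTriple, IsReducedTriple, Set.mem_ofPred_eq] at *
    rw [abs_le] at h3
    split_ifs with hb
    · have : |b| = -b := abs_of_neg hb
      rw [mem_sellingTriples hN]
      refine ⟨⟨?_, ?_, ?_, ?_, ?_, ?_⟩, ?_⟩ <;> lia
    · rw [mem_sellingTriples hN]
      refine ⟨⟨?_, ?_, ?_, ?_, ?_, ?_⟩, ?_⟩ <;> lia
  · rintro ⟨a, b, c⟩ ⟨h1, h2, h3, h4, h5⟩ ⟨a', b', c'⟩ ⟨h1', h2', h3', h4', h5'⟩ h
    simp only [toSellingTriple] at *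
    have hc : b < 0 → |b| = -b := abs_of_neg
    have hc' : b' < 0 → |b'| = -b' := abs_of_neg
    rw [abs_le] at h3 h3'
    split_ifs at h <;> simp only [Prod.mk.injEq] at h ⊢ <;> refine ⟨?_, ?_, ?_⟩ <;> lia
  · rintro ⟨x, y, z⟩ ⟨h, h'⟩
    rw [mem_sellingTriples hN] at h
    obtain ⟨hx, hy, hz, hxy, hyz, he⟩ := h
    have hN' : (0 : ℤ) < N := by exact_mod_cast hN
    obtain ⟨k, rfl⟩ : ∃ k, x = z + 2 * k := ⟨(x - z) / 2, by lia⟩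
    obtain ⟨l, rfl⟩ : ∃ l, y = z + 2 * l := ⟨(y - z) / 2, by lia⟩
    simp only [IsReducedTriple] at h'
    by_cases hlt : 0 < z ∧ z < z + 2 * k ∧ z + 2 * k < z + 2 * l
    · refine ⟨(z + k, -z, z + l), ⟨?_, ?_, ?_, ?_, ?_⟩, ?_⟩ <;>
        simp only [toSellingTriple, abs_neg, abs_of_nonneg hz]
      · lia
      · nlinarith
      · lia
      · lia
      · lia
      · rw [if_pos (by lia)]
        ext <;> simp <;> ring
    · have h'' := h'.resolve_left hlt
      have hl : 0 < z + l := by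
        by_contra hl
        have : z = 0 := by lia
        have : l = 0 := by lia
        subst z l
        simp at he
        lia
      refine ⟨(z + l, z, z + k), ⟨?_, ?_, ?_, ?_, ?_⟩, ?_⟩ <;>
        simp only [toSellingTriple, abs_of_nonneg hz]
      · exact hl
      · nlinarith
      · lia
      · lia
      · lia
      · rw [if_neg (by lia)]
        ext <;> simp <;> ring

lemma hurwitzWeight_eq_reducedTripleWeight {N : ℕ} {t : ℤ × ℤ × ℤ} (ht : t ∈ reducedForms N) :
    hurwitzWeight t = reducedTripleWeight (toSellingTriple t) := by
  obtain ⟨a, b, c⟩ := t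
  obtain ⟨h1, h2, h3, h4, h5⟩ := ht
  simp only [toSellingTriple, hurwitzWeight, reducedTripleWeight] at *
  have hb : b < 0 → |b| = -b := abs_of_neg
  rw [abs_le] at h3
  split_ifs <;> first | rfl | lia

lemma hurwitzClassNumber_eq_sum_ite {N : ℕ} (hN : 0 < N) :
    hurwitzClassNumber N =
      ∑ t ∈ sellingTriples N, if IsReducedTriple t then reducedTripleWeight t else 0 := by
  rw [hurwitzClassNumber, finsum_mem_eq_of_bijOn _ (bijOn_toSellingTriple hN)
    (fun t ht => hurwitzWeight_eq_reducedTripleWeight ht), ← Finset.sum_filter,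
    ← finsum_mem_finset_eq_sum]
  simp

lemma sum_perm_reducedTripleWeight {N : ℕ} (hN : 0 < N) {x y z : ℤ}
    (h : (x, y, z) ∈ sellingTriples N) {G : ℤ × ℤ × ℤ → ℚ}
    (hG : G = fun t => if IsReducedTriple t then reducedTripleWeight t else 0) :
    (G (x, y, z) + G (y, z, x) + G (z, x, y)) + (G (y, x, z) + G (x, z, y) + G (z, y, x)) =
      2 * sellingWeight (x, y, z) := by
  rw [mem_sellingTriples hN] at h
  obtain ⟨hx, hy, hz, hxy, hyz, he⟩ := h
  have hN' : (0 : ℤ) < N := by exact_mod_cast hN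
  have h1 : ¬ (x = 0 ∧ y = 0) := by rintro ⟨rfl, rfl⟩; simp at he; lia
  have h2 : ¬ (y = 0 ∧ z = 0) := by rintro ⟨rfl, rfl⟩; simp at he; lia
  have h3 : ¬ (z = 0 ∧ x = 0) := by rintro ⟨rfl, rfl⟩; simp at he; lia
  clear he hN' hxy hyz
  subst hG
  simp only [IsReducedTriple, reducedTripleWeight, sellingWeight]
  rcases lt_trichotomy x y with hxy | hxy | hxy <;>
  rcases lt_trichotomy y z with hyz | hyz | hyz <;>
  rcases lt_trichotomy x z with hxz | hxz | hxz <;>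
  grind

/-- Three times the Hurwitz class number is a weighted count of Selling triples. -/
lemma three_mul_hurwitzClassNumber_s10 {N : ℕ} (hN : 0 < N) :
    3 * hurwitzClassNumber N = ∑ t ∈ sellingTriples N, sellingWeight t := by
  obtain ⟨G, hG⟩ : ∃ G : ℤ × ℤ × ℤ → ℚ,
    G = fun t => if IsReducedTriple t then reducedTripleWeight t else 0 := ⟨_, rfl⟩
  have hH : hurwitzClassNumber N = ∑ t ∈ sellingTriples N, G t := by
    rw [hurwitzClassNumber_eq_sum_ite hN, hG]
  have h1 := sum_sellingTriples_rotate hN G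
  have h2 := sum_sellingTriples_rotate hN (fun t => G (t.2.1, t.2.2, t.1))
  have h3 := sum_sellingTriples_swap hN G
  have h4 := sum_sellingTriples_rotate hN (fun t => G (t.2.1, t.1, t.2.2))
  have h5 := sum_sellingTriples_rotate hN (fun t => G (t.2.2, t.2.1, t.1))
  have key := Finset.sum_congr rfl fun (t : ℤ × ℤ × ℤ) (ht : t ∈ sellingTriples N) =>
    sum_perm_reducedTripleWeight hN (x := t.1) (y := t.2.1) (z := t.2.2) ht hG
  simp only [Finset.sum_add_distrib, ← Finset.mul_sum] at key
  simp only at h1 h2 h3 h4 h5 key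
  linarith

open Finset in
/-- The triples `(u, v, w)` with `v` even, `w` odd, `|v| + |w| < u` and
`u² - v² - w² = n`. -/
noncomputable def coneTriples (n : ℕ) : Finset (ℤ × ℤ × ℤ) :=
  (Icc 0 (n : ℤ) ×ˢ Icc (-n : ℤ) n ×ˢ Icc (-n : ℤ) n).filter fun t =>
    t.2.1 % 2 = 0 ∧ t.2.2 % 2 = 1 ∧ |t.2.1| + |t.2.2| < t.1 ∧
      t.1 ^ 2 = n + t.2.1 ^ 2 + t.2.2 ^ 2

lemma abs_add_abs_lt_iff {u v w : ℤ} :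
    |v| + |w| < u ↔ v + w < u ∧ v - w < u ∧ w - v < u ∧ -v - w < u := by
  rcases abs_cases v with hv | hv <;> rcases abs_cases w with hw | hw <;> lia

lemma mem_coneTriples {n : ℕ} {u v w : ℤ} :
    (u, v, w) ∈ coneTriples n ↔
      v % 2 = 0 ∧ w % 2 = 1 ∧ (v + w < u ∧ v - w < u ∧ w - v < u ∧ -v - w < u) ∧
        u ^ 2 = n + v ^ 2 + w ^ 2 := by
  simp only [coneTriples, Finset.mem_filter, Finset.mem_product, Finset.mem_Icc, ← abs_le,
    ← abs_add_abs_lt_iff]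
  refine ⟨fun h => h.2, fun h => ⟨?_, h⟩⟩
  obtain ⟨-, -, h3, h4⟩ := h
  rw [← sq_abs v, ← sq_abs w] at h4
  have hv := abs_nonneg v
  have hw := abs_nonneg w
  have hu : u ≤ n := by
    nlinarith [mul_nonneg hv hw,
      mul_nonneg (by lia : 0 ≤ u - |v| - |w| - 1) (by lia : 0 ≤ u + |v| + |w|)]
  exact ⟨⟨by lia, hu⟩, by lia, by lia⟩

lemma sum_coneTriples_neg_snd (n : ℕ) (f : ℤ × ℤ × ℤ → ℚ) :
    ∑ t ∈ coneTriples n, f (t.1, -t.2.1, t.2.2) = ∑ t ∈ coneTriples n, f t := by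
  refine Finset.sum_nbij' (fun t => (t.1, -t.2.1, t.2.2)) (fun t => (t.1, -t.2.1, t.2.2))
    ?_ ?_ (by simp) (by simp) (fun _ _ => rfl)
  all_goals
    rintro ⟨u, v, w⟩ h
    rw [mem_coneTriples] at h ⊢
    rw [neg_sq]
    lia

lemma sum_coneTriples_neg_trd (n : ℕ) (f : ℤ × ℤ × ℤ → ℚ) :
    ∑ t ∈ coneTriples n, f (t.1, t.2.1, -t.2.2) = ∑ t ∈ coneTriples n, f t := by
  refine Finset.sum_nbij' (fun t => (t.1, t.2.1, -t.2.2)) (fun t => (t.1, t.2.1, -t.2.2))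
    ?_ ?_ (by simp) (by simp) (fun _ _ => rfl)
  all_goals
    rintro ⟨u, v, w⟩ h
    rw [mem_coneTriples] at h ⊢
    rw [neg_sq]
    lia

lemma odd_of_mem_sellingTriples {n : ℕ} (h : n % 4 = 3) {x y z : ℤ}
    (ht : (x, y, z) ∈ sellingTriples n) : x % 2 = 1 ∧ y % 2 = 1 ∧ z % 2 = 1 := by
  rw [mem_sellingTriples (by lia)] at ht
  obtain ⟨-, -, -, h1, h2, h3⟩ := ht
  rcases Int.emod_two_eq_zero_or_one x with hx | hx
  · obtain ⟨a, rfl⟩ : (2 : ℤ) ∣ x := by lia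
    obtain ⟨b, rfl⟩ : (2 : ℤ) ∣ y := by lia
    obtain ⟨c, rfl⟩ : (2 : ℤ) ∣ z := by lia
    have : 4 * (a * b + b * c + c * a) = n := by linarith
    lia
  · lia

lemma even_of_mem_sellingTriples {n : ℕ} (hn : 0 < n) {x y z : ℤ}
    (ht : (x, y, z) ∈ sellingTriples (4 * n)) : x % 2 = 0 ∧ y % 2 = 0 ∧ z % 2 = 0 := by
  rw [mem_sellingTriples (by lia)] at ht
  obtain ⟨-, -, -, h1, h2, h3⟩ := ht
  rcases Int.emod_two_eq_zero_or_one x with hx | hx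
  · lia
  · obtain ⟨a, rfl⟩ : ∃ a, x = 2 * a + 1 := ⟨x / 2, by lia⟩
    obtain ⟨b, rfl⟩ : ∃ b, y = 2 * b + 1 := ⟨y / 2, by lia⟩
    obtain ⟨c, rfl⟩ : ∃ c, z = 2 * c + 1 := ⟨z / 2, by lia⟩
    push_cast at h3
    ring_nf at h3
    lia

lemma emod_of_mem_sellingTriples {n : ℕ} (h : n % 4 = 3) {x y z : ℤ}
    (ht : (x, y, z) ∈ sellingTriples (4 * n)) (hx : x % 4 = 0) :
    y % 4 = 2 ∧ z % 4 = 2 ∧ (y - z) % 8 = 4 := by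
  obtain ⟨-, hy, hz⟩ := even_of_mem_sellingTriples (by lia) ht
  rw [mem_sellingTriples (by lia)] at ht
  obtain ⟨p, rfl⟩ : ∃ p, x = 4 * p := ⟨x / 4, by lia⟩
  obtain ⟨q, rfl⟩ : ∃ q, y = 2 * q := ⟨y / 2, by lia⟩
  obtain ⟨r, rfl⟩ : ∃ r, z = 2 * r := ⟨z / 2, by lia⟩
  obtain ⟨-, -, -, -, -, he⟩ := ht
  push_cast at he
  have he' : 2 * (p * (q + r)) + q * r = n := by linarith
  rcases Int.emod_two_eq_zero_or_one q with h0 | h1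
  · obtain ⟨a, rfl⟩ : ∃ a, q = 2 * a := ⟨q / 2, by lia⟩
    ring_nf at he'
    lia
  rcases Int.emod_two_eq_zero_or_one r with h0 | h2
  · obtain ⟨a, rfl⟩ : ∃ a, r = 2 * a := ⟨r / 2, by lia⟩
    ring_nf at he'
    lia
  refine ⟨by lia, by lia, ?_⟩
  obtain ⟨b, rfl⟩ : ∃ b, r = 2 * b + 1 := ⟨r / 2, by lia⟩
  by_contra h3
  obtain ⟨a, rfl⟩ : ∃ a, q = 2 * b + 1 + 4 * a := ⟨(q - (2 * b + 1)) / 4, by lia⟩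
  ring_nf at he'
  lia

lemma even_of_mem_coneTriples {n : ℕ} (h : n % 4 = 3) {u v w : ℤ}
    (ht : (u, v, w) ∈ coneTriples n) : u % 2 = 0 := by
  obtain ⟨h1, h2, -, h3⟩ := mem_coneTriples.1 ht
  obtain ⟨a, rfl⟩ : ∃ a, v = 2 * a := ⟨v / 2, by lia⟩
  obtain ⟨b, rfl⟩ : ∃ b, w = 2 * b + 1 := ⟨w / 2, by lia⟩
  rcases Int.emod_two_eq_zero_or_one u with hu | hu
  · exact hu
  · obtain ⟨c, rfl⟩ : ∃ c, u = 2 * c + 1 := ⟨u / 2, by lia⟩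
    ring_nf at h3
    lia

/-- The triples in the cone with positive odd coordinate correspond to odd Selling triples. -/
lemma sum_coneTriples_pos_trd {n : ℕ} (h : n % 4 = 3) :
    (∑ t ∈ coneTriples n, if 0 < t.2.2 then (1 : ℚ) else 0) =
      ∑ t ∈ sellingTriples n, if t.2.1 % 4 = t.2.2 % 4 then 1 else 0 := by
  rw [← Finset.sum_filter, ← Finset.sum_filter]
  refine Finset.sum_nbij' (fun t => (t.2.2, t.1 + t.2.1 - t.2.2, t.1 - t.2.1 - t.2.2))
    (fun t => ((2 * t.1 + t.2.1 + t.2.2) / 2, (t.2.1 - t.2.2) / 2, t.1)) ?_ ?_ ?_ ?_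
    (fun _ _ => rfl)
  · rintro ⟨u, v, w⟩ ht
    obtain ⟨hm, hw⟩ := Finset.mem_filter.1 ht
    have hu := even_of_mem_coneTriples h hm
    obtain ⟨h1, h2, h3, h4⟩ := mem_coneTriples.1 hm
    simp only [Finset.mem_filter, mem_sellingTriples (by lia : 0 < n)] at hw ⊢
    refine ⟨⟨?_, ?_, ?_, ?_, ?_, ?_⟩, ?_⟩ <;> lia
  · rintro ⟨x, y, z⟩ ht
    obtain ⟨hm, hyz⟩ := Finset.mem_filter.1 ht
    obtain ⟨ox, oy, oz⟩ := odd_of_mem_sellingTriples h hm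
    rw [mem_sellingTriples (by lia)] at hm
    simp only [Finset.mem_filter, mem_coneTriples] at hyz ⊢
    obtain ⟨k, rfl⟩ : ∃ k, y = z + 4 * k := ⟨(y - z) / 4, by lia⟩
    have e1 : (2 * x + (z + 4 * k) + z) / 2 = x + z + 2 * k := by lia
    have e2 : (z + 4 * k - z) / 2 = 2 * k := by lia
    rw [e1, e2]
    refine ⟨⟨?_, ?_, ?_, ?_⟩, ?_⟩ <;> lia
  · rintro ⟨u, v, w⟩ -
    simp only [Prod.mk.injEq]
    lia
  · rintro ⟨x, y, z⟩ ht
    simp only [Finset.mem_filter] at ht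
    simp only [Prod.mk.injEq]
    lia

/-- The triples in the cone up to the sign of the even coordinate correspond to the Selling
triples whose first entry is divisible by `4`. -/
lemma sum_coneTriples_weight {n : ℕ} (h : n % 4 = 3) :
    (∑ t ∈ coneTriples n, if 0 ≤ t.2.1 then (if t.2.1 = 0 then 1/2 else 1 : ℚ) else 0) =
      ∑ t ∈ sellingTriples (4 * n), if t.1 % 4 = 0 then sellingWeight t else 0 := by
  rw [← Finset.sum_filter, ← Finset.sum_filter]
  refine Finset.sum_nbij'
    (fun t => (2 * t.2.1, 2 * (t.1 + t.2.2 - t.2.1), 2 * (t.1 - t.2.2 - t.2.1)))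
    (fun t => ((2 * t.1 + t.2.1 + t.2.2) / 4, t.1 / 2, (t.2.1 - t.2.2) / 4)) ?_ ?_ ?_ ?_ ?_
  · rintro ⟨u, v, w⟩ ht
    obtain ⟨hm, hw⟩ := Finset.mem_filter.1 ht
    obtain ⟨h1, h2, h3, h4⟩ := mem_coneTriples.1 hm
    simp only [Finset.mem_filter, mem_sellingTriples (by lia : 0 < 4 * n)] at hw ⊢
    push_cast
    refine ⟨⟨?_, ?_, ?_, ?_, ?_, ?_⟩, ?_⟩ <;> lia
  · rintro ⟨x, y, z⟩ ht
    obtain ⟨hm, hx⟩ := Finset.mem_filter.1 ht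
    obtain ⟨ox, oy, oz⟩ := emod_of_mem_sellingTriples h hm hx
    rw [mem_sellingTriples (by lia)] at hm
    simp only [Finset.mem_filter, mem_coneTriples] at hx ⊢
    obtain ⟨p, rfl⟩ : ∃ p, x = 4 * p := ⟨x / 4, by lia⟩
    obtain ⟨q, rfl⟩ : ∃ q, y = 2 * q := ⟨y / 2, by lia⟩
    obtain ⟨r, rfl⟩ : ∃ r, z = 2 * r := ⟨z / 2, by lia⟩
    obtain ⟨hp, hq, hr, -, -, he⟩ := hm
    push_cast at he
    obtain ⟨k, rfl⟩ : ∃ k, q = r + 2 * k := ⟨(q - r) / 2, by lia⟩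
    have e1 : (2 * (4 * p) + 2 * (r + 2 * k) + 2 * r) / 4 = 2 * p + r + k := by lia
    have e2 : (2 * (r + 2 * k) - 2 * r) / 4 = k := by lia
    have e3 : 4 * p / 2 = 2 * p := by lia
    rw [e1, e2, e3]
    refine ⟨⟨?_, ?_, ?_, ?_⟩, ?_⟩ <;> lia
  · rintro ⟨u, v, w⟩ -
    simp only [Prod.mk.injEq]
    lia
  · rintro ⟨x, y, z⟩ ht
    obtain ⟨hm, hx⟩ := Finset.mem_filter.1 ht
    have := emod_of_mem_sellingTriples h hm hx
    simp only [Prod.mk.injEq]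
    lia
  · rintro ⟨u, v, w⟩ ht
    obtain ⟨hm, hw⟩ := Finset.mem_filter.1 ht
    obtain ⟨h1, h2, h3, h4⟩ := mem_coneTriples.1 hm
    simp only [sellingWeight] at hw ⊢
    split_ifs <;> first | rfl | lia

/-- Doubling matches the Selling triples of discriminant `-n` with those of discriminant `-4n`
having no entry divisible by `4`. -/
lemma sum_sellingTriples_double {n : ℕ} (h : n % 4 = 3) :
    (∑ t ∈ sellingTriples (4 * n),
      if t.1 % 4 = 0 ∨ t.2.1 % 4 = 0 ∨ t.2.2 % 4 = 0 then 0 else sellingWeight t) =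
      ∑ t ∈ sellingTriples n, sellingWeight t := by
  simp only [← ite_not (p := _ ∨ _), ← Finset.sum_filter]
  symm
  refine Finset.sum_nbij' (fun t => (2 * t.1, 2 * t.2.1, 2 * t.2.2))
    (fun t => (t.1 / 2, t.2.1 / 2, t.2.2 / 2)) ?_ ?_ ?_ ?_ ?_
  · rintro ⟨x, y, z⟩ ht
    have := odd_of_mem_sellingTriples h ht
    simp only [Finset.mem_filter, mem_sellingTriples (by lia : 0 < n),
      mem_sellingTriples (by lia : 0 < 4 * n)] at ht ⊢
    push_cast
    refine ⟨⟨?_, ?_, ?_, ?_, ?_, ?_⟩, ?_⟩ <;> lia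
  · rintro ⟨x, y, z⟩ ht
    obtain ⟨hm, hx⟩ := Finset.mem_filter.1 ht
    obtain ⟨ox, oy, oz⟩ := even_of_mem_sellingTriples (by lia) hm
    rw [mem_sellingTriples (by lia)] at hm ⊢
    obtain ⟨p, rfl⟩ : ∃ p, x = 2 * p := ⟨x / 2, by lia⟩
    obtain ⟨q, rfl⟩ : ∃ q, y = 2 * q := ⟨y / 2, by lia⟩
    obtain ⟨r, rfl⟩ : ∃ r, z = 2 * r := ⟨z / 2, by lia⟩
    simp only at hx
    obtain ⟨hp, hq, hr, -, -, he⟩ := hm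
    push_cast at he
    simp only [Int.mul_ediv_cancel_left _ (two_ne_zero' ℤ)]
    refine ⟨?_, ?_, ?_, ?_, ?_, ?_⟩ <;> lia
  · rintro ⟨x, y, z⟩ -
    simp
  · rintro ⟨x, y, z⟩ ht
    obtain ⟨ox, oy, oz⟩ := even_of_mem_sellingTriples (by lia) (Finset.mem_filter.1 ht).1
    simp only [Prod.mk.injEq]
    lia
  · rintro ⟨x, y, z⟩ -
    simp [sellingWeight]

lemma sum_coneTriples_eq_two_mul_pos_trd (n : ℕ) :
    ∑ _t ∈ coneTriples n, (1 : ℚ) = 2 * ∑ t ∈ coneTriples n, if 0 < t.2.2 then (1 : ℚ) else 0 := by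
  have h1 := sum_coneTriples_neg_trd n (fun t => if 0 < t.2.2 then (1 : ℚ) else 0)
  rw [two_mul]
  nth_rewrite 1 [← h1]
  rw [← Finset.sum_add_distrib]
  refine Finset.sum_congr rfl ?_
  rintro ⟨u, v, w⟩ ht
  have := (mem_coneTriples.1 ht).2.1
  simp only
  split_ifs <;> first | (exfalso; lia) | norm_num

lemma sum_coneTriples_eq_two_mul_weight (n : ℕ) :
    ∑ _t ∈ coneTriples n, (1 : ℚ) = 2 * ∑ t ∈ coneTriples n,
      if 0 ≤ t.2.1 then (if t.2.1 = 0 then 1/2 else 1 : ℚ) else 0 := by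
  have h1 := sum_coneTriples_neg_snd n
    (fun t => if 0 ≤ t.2.1 then (if t.2.1 = 0 then 1/2 else 1 : ℚ) else 0)
  rw [two_mul]
  nth_rewrite 1 [← h1]
  rw [← Finset.sum_add_distrib]
  refine Finset.sum_congr rfl ?_
  rintro ⟨u, v, w⟩ -
  simp only
  split_ifs <;> first | (exfalso; lia) | norm_num

lemma sellingWeight_of_mem {n : ℕ} (h : n % 4 = 3) {t : ℤ × ℤ × ℤ} (ht : t ∈ sellingTriples n) :
    sellingWeight t = 1 := by
  have := odd_of_mem_sellingTriples h ht
  exact if_neg (by lia)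

/-- `3 H(4n)` exceeds `3 H(n)` by three times the number of odd Selling triples whose last two
entries agree modulo `4`. -/
lemma three_mul_hurwitzClassNumber_four_mul {n : ℕ} (h : n % 4 = 3) :
    3 * hurwitzClassNumber (4 * n) = 3 * hurwitzClassNumber n +
      3 * ∑ t ∈ sellingTriples n, if t.2.1 % 4 = t.2.2 % 4 then (1 : ℚ) else 0 := by
  have hn : 0 < 4 * n := by lia
  have h1 := sum_sellingTriples_rotate hn (fun t => if t.1 % 4 = 0 then sellingWeight t else 0)
  have h2 := sum_sellingTriples_rotate hn
    (fun t => if t.2.1 % 4 = 0 then sellingWeight (t.2.1, t.2.2, t.1) else 0)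
  have key : ∑ t ∈ sellingTriples (4 * n), sellingWeight t = ∑ t ∈ sellingTriples (4 * n),
      ((if t.1 % 4 = 0 ∨ t.2.1 % 4 = 0 ∨ t.2.2 % 4 = 0 then 0 else sellingWeight t) +
        (if t.1 % 4 = 0 then sellingWeight t else 0) +
        (if t.2.1 % 4 = 0 then sellingWeight (t.2.1, t.2.2, t.1) else 0) +
        (if t.2.2 % 4 = 0 then sellingWeight (t.2.2, t.1, t.2.1) else 0)) := by
    refine Finset.sum_congr rfl ?_
    rintro ⟨x, y, z⟩ ht
    have e1 := emod_of_mem_sellingTriples h ht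
    have e2 : y % 4 = 0 → z % 4 = 2 := fun hy => by
      rw [mem_sellingTriples hn] at ht
      refine (emod_of_mem_sellingTriples h (x := y) (y := z) (z := x) ?_ hy).1
      rw [mem_sellingTriples hn]
      lia
    have w1 : sellingWeight (y, z, x) = sellingWeight (x, y, z) := by grind [sellingWeight]
    have w2 : sellingWeight (z, x, y) = sellingWeight (x, y, z) := by grind [sellingWeight]
    simp only [w1, w2]
    split_ifs <;> first | lia | simp
  simp only [Finset.sum_add_distrib] at key
  have h3 := sum_coneTriples_pos_trd h
  have h4 := sum_coneTriples_weight h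
  have h5 := sum_coneTriples_eq_two_mul_pos_trd n
  have h6 := sum_coneTriples_eq_two_mul_weight n
  rw [three_mul_hurwitzClassNumber_s10 hn, three_mul_hurwitzClassNumber_s10 (by lia : 0 < n),
    ← sum_sellingTriples_double h]
  simp only at h1 h2 key
  linarith

lemma odd_mul_add_emod_eight {x y z : ℤ} (hx : x % 2 = 1) (hy : y % 2 = 1) (hz : z % 2 = 1) :
    (x * y + y * z + z * x) % 8 = if x % 4 = y % 4 ∧ y % 4 = z % 4 then 3 else 7 := by
  obtain ⟨a, i, hi, rfl⟩ : ∃ a i : ℤ, (i = 1 ∨ i = 3) ∧ x = 4 * a + i :=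
    ⟨x / 4, x % 4, by lia, by lia⟩
  obtain ⟨b, j, hj, rfl⟩ : ∃ b j : ℤ, (j = 1 ∨ j = 3) ∧ y = 4 * b + j :=
    ⟨y / 4, y % 4, by lia, by lia⟩
  obtain ⟨c, k, hk, rfl⟩ : ∃ c k : ℤ, (k = 1 ∨ k = 3) ∧ z = 4 * c + k :=
    ⟨z / 4, z % 4, by lia, by lia⟩
  rcases hi with rfl | rfl <;> rcases hj with rfl | rfl <;> rcases hk with rfl | rfl <;>
    ring_nf <;> split_ifs <;> lia

lemma emod_eq_of_mem_sellingTriples {n : ℕ} (h : n % 8 = 3) {x y z : ℤ}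
    (ht : (x, y, z) ∈ sellingTriples n) : x % 4 = y % 4 ∧ y % 4 = z % 4 := by
  obtain ⟨hx, hy, hz⟩ := odd_of_mem_sellingTriples (by lia) ht
  have h8 := odd_mul_add_emod_eight hx hy hz
  rw [((mem_sellingTriples (by lia)).1 ht).2.2.2.2.2] at h8
  split_ifs at h8 with hxyz
  · exact hxyz
  · lia

lemma sum_ite_emod_eq_of_mem_sellingTriples {n : ℕ} (h : n % 8 = 7) {x y z : ℤ}
    (ht : (x, y, z) ∈ sellingTriples n) :
    ((if y % 4 = z % 4 then 1 else 0) + (if z % 4 = x % 4 then 1 else 0) +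
      (if x % 4 = y % 4 then 1 else 0) : ℚ) = 1 := by
  obtain ⟨hx, hy, hz⟩ := odd_of_mem_sellingTriples (by lia) ht
  have h8 := odd_mul_add_emod_eight hx hy hz
  rw [((mem_sellingTriples (by lia)).1 ht).2.2.2.2.2] at h8
  split_ifs at h8 with hxyz
  · lia
  · split_ifs <;> first | (exfalso; lia) | norm_num

/-- For `n ≡ 3 (mod 4)`: `H(4n) = 4 H(n)` if `n ≡ 3 (mod 8)`, and `H(4n) = 2 H(n)` if
`n ≡ 7 (mod 8)`. -/
theorem hurwitz_four_mul (n : ℕ) (hn : 0 < n) (h : n % 4 = 3) :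
    (n % 8 = 3 → hurwitzClassNumber (4 * n) = 4 * hurwitzClassNumber n) ∧
    (n % 8 = 7 → hurwitzClassNumber (4 * n) = 2 * hurwitzClassNumber n) := by
  constructor
  · intro h8
    have h1 := three_mul_hurwitzClassNumber_four_mul h
    have h2 : 3 * hurwitzClassNumber n =
        ∑ t ∈ sellingTriples n, if t.2.1 % 4 = t.2.2 % 4 then (1 : ℚ) else 0 := by
      rw [three_mul_hurwitzClassNumber_s10 hn]
      refine Finset.sum_congr rfl fun t ht => ?_
      rw [sellingWeight_of_mem h ht, if_pos (emod_eq_of_mem_sellingTriples h8 ht).2]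
    linarith
  · intro h8
    have h1 := three_mul_hurwitzClassNumber_four_mul h
    have h2 := sum_sellingTriples_rotate hn
      (fun t => if t.2.1 % 4 = t.2.2 % 4 then (1 : ℚ) else 0)
    have h3 := sum_sellingTriples_rotate hn
      (fun t => if t.2.2 % 4 = t.1 % 4 then (1 : ℚ) else 0)
    have h4 : 3 * hurwitzClassNumber n = ∑ t ∈ sellingTriples n,
        ((if t.2.1 % 4 = t.2.2 % 4 then 1 else 0) + (if t.2.2 % 4 = t.1 % 4 then 1 else 0) +
          (if t.1 % 4 = t.2.1 % 4 then 1 else 0) : ℚ) := by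
      rw [three_mul_hurwitzClassNumber_s10 hn]
      refine Finset.sum_congr rfl fun t ht => ?_
      rw [sellingWeight_of_mem h ht, sum_ite_emod_eq_of_mem_sellingTriples h8 ht]
    simp only [Finset.sum_add_distrib] at h4
    simp only at h2 h3 h4
    linarith
end
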